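/- arXiv:1611.02231 — 2 statements merged into one kernel-verified Lean document; each statement's English description precedes it below -/
import Mathlib

section
/- Every graph that contains 4 pairwise edge-disjoint spanning trees is Z_3-connected; that is, for every mapping f : V(G) → Z_3 with |E(G)| ≡ Σ_{v∈V(G)} f(v) (mod 3), G admits an orientation such that d⁺(v) ≡ f(v) (mod 3) for every vertex v. -/
/-- A finite loopless multigraph on vertex type `V` with edge type `E`:
each edge `e` is given by its two (distinct) endpoints `fst e` and `snd e`.
Multiple edges are allowed, loops are not. -/
structure Multigraph (V : Type) (E : Type) where
  fst : E → V
  snd : E → V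
  loopless : ∀ e, fst e ≠ snd e

namespace Multigraph

variable {V E : Type} (G : Multigraph V E)

/-- `u` and `v` are joined by some edge belonging to the edge set `F`. -/
def AdjOn (F : Set E) (u v : V) : Prop :=
  ∃ e ∈ F, (G.fst e = u ∧ G.snd e = v) ∨ (G.fst e = v ∧ G.snd e = u)

/-- The subgraph with vertex set `S` and edge set `F` is a connected spanning
subgraph of the induced subgraph of `G` on `S`: all edges of `F` have both
endpoints in `S`, and any two vertices of `S` are joined by a walk using
edges of `F`. -/
def ConnectedWithin (S : Set V) (F : Set E) : Prop :=
  (∀ e ∈ F, G.fst e ∈ S ∧ G.snd e ∈ S) ∧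
    ∀ u ∈ S, ∀ v ∈ S, Relation.ReflTransGen (G.AdjOn F) u v

/-- The spanning subgraph of `G` with edge set `F` is connected. -/
def ConnectedOn (F : Set E) : Prop := G.ConnectedWithin Set.univ F

/-- `G` is a connected graph. -/
def Connected : Prop := G.ConnectedOn Set.univ

/-- `F` is the edge set of a spanning tree of the induced subgraph of `G`
on `S`, i.e. a minimal edge set making `S` connected. -/
def IsSpanningTreeWithin (S : Set V) (F : Set E) : Prop :=
  G.ConnectedWithin S F ∧ ∀ F' ⊆ F, G.ConnectedWithin S F' → F' = F

/-- `F` is the edge set of a spanning tree of `G`: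
a minimal edge set making `G` connected. -/
def IsSpanningTree (F : Set E) : Prop := G.IsSpanningTreeWithin Set.univ F

/-- `G` contains `t` pairwise edge-disjoint spanning trees. -/
def HasEdgeDisjointSpanningTrees (t : ℕ) : Prop :=
  ∃ T : Fin t → Set E, (∀ i, G.IsSpanningTree (T i)) ∧
    ∀ i j, i ≠ j → Disjoint (T i) (T j)

/-- The edge cut determined by the vertex set `S`: all edges with exactly
one endpoint in `S`. -/
def cutEdges (S : Set V) : Set E :=
  {e | (G.fst e ∈ S ∧ G.snd e ∉ S) ∨ (G.fst e ∉ S ∧ G.snd e ∈ S)}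

/-- `G` is `n`-edge-connected: it is connected and every edge cut has at
least `n` edges. -/
def EdgeConnected (n : ℕ) : Prop :=
  G.Connected ∧
    ∀ S : Set V, S.Nonempty → S ≠ Set.univ → n ≤ (G.cutEdges S).ncard

/-- An orientation of `G` is a map `o : E → Bool`: `o e = true` means `e` is
directed from `fst e` to `snd e`, and `o e = false` means the reverse.
`tail o e` is the initial vertex of `e` under the orientation `o`. -/
def tail (o : E → Bool) (e : E) : V := if o e then G.fst e else G.snd e

/-- The terminal vertex of the edge `e` under the orientation `o`. -/
def head (o : E → Bool) (e : E) : V := if o e then G.snd e else G.fst e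

/-- The number of edges belonging to `F` directed away from `v` by `o`. -/
noncomputable def outDegOn (F : Set E) (o : E → Bool) (v : V) : ℕ :=
  {e ∈ F | G.tail o e = v}.ncard

/-- The out-degree of `v` under the orientation `o`. -/
noncomputable def outDeg (o : E → Bool) (v : V) : ℕ := G.outDegOn Set.univ o v

/-- The in-degree of `v` under the orientation `o`. -/
noncomputable def inDeg (o : E → Bool) (v : V) : ℕ := {e | G.head o e = v}.ncard

/-- The degree of `v` in the spanning subgraph with edge set `F`
(there are no loops, so each edge at `v` counts once). -/
noncomputable def degOn (F : Set E) (v : V) : ℕ := {e ∈ F | G.fst e = v ∨ G.snd e = v}.ncard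

/-- `o` is an `f`-orientation of `G` (modulo `k`): the out-degree of every
vertex `v` is congruent to `f v` modulo `k`. -/
def IsModOrientation (k : ℕ) (f : V → ZMod k) (o : E → Bool) : Prop :=
  ∀ v, (G.outDeg o v : ZMod k) = f v

/-- `G` is `Z_3`-connected: for every `f : V → ZMod 3` with
`|E(G)| ≡ ∑ v, f v (mod 3)`, `G` has an `f`-orientation. -/
def Z3Connected [Fintype V] [Fintype E] : Prop :=
  ∀ f : V → ZMod 3, (Nat.card E : ZMod 3) = ∑ v, f v →
    ∃ o : E → Bool, G.IsModOrientation 3 f o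

/-- `G` is a simple graph: no two distinct edges have the same endpoints
(and there are no loops, by definition of `Multigraph`). -/
def IsSimple : Prop :=
  ∀ e e' : E, s(G.fst e, G.snd e) = s(G.fst e', G.snd e') → e = e'

/-- `G` admits a decomposition of its edge set into stars with `k` edges:
a partition of `E` into parts, each consisting of `k` edges sharing a
common center vertex. -/
def HasStarDecomposition (k : ℕ) : Prop :=
  ∃ P : Set (Set E), (∀ e : E, ∃! p, p ∈ P ∧ e ∈ p) ∧
    ∀ p ∈ P, ∃ c : V, (∀ e ∈ p, G.fst e = c ∨ G.snd e = c) ∧ p.ncard = k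

end Multigraph

namespace Z3Flow

/-- `x` is a sum of `m` signs `±1` in `ZMod 3`. -/
def Attainable (m : ℕ) (x : ZMod 3) : Prop := (m = 0 → x = 0) ∧ (m = 1 → x ≠ 0)

@[simp] lemma attainable_zero {x : ZMod 3} : Attainable 0 x ↔ x = 0 := by simp [Attainable]

@[simp] lemma attainable_one {x : ZMod 3} : Attainable 1 x ↔ x ≠ 0 := by simp [Attainable]

lemma attainable_of_two_le {m : ℕ} (h : 2 ≤ m) (x : ZMod 3) : Attainable m x :=
  ⟨fun _ => by omega, fun _ => by omega⟩

@[simp] lemma attainable_add_two {m : ℕ} {x : ZMod 3} : Attainable (m + 2) x ↔ True :=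
  iff_true_intro (attainable_of_two_le (by omega) x)

lemma Attainable.neg {m : ℕ} {x : ZMod 3} (h : Attainable m x) : Attainable m (-x) :=
  ⟨fun hm => by simp [h.1 hm], fun hm => by simpa using h.2 hm⟩

lemma Attainable.add {m k : ℕ} {x y : ZMod 3} (hx : Attainable m x) (hy : Attainable k y) :
    Attainable (m + k) (x + y) := by
  refine ⟨fun h => ?_, fun h => ?_⟩
  · rw [hx.1 (by omega), hy.1 (by omega), add_zero]
  · rcases Nat.add_eq_one_iff.1 h with ⟨h1, h2⟩ | ⟨h1, h2⟩
    · simpa [hx.1 h1] using hy.2 h2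
    · simpa [hy.1 h2] using hx.2 h1

lemma Attainable.exists_add {m k : ℕ} {x : ZMod 3} (h : Attainable (m + k) x) :
    ∃ a b, Attainable m a ∧ Attainable k b ∧ a + b = x := by
  rcases m with _ | _ | m <;> rcases k with _ | _ | k <;>
    simp only [zero_add, add_zero, attainable_zero, attainable_one, attainable_add_two] at h ⊢ <;>
    (first | (have h' := h; clear h; revert x; decide) | (clear h; revert x; decide))

lemma Attainable.sum {ι : Type*} {A : Finset ι} {m : ι → ℕ} {x : ι → ZMod 3}
    (h : ∀ i ∈ A, Attainable (m i) (x i)) : Attainable (∑ i ∈ A, m i) (∑ i ∈ A, x i) := by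
  classical
  induction A using Finset.induction_on with
  | empty => simp
  | insert a A ha ih =>
    rw [Finset.sum_insert ha, Finset.sum_insert ha]
    exact (h a (by simp)).add (ih fun i hi => h i (by simp [hi]))

lemma Attainable.exists_sum {ι : Type*} {A : Finset ι} {m : ι → ℕ} {x : ZMod 3}
    (h : Attainable (∑ i ∈ A, m i) x) :
    ∃ f : ι → ZMod 3, (∀ i ∈ A, Attainable (m i) (f i)) ∧ ∑ i ∈ A, f i = x := by
  classical
  induction A using Finset.induction_on generalizing x with
  | empty => exact ⟨0, by simp, by simpa [eq_comm] using h⟩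
  | insert a A ha ih =>
    rw [Finset.sum_insert ha] at h
    obtain ⟨b, y, hb, hy, rfl⟩ := h.exists_add
    obtain ⟨f, hf, rfl⟩ := ih hy
    refine ⟨Function.update f a b, fun i hi => ?_, ?_⟩
    · rcases Finset.mem_insert.1 hi with rfl | hi
      · simpa using hb
      · rw [Function.update_of_ne (ne_of_mem_of_not_mem hi ha)]
        exact hf i hi
    · rw [Finset.sum_insert ha, Function.update_self, Finset.sum_update_of_notMem ha]

variable {V : Type*}

/-- `n` is the net flow of an orientation of the multigraph with multiplicities `w` on `S`. -/
def Attains (S : Finset V) (w : V → V → ℕ) (n : V → V → ZMod 3) : Prop :=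
  (∀ i j, n j i = -n i j) ∧ ∀ i ∈ S, ∀ j ∈ S, i ≠ j → Attainable (w i j) (n i j)

lemma Attains.self {S : Finset V} {w : V → V → ℕ} {n : V → V → ZMod 3} (h : Attains S w n)
    (i : V) : n i i = 0 := by
  have := h.1 i i
  generalize n i i = x at this
  revert x; decide

/-- The multigraph with multiplicities `w` on `S` has an orientation with net outflow `γ`
modulo `3`. -/
def Solvable (S : Finset V) (w : V → V → ℕ) (γ : V → ZMod 3) : Prop :=
  ∃ n, Attains S w n ∧ ∀ i ∈ S, ∑ j ∈ S, n i j = γ i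

lemma Solvable.congr {S : Finset V} {w w' : V → V → ℕ} {γ γ' : V → ZMod 3}
    (h : Solvable S w γ) (hw : ∀ i ∈ S, ∀ j ∈ S, i ≠ j → w i j = w' i j)
    (hγ : ∀ i ∈ S, γ i = γ' i) : Solvable S w' γ' := by
  obtain ⟨n, hn, hs⟩ := h
  exact ⟨n, ⟨hn.1, fun i hi j hj hij => hw i hi j hj hij ▸ hn.2 i hi j hj hij⟩,
    fun i hi => (hs i hi).trans (hγ i hi)⟩

lemma solvable_of_card_le_one {S : Finset V} (hS : S.card ≤ 1) (w : V → V → ℕ) {γ : V → ZMod 3}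
    (hγ : ∑ i ∈ S, γ i = 0) : Solvable S w γ := by
  rw [Finset.card_le_one] at hS
  refine ⟨0, ⟨by simp, fun i hi j hj hij => (hij (hS i hi j hj)).elim⟩, fun i hi => ?_⟩
  rw [Finset.eq_singleton_iff_unique_mem.2 ⟨hi, fun j hj => hS j hj i hi⟩] at hγ
  simpa using hγ.symm

variable [DecidableEq V]

/-- The multiplicity function of a single edge `xy`. -/
def edge (x y : V) : V → V → ℕ := fun i j => if (i = x ∧ j = y) ∨ (i = y ∧ j = x) then 1 else 0

/-- The unit flow along the arc from `x` to `y`. -/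
def arc (x y : V) : V → V → ZMod 3 := fun i j =>
  (if i = x ∧ j = y then 1 else 0) - (if i = y ∧ j = x then 1 else 0)

lemma edge_symm (x y i j : V) : edge x y i j = edge x y j i := by
  unfold edge; congr 1; simp only [eq_iff_iff]; tauto

lemma arc_symm (x y i j : V) : arc x y j i = -arc x y i j := by
  unfold arc; simp only [and_comm]; ring

lemma sum_arc {S : Finset V} {x y : V} (hx : x ∈ S) (hy : y ∈ S) (i : V) :
    ∑ j ∈ S, arc x y i j = (if i = x then 1 else 0) - (if i = y then 1 else 0) := by
  unfold arc
  rw [Finset.sum_sub_distrib]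
  simp [ite_and, hx, hy, Finset.sum_ite_irrel]

lemma Attains.add_edge {S : Finset V} {w : V → V → ℕ} {n : V → V → ZMod 3} (h : Attains S w n)
    {x y : V} (hxy : x ≠ y) {ε : ZMod 3} (hε : ε ≠ 0) :
    Attains S (w + edge x y) (fun i j => n i j + ε * arc x y i j) := by
  refine ⟨fun i j => by simp only [h.1 i j, arc_symm x y i j]; ring, fun i hi j hj hij => ?_⟩
  refine (h.2 i hi j hj hij).add ?_
  unfold edge arc
  by_cases h1 : i = x ∧ j = y
  · obtain ⟨rfl, rfl⟩ := h1
    simp [hxy, hε]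
  · by_cases h2 : i = y ∧ j = x
    · obtain ⟨rfl, rfl⟩ := h2
      simp [hij, hε]
    · simp [h1, h2]

lemma Attains.remove_edge {S : Finset V} {w : V → V → ℕ} {n : V → V → ZMod 3}
    (hw : ∀ i j, w i j = w j i) {x y : V} (hx : x ∈ S) (hy : y ∈ S) (hxy : x ≠ y)
    (h : Attains S (w + edge x y) n) :
    ∃ ε : ZMod 3, ε ≠ 0 ∧ Attains S w (fun i j => n i j - ε * arc x y i j) := by
  have hatt := h.2 x hx y hy hxy
  have he : edge x y x y = 1 := by simp [edge]
  simp only [Pi.add_apply, he] at hatt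
  obtain ⟨a, b, ha, hb, hab⟩ := hatt.exists_add
  refine ⟨b, by simpa using hb,
    fun i j => by simp only [h.1 i j, arc_symm x y i j]; ring, fun i hi j hj hij => ?_⟩
  by_cases h1 : i = x ∧ j = y
  · obtain ⟨rfl, rfl⟩ := h1
    simpa [arc, hxy, ← hab] using ha
  · by_cases h2 : i = y ∧ j = x
    · obtain ⟨rfl, rfl⟩ := h2
      rw [hw]
      simpa [arc, hij, h.1 j i, ← hab, add_comm] using ha.neg
    · simpa [edge, arc, h1, h2] using h.2 i hi j hj hij

lemma Solvable.add_edge {S : Finset V} {w : V → V → ℕ} {γ : V → ZMod 3} {x y : V} (hx : x ∈ S)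
    (hy : y ∈ S) (hxy : x ≠ y) {ε : ZMod 3} (hε : ε ≠ 0)
    (h : Solvable S w (γ - Pi.single x ε + Pi.single y ε)) : Solvable S (w + edge x y) γ := by
  obtain ⟨n, hn, hs⟩ := h
  refine ⟨_, hn.add_edge hxy hε, fun i hi => ?_⟩
  rw [Finset.sum_add_distrib, hs i hi, ← Finset.mul_sum, sum_arc hx hy]
  simp only [Pi.add_apply, Pi.sub_apply, Pi.single_apply]
  split_ifs <;> ring

/-- Splitting off a pair of edges at `v`. -/
lemma Solvable.lift {S : Finset V} {w : V → V → ℕ} {γ : V → ZMod 3} {x y v : V}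
    (hw : ∀ i j, w i j = w j i) (hx : x ∈ S)
    (hy : y ∈ S) (hv : v ∈ S) (hxy : x ≠ y) (hxv : x ≠ v) (hvy : v ≠ y)
    (h : Solvable S (w + edge x y) γ) : Solvable S (w + edge x v + edge v y) γ := by
  obtain ⟨n, hn, hs⟩ := h
  obtain ⟨ε, hε, hn'⟩ := hn.remove_edge hw hx hy hxy
  refine ⟨_, (hn'.add_edge hxv hε).add_edge hvy hε, fun i hi => ?_⟩
  rw [Finset.sum_add_distrib, Finset.sum_add_distrib, Finset.sum_sub_distrib, hs i hi,
    ← Finset.mul_sum, ← Finset.mul_sum, ← Finset.mul_sum, sum_arc hx hy, sum_arc hx hv,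
    sum_arc hv hy]
  ring

lemma Solvable.of_erase {S : Finset V} {w : V → V → ℕ} {γ : V → ZMod 3} {v : V}
    (hw : ∀ i j, w i j = w j i) (hv : v ∈ S) {f : V → ZMod 3}
    (hf : ∀ j ∈ S.erase v, Attainable (w v j) (f j)) (hfs : ∑ j ∈ S.erase v, f j = γ v)
    (h : Solvable (S.erase v) w (γ + f)) : Solvable S w γ := by
  obtain ⟨n, hn, hs⟩ := h
  refine ⟨fun i j => if i = v then if j = v then 0 else f j else if j = v then -f i else n i j,
    ⟨fun i j => ?_, fun i hi j hj hij => ?_⟩, fun i hi => ?_⟩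
  · by_cases h1 : i = v <;> by_cases h2 : j = v <;> simp [h1, h2, hn.1 i j]
  · by_cases h1 : i = v
    · subst h1
      simpa [hij.symm] using hf j (by simp [hij.symm, hj])
    · by_cases h2 : j = v
      · subst h2
        rw [hw]
        simpa [h1] using (hf i (by simp [h1, hi])).neg
      · simpa [h1, h2] using hn.2 i (by simp [h1, hi]) j (by simp [h2, hj]) hij
  · rw [← Finset.add_sum_erase S _ hv]
    by_cases h1 : i = v
    · subst h1
      rw [← hfs]
      simp only [if_true, zero_add]
      exact Finset.sum_congr rfl fun j hj => by simp [(Finset.mem_erase.1 hj).1]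
    · have := hs i (by simp [h1, hi])
      simp only [h1, if_false, if_true]
      rw [Finset.sum_congr rfl (g := n i) fun j hj => by simp [(Finset.mem_erase.1 hj).1], this]
      simp

lemma solvable_pair {x y : V} (hxy : x ≠ y) {w : V → V → ℕ} (hw : ∀ i j, w i j = w j i)
    (h : 2 ≤ w x y) {γ : V → ZMod 3} (hγ : ∑ i ∈ {x, y}, γ i = 0) : Solvable {x, y} w γ := by
  have he : ({x, y} : Finset V).erase x = {y} := by
    ext i; simp only [Finset.mem_erase, Finset.mem_insert, Finset.mem_singleton]
    constructor
    · tauto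
    · rintro rfl; exact ⟨hxy.symm, Or.inr rfl⟩
  refine Solvable.of_erase hw (v := x) (f := fun _ => γ x) (by simp) ?_ ?_ ?_
  · rw [he]; simpa using attainable_of_two_le h _
  · rw [he]; simp
  · rw [he]
    refine solvable_of_card_le_one (by simp) w ?_
    rw [Finset.sum_pair hxy] at hγ
    simpa [add_comm] using hγ

/-- The map contracting `A` to the vertex `a`. -/
def contr (A : Finset V) (a : V) : V → V := fun i => if i ∈ A then a else i

/-- Multiplicities of the quotient of `S` by `π`. -/
def quot (S : Finset V) (π : V → V) (w : V → V → ℕ) : V → V → ℕ := fun u v =>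
  ∑ i ∈ S with π i = u, ∑ j ∈ S with π j = v, w i j

/-- Pushforward of a vertex weight along `π`. -/
def push {M : Type*} [AddCommMonoid M] (S : Finset V) (π : V → V) (c : V → M) : V → M := fun u =>
  ∑ i ∈ S with π i = u, c i

lemma image_contr {S A : Finset V} (hA : A ⊆ S) {a : V} (ha : a ∈ A) :
    S.image (contr A a) = insert a (S \ A) := by
  ext i
  simp only [contr, Finset.mem_image, Finset.mem_insert, Finset.mem_sdiff]
  constructor
  · rintro ⟨j, hj, rfl⟩
    split_ifs with h
    · exact Or.inl rfl
    · exact Or.inr ⟨hj, h⟩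
  · rintro (rfl | ⟨h1, h2⟩)
    · exact ⟨i, hA ha, by simp⟩
    · exact ⟨i, h1, by simp [h2]⟩

lemma filter_contr_self {S A : Finset V} (hA : A ⊆ S) {a : V} (ha : a ∈ A) :
    {i ∈ S | contr A a i = a} = A := by
  ext i
  rw [Finset.mem_filter, contr]
  constructor
  · rintro ⟨_, h⟩
    by_contra h'
    rw [if_neg h'] at h
    exact h' (h ▸ ha)
  · intro h
    exact ⟨hA h, by simp [h]⟩

lemma filter_contr_of_notMem {S A : Finset V} {a : V} (ha : a ∈ A) {u : V} (hu : u ∈ S \ A) :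
    {i ∈ S | contr A a i = u} = {u} := by
  rw [Finset.mem_sdiff] at hu
  ext i
  rw [Finset.mem_filter, Finset.mem_singleton, contr]
  constructor
  · rintro ⟨_, h⟩
    split_ifs at h with h'
    · exact (hu.2 (h ▸ ha)).elim
    · exact h
  · rintro rfl
    exact ⟨hu.1, by simp [hu.2]⟩

/-- A flow on the contraction of `A` extends to `S` if every compatible demand on `A` is
solvable. -/
lemma Solvable.of_contr {S A : Finset V} (hA : A ⊆ S) {a : V} (ha : a ∈ A) {w : V → V → ℕ}
    (hw : ∀ i j, w i j = w j i) {γ : V → ZMod 3}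
    (h : Solvable (S.image (contr A a)) (quot S (contr A a) w) (push S (contr A a) γ))
    (hsub : ∀ g : V → ZMod 3, (∀ i ∈ A, Attainable (∑ j ∈ S \ A, w i j) (g i)) →
      ∑ i ∈ A, g i = ∑ i ∈ A, γ i → Solvable A w (γ - g)) : Solvable S w γ := by
  obtain ⟨n, hn, hs⟩ := h
  rw [image_contr hA ha] at hn hs
  have haS : a ∉ S \ A := by simp [ha]
  have hex : ∀ j, ∃ f : V → ZMod 3, j ∈ S \ A →
      (∀ i ∈ A, Attainable (w i j) (f i)) ∧ ∑ i ∈ A, f i = n a j := by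
    intro j
    by_cases hj : j ∈ S \ A
    · have := hn.2 a (by simp) j (by simp [Finset.mem_sdiff.1 hj]) (by rintro rfl; exact haS hj)
      rw [quot, filter_contr_self hA ha, filter_contr_of_notMem ha hj] at this
      simp only [Finset.sum_singleton] at this
      obtain ⟨f, hf⟩ := this.exists_sum
      exact ⟨f, fun _ => hf⟩
    · exact ⟨0, fun h => (hj h).elim⟩
  choose f hf using hex
  obtain ⟨n2, hn2, hs2⟩ := hsub (fun i => ∑ j ∈ S \ A, f j i)
    (fun i hi => Attainable.sum fun j hj => (hf j hj).1 i hi) (by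
      rw [Finset.sum_comm, Finset.sum_congr rfl fun j hj => (hf j hj).2]
      have := hs a (by simp)
      rwa [Finset.sum_insert haS, hn.self, zero_add, push, filter_contr_self hA ha] at this)
  refine ⟨fun i j => if i ∈ A then if j ∈ A then n2 i j else f j i
    else if j ∈ A then -f i j else n i j, ⟨fun i j => ?_, fun i hi j hj hij => ?_⟩, fun i hi => ?_⟩
  · by_cases h1 : i ∈ A <;> by_cases h2 : j ∈ A <;> simp [h1, h2, hn.1 i j, hn2.1 i j]
  · by_cases h1 : i ∈ A <;> by_cases h2 : j ∈ A <;> simp only [h1, h2, if_true, if_false]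
    · exact hn2.2 i h1 j h2 hij
    · exact (hf j (by simp [hj, h2])).1 i h1
    · rw [hw]
      exact ((hf i (by simp [hi, h1])).1 j h2).neg
    · have hi' : i ∈ S \ A := by simp [hi, h1]
      have hj' : j ∈ S \ A := by simp [hj, h2]
      have := hn.2 i (by simp [hi, h1]) j (by simp [hj, h2]) hij
      rw [quot, filter_contr_of_notMem ha hi', filter_contr_of_notMem ha hj'] at this
      simpa using this
  · rw [← Finset.sum_sdiff hA, add_comm]
    by_cases h1 : i ∈ A
    · simp only [h1, if_true]
      rw [Finset.sum_congr rfl (g := n2 i) fun j hj => by simp [hj], hs2 i h1,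
        Finset.sum_congr rfl (g := fun j => f j i)
          fun j hj => by simp [(Finset.mem_sdiff.1 hj).2]]
      simp
    · have hi' : i ∈ S \ A := by simp [hi, h1]
      simp only [h1, if_false]
      rw [Finset.sum_congr (s₁ := A) rfl (g := fun j => -f i j) fun j hj => by simp [hj],
        Finset.sum_congr (s₁ := S \ A) rfl (g := n i) fun j hj => by simp [(Finset.mem_sdiff.1 hj).2],
        Finset.sum_neg_distrib, (hf i hi').2, ← hn.1 a i]
      have := hs i (by simp [hi, h1])
      rwa [Finset.sum_insert haS, push, filter_contr_of_notMem ha hi', Finset.sum_singleton] at this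

end Z3Flow

namespace Z3Flow

variable {V : Type*}

/-- The total demand on `A`, where `s i` is the prescribed net flow from `i` to the root. -/
def demand (γ s : V → ZMod 3) (A : Finset V) : ZMod 3 := ∑ i ∈ A, (γ i + s i)

lemma demand_single (γ s : V → ZMod 3) (x : V) : demand γ s {x} = γ x + s x := by
  simp [demand]

variable [DecidableEq V]

/-- The degree of the vertex set `A` in the multigraph on `S` with multiplicities `w` and `c i`
further edges from each vertex `i` to a root outside `S`. -/
def cut (S : Finset V) (w : V → V → ℕ) (c : V → ℕ) (A : Finset V) : ℕ :=
  ∑ i ∈ A, ∑ j ∈ S \ A, w i j + ∑ i ∈ A, c i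

lemma cut_add_edge {S A : Finset V} {w : V → V → ℕ} {c : V → ℕ} {x y : V}
    (hx : x ∈ S) (hy : y ∈ S) (hxy : x ≠ y) :
    cut S (w + edge x y) c A =
      cut S w c A + ((if x ∈ A ∧ y ∉ A then 1 else 0) + if y ∈ A ∧ x ∉ A then 1 else 0) := by
  have he : ∀ i j, edge x y i j =
      (if i = x ∧ j = y then 1 else 0) + if i = y ∧ j = x then 1 else 0 := by
    intro i j
    unfold edge
    by_cases h1 : i = x ∧ j = y
    · obtain ⟨rfl, rfl⟩ := h1
      simp [hxy]
    · simp [h1]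
  have hs : ∀ a b, b ∈ S → (∑ i ∈ A, ∑ j ∈ S \ A, if i = a ∧ j = b then 1 else 0) =
      if a ∈ A ∧ b ∉ A then 1 else 0 := by
    intro a b hb
    simp [ite_and, hb, Finset.sum_ite_irrel]
  unfold cut
  simp only [Pi.add_apply, he, Finset.sum_add_distrib, hs x y hy, hs y x hx]
  ring

lemma cut_add_single (S A : Finset V) (w : V → V → ℕ) (c : V → ℕ) (x : V) (k : ℕ) :
    cut S w (c + Pi.single x k) A = cut S w c A + if x ∈ A then k else 0 := by
  unfold cut
  simp [Finset.sum_add_distrib, Pi.single_apply, add_assoc]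

lemma cut_union {S A B : Finset V} {w : V → V → ℕ} (hw : ∀ i j, w i j = w j i) (c : V → ℕ)
    (hA : A ⊆ S) (hB : B ⊆ S) (hAB : Disjoint A B) :
    cut S w c A + cut S w c B = cut S w c (A ∪ B) + 2 * ∑ i ∈ A, ∑ j ∈ B, w i j := by
  have h1 : ∀ A B : Finset V, B ⊆ S → Disjoint A B → ∑ i ∈ A, ∑ j ∈ S \ A, w i j =
      ∑ i ∈ A, ∑ j ∈ S \ (A ∪ B), w i j + ∑ i ∈ A, ∑ j ∈ B, w i j := by
    intro A B hB hAB
    rw [← Finset.sum_add_distrib]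
    refine Finset.sum_congr rfl fun i _ => ?_
    rw [← Finset.sum_sdiff (Finset.subset_sdiff.2 ⟨hB, hAB.symm⟩), sdiff_sdiff_left]
    rfl
  have h2 : ∑ i ∈ B, ∑ j ∈ A, w i j = ∑ i ∈ A, ∑ j ∈ B, w i j := by
    rw [Finset.sum_comm]
    exact Finset.sum_congr rfl fun i _ => Finset.sum_congr rfl fun j _ => hw j i
  unfold cut
  rw [h1 A B hB hAB, h1 B A hA hAB.symm, h2, Finset.sum_union hAB, Finset.sum_union hAB,
    Finset.union_comm B A]
  ring

lemma cut_self (S : Finset V) (w : V → V → ℕ) (c : V → ℕ) : cut S w c S = ∑ i ∈ S, c i := by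
  simp [cut]

lemma sum_fibers {M : Type*} [AddCommMonoid M] (S B : Finset V) (π : V → V) (f : V → M) :
    ∑ u ∈ B, ∑ i ∈ S with π i = u, f i = ∑ i ∈ S with π i ∈ B, f i := by
  rw [← Finset.sum_fiberwise_of_maps_to (s := {i ∈ S | π i ∈ B}) (t := B) (g := π)
    (fun i hi => (Finset.mem_filter.1 hi).2)]
  refine Finset.sum_congr rfl fun u hu => ?_
  rw [Finset.filter_filter]
  refine Finset.sum_congr (Finset.filter_congr fun i _ => ?_) fun _ _ => rfl
  constructor
  · rintro rfl; exact ⟨hu, rfl⟩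
  · exact fun h => h.2

lemma sum_quot (S B C : Finset V) (π : V → V) (w : V → V → ℕ) :
    ∑ u ∈ B, ∑ v ∈ C, quot S π w u v =
      ∑ i ∈ S with π i ∈ B, ∑ j ∈ S with π j ∈ C, w i j := by
  rw [← sum_fibers]
  refine Finset.sum_congr rfl fun u _ => ?_
  unfold quot
  rw [Finset.sum_comm]
  exact Finset.sum_congr rfl fun i _ => sum_fibers S C π _

lemma cut_quot (S B : Finset V) (π : V → V) (w : V → V → ℕ) (c : V → ℕ) :
    cut (S.image π) (quot S π w) (push S π c) B = cut S w c {i ∈ S | π i ∈ B} := by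
  unfold cut push
  rw [sum_quot, sum_fibers]
  congr 1
  refine Finset.sum_congr rfl fun i _ => Finset.sum_congr ?_ fun _ _ => rfl
  ext j
  simp only [Finset.mem_filter, Finset.mem_sdiff, Finset.mem_image]
  constructor
  · rintro ⟨h1, _, h2⟩; exact ⟨h1, fun h => h2 h.2⟩
  · rintro ⟨h1, h2⟩; exact ⟨h1, ⟨j, h1, rfl⟩, fun h => h2 ⟨h1, h⟩⟩

lemma quot_symm {w : V → V → ℕ} (hw : ∀ i j, w i j = w j i) (S : Finset V) (π : V → V) (u v : V) :
    quot S π w u v = quot S π w v u := by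
  unfold quot
  rw [Finset.sum_comm]
  simp only [fun i j => hw j i]

lemma demand_quot (S B : Finset V) (π : V → V) (γ s : V → ZMod 3) :
    demand (push S π γ) (push S π s) B = demand γ s {i ∈ S | π i ∈ B} := by
  unfold demand push
  simp only [Finset.sum_add_distrib, sum_fibers]

lemma demand_add_single_sub (γ s : V → ZMod 3) (x y : V) (ε : ZMod 3) (A : Finset V) :
    demand (γ - Pi.single x ε + Pi.single y ε) s A =
      demand γ s A - (if x ∈ A then ε else 0) + if y ∈ A then ε else 0 := by
  unfold demand
  simp only [Pi.add_apply, Pi.sub_apply, Finset.sum_add_distrib, Finset.sum_sub_distrib,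
    Pi.single_apply, Finset.sum_ite_eq']
  ring

lemma demand_union (γ s : V → ZMod 3) {A B : Finset V} (h : Disjoint A B) :
    demand γ s (A ∪ B) = demand γ s A + demand γ s B := Finset.sum_union h

/-- `d ≥ 4 + |τ|`, where `τ ∈ {0, ±1, ±2, 3}` has the parity of `d` and the residue `b`. -/
def Big (d : ℕ) (b : ZMod 3) : Prop := 6 ≤ d ∨ d = 5 ∧ b ≠ 0 ∨ d = 4 ∧ b = 0

/-- `d ≥ 6 + |τ|`, where `τ ∈ {0, ±1, ±2, 3}` has the parity of `d` and the residue `b`. -/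
def Huge (d : ℕ) (b : ZMod 3) : Prop := 8 ≤ d ∨ d = 7 ∧ b ≠ 0 ∨ d = 6 ∧ b = 0

/-- `d ≤ 4 + |τ|`, where `τ ∈ {0, ±1, ±2, 3}` has the parity of `d` and the residue `b`. -/
def Small (d : ℕ) (b : ZMod 3) : Prop := d ≤ 5 ∨ d = 6 ∧ b ≠ 0 ∨ d = 7 ∧ b = 0

lemma Big.four_le {d : ℕ} {b : ZMod 3} (h : Big d b) : 4 ≤ d := by unfold Big at h; omega

lemma Huge.six_le {d : ℕ} {b : ZMod 3} (h : Huge d b) : 6 ≤ d := by unfold Huge at h; omega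

lemma Small.le_seven {d : ℕ} {b : ZMod 3} (h : Small d b) : d ≤ 7 := by unfold Small at h; omega

lemma big_of_six_le {d : ℕ} (h : 6 ≤ d) (b : ZMod 3) : Big d b := Or.inl h

lemma huge_or_small (d : ℕ) (b : ZMod 3) : Huge d b ∨ Small d b := by
  unfold Huge Small
  by_cases hb : b = 0 <;> simp [hb] <;> omega

lemma Huge.big_of_add_one {d : ℕ} {b ε : ZMod 3} (h : Huge (d + 1) b) (hε : ε ≠ 0) :
    Big d (b + ε) := by
  unfold Big Huge at *
  by_cases hb : b = 0
  · simp [hb, hε] at *; omega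
  · simp [hb] at *; omega

lemma Huge.big_of_add_two {d : ℕ} {b : ZMod 3} (h : Huge (d + 2) b) : Big d b := by
  unfold Big Huge at *
  by_cases hb : b = 0 <;> simp [hb] at * <;> omega

lemma Small.of_add_one {d : ℕ} {b ε : ZMod 3} (h : Small (d + 1) b) (hε : ε ≠ 0) :
    Small d (b + ε) := by
  unfold Small at *
  by_cases hb : b = 0
  · simp [hb, hε] at *; omega
  · simp [hb] at *; omega

/-- The hypotheses on a multigraph on `S` joined to a root by pre-oriented edges under which the
pre-orientation extends. -/
structure Good (S : Finset V) (w : V → V → ℕ) (c : V → ℕ) (γ s : V → ZMod 3) : Prop where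
  symm : ∀ i j, w i j = w j i
  sum_eq : ∑ i ∈ S, γ i = 0
  att : ∀ i ∈ S, Attainable (c i) (s i)
  big : ∀ A ⊆ S, A.Nonempty → A ≠ S → Big (cut S w c A) (demand γ s A)
  small : Small (∑ i ∈ S, c i) (∑ i ∈ S, s i)

variable {S : Finset V} {w : V → V → ℕ} {c : V → ℕ} {γ s : V → ZMod 3}

lemma Good.demand_self (h : Good S w c γ s) : demand γ s S = ∑ i ∈ S, s i := by
  unfold demand
  rw [Finset.sum_add_distrib, h.sum_eq, zero_add]

lemma filter_mem_image (S : Finset V) (π : V → V) : {i ∈ S | π i ∈ S.image π} = S :=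
  Finset.filter_true_of_mem fun _ hi => Finset.mem_image_of_mem π hi

lemma Good.quot (h : Good S w c γ s) (π : V → V) :
    Good (S.image π) (quot S π w) (push S π c) (push S π γ) (push S π s) where
  symm := quot_symm h.symm S π
  sum_eq := by
    unfold push
    rw [sum_fibers, filter_mem_image, h.sum_eq]
  att u _ := Attainable.sum fun i hi => h.att i (Finset.mem_filter.1 hi).1
  big A hA hne hAS := by
    rw [cut_quot, demand_quot]
    refine h.big _ (Finset.filter_subset _ _) ?_ fun heq => hAS (hA.antisymm fun u hu => ?_)
    · obtain ⟨u, hu⟩ := hne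
      obtain ⟨i, hi, rfl⟩ := Finset.mem_image.1 (hA hu)
      exact ⟨i, Finset.mem_filter.2 ⟨hi, hu⟩⟩
    · obtain ⟨i, hi, rfl⟩ := Finset.mem_image.1 hu
      rw [← heq] at hi
      exact (Finset.mem_filter.1 hi).2
  small := by
    unfold push
    rw [sum_fibers, sum_fibers, filter_mem_image]
    exact h.small

lemma sdiff_sdiff_union {S A B : Finset V} (hA : A ⊆ S) (hB : B ⊆ A) :
    S \ B = A \ B ∪ S \ A := by
  ext i
  have := @hA i
  have := @hB i
  simp only [Finset.mem_sdiff, Finset.mem_union]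
  tauto

lemma cut_restrict {A B : Finset V} (hA : A ⊆ S) (hB : B ⊆ A) (w : V → V → ℕ) (c : V → ℕ) :
    cut A w (c + fun i => ∑ j ∈ S \ A, w i j) B = cut S w c B := by
  unfold cut
  have hd : Disjoint (A \ B) (S \ A) :=
    Finset.disjoint_left.2 fun i hi hi' => (Finset.mem_sdiff.1 hi').2 (Finset.mem_sdiff.1 hi).1
  simp only [sdiff_sdiff_union hA hB, Finset.sum_union hd, Pi.add_apply, Finset.sum_add_distrib]
  ring

lemma Good.restrict (h : Good S w c γ s) {A : Finset V} (hA : A ⊆ S) (hAS : A ≠ S)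
    (hsmall : Small (cut S w c A) (demand γ s A)) {g : V → ZMod 3}
    (hg : ∀ i ∈ A, Attainable (∑ j ∈ S \ A, w i j) (g i)) (hsum : ∑ i ∈ A, g i = ∑ i ∈ A, γ i) :
    Good A w (c + fun i => ∑ j ∈ S \ A, w i j) (γ - g) (s + g) where
  symm := h.symm
  sum_eq := by simp [Finset.sum_sub_distrib, hsum]
  att i hi := (h.att i (hA hi)).add (hg i hi)
  big B hB hne _ := by
    rw [cut_restrict hA hB]
    have : demand (γ - g) (s + g) B = demand γ s B :=
      Finset.sum_congr rfl fun i _ => by simp only [Pi.sub_apply, Pi.add_apply]; ring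
    rw [this]
    exact h.big B (hB.trans hA) hne (by rintro rfl; exact hAS (hA.antisymm hB))
  small := by
    rw [← cut_self A w, cut_restrict hA subset_rfl]
    convert hsmall using 1
    simp only [demand, Pi.add_apply, Finset.sum_add_distrib, hsum, add_comm]

lemma card_image_contr_lt {A : Finset V} (hA : A ⊆ S) {a : V} (ha : a ∈ A) (h2 : 2 ≤ A.card) :
    (S.image (contr A a)).card < S.card := by
  rw [image_contr hA ha, Finset.card_insert_of_notMem (by simp [ha]), Finset.card_sdiff_of_subset hA]
  have := Finset.card_le_card hA
  omega

lemma Good.solvable_of_small_cut (h : Good S w c γ s)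
    (ih : ∀ S' : Finset V, S'.card < S.card → ∀ w' c' γ' s', Good S' w' c' γ' s' →
      Solvable S' w' γ')
    {A : Finset V} (hA : A ⊆ S) (hAS : A ≠ S) (h2 : 2 ≤ A.card)
    (hsmall : Small (cut S w c A) (demand γ s A)) : Solvable S w γ := by
  obtain ⟨a, ha⟩ : A.Nonempty := Finset.card_pos.1 (by omega)
  refine Solvable.of_contr hA ha h.symm (ih _ (card_image_contr_lt hA ha h2) _ _ _ _ (h.quot _))
    fun g hg hsum => ih A (Finset.card_lt_card (hA.ssubset_of_ne hAS)) _ _ _ _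
      (h.restrict hA hAS hsmall hg hsum)

lemma Good.solvable_of_parallel (h : Good S w c γ s)
    (ih : ∀ S' : Finset V, S'.card < S.card → ∀ w' c' γ' s', Good S' w' c' γ' s' →
      Solvable S' w' γ')
    {x y : V} (hx : x ∈ S) (hy : y ∈ S) (hxy : x ≠ y) (h2 : 2 ≤ w x y) : Solvable S w γ := by
  have hA : {x, y} ⊆ S := by simp [Finset.insert_subset_iff, hx, hy]
  have ha : x ∈ ({x, y} : Finset V) := by simp
  refine Solvable.of_contr hA ha h.symm
    (ih _ (card_image_contr_lt hA ha (Finset.card_pair hxy).ge) _ _ _ _ (h.quot _))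
    fun g _ hsum => solvable_pair hxy h.symm h2 ?_
  simp [Finset.sum_sub_distrib, hsum]

end Z3Flow

namespace Z3Flow

variable {V : Type*} [DecidableEq V] {S : Finset V} {w : V → V → ℕ} {c : V → ℕ}
  {γ s : V → ZMod 3}

lemma sub_edge_add (hw : ∀ i j, w i j = w j i) {x y : V} (h : 1 ≤ w x y) :
    w - edge x y + edge x y = w := by
  refine tsub_add_cancel_of_le fun i j => ?_
  unfold edge
  split_ifs with hij
  · rcases hij with ⟨rfl, rfl⟩ | ⟨rfl, rfl⟩
    · exact h
    · rwa [hw]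
  · exact Nat.zero_le _

lemma sub_edge_symm (hw : ∀ i j, w i j = w j i) (x y i j : V) :
    (w - edge x y) i j = (w - edge x y) j i := by
  simp only [Pi.sub_apply, hw i j, edge_symm x y i j]

/-- Splitting off the pair of edges from `x` to `y` and `z`. -/
lemma Solvable.of_lift (hw : ∀ i j, w i j = w j i) {x y z : V} (hx : x ∈ S)
    (hy : y ∈ S.erase x) (hz : z ∈ S.erase x) (hyz : y ≠ z) (hwy : 1 ≤ w x y) (hwz : 1 ≤ w x z)
    (h : Solvable S (w - edge x z - edge y x + edge y z) γ) : Solvable S w γ := by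
  obtain ⟨hyx, hyS⟩ := Finset.mem_erase.1 hy
  obtain ⟨hzx, hzS⟩ := Finset.mem_erase.1 hz
  have h1 : 1 ≤ (w - edge x z) y x := by
    simpa [edge, hyx, hyz, hw y x] using hwy
  rw [← sub_edge_add hw hwz, ← sub_edge_add (sub_edge_symm hw x z) h1]
  exact Solvable.lift (sub_edge_symm (sub_edge_symm hw x z) y x) hyS hzS hx hyz hyx hzx.symm h

lemma lift_symm (hw : ∀ i j, w i j = w j i) (x y z i j : V) :
    (w - edge x z - edge y x + edge y z) i j = (w - edge x z - edge y x + edge y z) j i := by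
  simp only [Pi.add_apply, sub_edge_symm (sub_edge_symm hw x z) y x i j, edge_symm y z i j]

lemma lift_apply {x y z j : V} (hy : y ∈ S.erase x) (hz : z ∈ S.erase x) (hyz : y ≠ z)
    (hj : j ∈ S.erase x) : (w - edge x z - edge y x + edge y z) x j =
      w x j - ((if j = y then 1 else 0) + if j = z then 1 else 0) := by
  have hyx := Finset.ne_of_mem_erase hy
  have hzx := Finset.ne_of_mem_erase hz
  have hjx := Finset.ne_of_mem_erase hj
  simp only [Pi.add_apply, Pi.sub_apply, edge]
  by_cases h2 : j = y <;> by_cases h3 : j = z <;>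
    simp [h2, h3, hyx, hzx, hyx.symm, hzx.symm, hyz, hyz.symm]

lemma lift_apply_of_mem {x y z i j : V} (hi : i ∈ S.erase x) (hj : j ∈ S.erase x) :
    (w - edge x z - edge y x + edge y z) i j = (w + edge y z) i j := by
  simp [edge, (Finset.mem_erase.1 hi).1, (Finset.mem_erase.1 hj).1]

/-- Splitting off the pair of edges from `x` to `y` and `z`, then deleting `x`. -/
lemma Solvable.of_lift_erase (hw : ∀ i j, w i j = w j i) {x y z : V} (hx : x ∈ S)
    (hy : y ∈ S.erase x) (hz : z ∈ S.erase x) (hyz : y ≠ z) (hwy : 1 ≤ w x y) (hwz : 1 ≤ w x z)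
    {f : V → ZMod 3}
    (hf : ∀ j ∈ S.erase x, Attainable (w x j - ((if j = y then 1 else 0) + if j = z then 1 else 0))
      (f j))
    (hfs : ∑ j ∈ S.erase x, f j = γ x)
    (h : Solvable (S.erase x) (w + edge y z) (γ + f)) : Solvable S w γ :=
  Solvable.of_lift hw hx hy hz hyz hwy hwz (Solvable.of_erase (lift_symm hw x y z) hx
    (fun j hj => by rw [lift_apply hy hz hyz hj]; exact hf j hj) hfs
    (h.congr (fun _ hi _ hj _ => (lift_apply_of_mem hi hj).symm) fun _ _ => rfl))

lemma cut_sub_edge (hw : ∀ i j, w i j = w j i) {A : Finset V} {x y : V}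
    (hx : x ∈ S) (hy : y ∈ S) (hxy : x ≠ y) (h : 1 ≤ w x y) :
    cut S (w - edge x y) c A +
      ((if x ∈ A ∧ y ∉ A then 1 else 0) + if y ∈ A ∧ x ∉ A then 1 else 0) = cut S w c A := by
  rw [← cut_add_edge hx hy hxy, sub_edge_add hw h]

lemma cut_singleton (x : V) : cut S w c {x} = ∑ j ∈ S.erase x, w x j + c x := by
  simp [cut, Finset.sdiff_singleton_eq_erase]

lemma cut_erase {x : V} (hx : x ∈ S) {A : Finset V} (hA : A ⊆ S.erase x) :
    cut (S.erase x) w c A + ∑ i ∈ A, w i x = cut S w c A := by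
  have h1 : S \ A = insert x (S.erase x \ A) := by
    ext i
    have := @hA i
    simp only [Finset.mem_sdiff, Finset.mem_erase, Finset.mem_insert] at *
    by_cases h : i = x
    · subst h; tauto
    · tauto
  unfold cut
  rw [h1]
  simp only [Finset.sum_insert (show x ∉ S.erase x \ A by simp), Finset.sum_add_distrib]
  ring

lemma cut_compl_singleton (hw : ∀ i j, w i j = w j i) {x : V} (hx : x ∈ S) :
    cut S w c (S.erase x) + 2 * c x = cut S w c {x} + ∑ i ∈ S, c i := by
  have h := cut_union hw c (S := S) (A := {x}) (B := S.erase x) (by simpa) (Finset.erase_subset _ _)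
    (by simp)
  rw [show {x} ∪ S.erase x = S by rw [← Finset.insert_eq, Finset.insert_erase hx], cut_self,
    Finset.sum_singleton] at h
  have := cut_singleton (S := S) (w := w) (c := c) x
  omega

lemma demand_compl_singleton (h : Good S w c γ s) {x : V} (hx : x ∈ S) :
    demand γ s (S.erase x) = ∑ i ∈ S, s i - (γ x + s x) := by
  rw [← h.demand_self]
  unfold demand
  rw [← Finset.add_sum_erase S _ hx]
  ring

/-- A `Good` instance to which neither contraction of a small cut nor contraction of a pair of
parallel edges applies. -/
structure Reduced (S : Finset V) (w : V → V → ℕ) (c : V → ℕ) (γ s : V → ZMod 3) : Prop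
    extends Good S w c γ s where
  huge : ∀ A ⊆ S, 2 ≤ A.card → A ≠ S → Huge (cut S w c A) (demand γ s A)
  simple : ∀ x ∈ S, ∀ y ∈ S, x ≠ y → w x y ≤ 1
  two_lt : 2 < S.card

lemma Reduced.big_singleton (h : Reduced S w c γ s) {x : V} (hx : x ∈ S) :
    Big (cut S w c {x}) (γ x + s x) := by
  rw [← demand_single]
  refine h.big {x} (by simpa) (by simp) ?_
  rintro rfl
  simpa using h.two_lt

lemma Reduced.huge_erase (h : Reduced S w c γ s) {x : V} (hx : x ∈ S) :
    Huge (cut S w c (S.erase x)) (∑ i ∈ S, s i - (γ x + s x)) := by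
  rw [← demand_compl_singleton h.toGood hx]
  have := h.two_lt
  refine h.huge _ (Finset.erase_subset _ _) ?_ ?_
  · rw [Finset.card_erase_of_mem hx]; omega
  · intro he
    rw [← he] at hx
    simp at hx

lemma Good.of_singleton (symm : ∀ i j, w i j = w j i) (sum_eq : ∑ i ∈ S, γ i = 0)
    (att : ∀ i ∈ S, Attainable (c i) (s i))
    (big₁ : ∀ i ∈ S, Big (cut S w c {i}) (γ i + s i))
    (big₂ : ∀ A ⊆ S, 2 ≤ A.card → A ≠ S → Big (cut S w c A) (demand γ s A))
    (small : Small (∑ i ∈ S, c i) (∑ i ∈ S, s i)) : Good S w c γ s where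
  symm := symm
  sum_eq := sum_eq
  att := att
  big A hA hne hAS := by
    rcases Nat.lt_or_ge A.card 2 with h2 | h2
    · have := hne.card_pos
      obtain ⟨x, rfl⟩ := Finset.card_eq_one.1 (show A.card = 1 by omega)
      rw [demand_single]
      exact big₁ x (hA (by simp))
    · exact big₂ A hA h2 hAS
  small := small

lemma Reduced.delete_root_edge {x : V} (h : Reduced S w (c + Pi.single x 1) γ s) (hx : x ∈ S)
    {ε : ZMod 3} (hε : ε ≠ 0) (hatt : Attainable (c x) (s x - ε))
    (hbig : Big (cut S w c {x}) (γ x + s x - ε)) : Good S w c γ (s - Pi.single x ε) := by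
  have hd : ∀ A, demand γ (s - Pi.single x ε) A = demand γ s A - if x ∈ A then ε else 0 := by
    intro A
    simp only [demand, Pi.sub_apply, Finset.sum_add_distrib, Finset.sum_sub_distrib,
      Pi.single_apply, Finset.sum_ite_eq']
    ring
  refine Good.of_singleton h.symm h.sum_eq (fun i hi => ?_) (fun i hi => ?_)
    (fun A hA h2 hAS => ?_) ?_
  · by_cases hix : i = x
    · subst hix; simpa using hatt
    · simpa [hix] using h.att i hi
  · by_cases hix : i = x
    · subst hix; simpa [add_sub_assoc] using hbig
    · simpa [hix, cut_add_single, Ne.symm hix] using h.big_singleton hi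
  · have := h.huge A hA h2 hAS
    rw [cut_add_single] at this
    rw [hd]
    by_cases hxA : x ∈ A
    · simp only [hxA, if_true] at this ⊢
      rw [sub_eq_add_neg]
      exact this.big_of_add_one (neg_ne_zero.2 hε)
    · simp only [hxA, if_false, sub_zero] at this ⊢
      exact big_of_six_le this.six_le _
  · have := h.small
    simp only [Pi.add_apply, Pi.sub_apply, Finset.sum_add_distrib, Finset.sum_sub_distrib,
      Pi.single_apply, Finset.sum_ite_eq', hx, if_true] at this ⊢
    rw [sub_eq_add_neg]
    exact this.of_add_one (neg_ne_zero.2 hε)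

/-- Deleting an edge `xy` oriented with value `ε`, while adding `k` edges from `x` to the root. -/
lemma Reduced.delete_edge (h : Reduced S w c γ s) {x y : V} (hx : x ∈ S) (hy : y ∈ S)
    (hxy : x ≠ y) (hw : 1 ≤ w x y) (k : ℕ) {ε : ZMod 3} (hε : ε ≠ 0)
    (hatt : Attainable (c x + k) (s x)) (hsmall : Small (∑ i ∈ S, c i + k) (∑ i ∈ S, s i))
    (hbx : Big (cut S w c {x} + k - 1) (γ x + s x - ε))
    (hby : Big (cut S w c {y} - 1) (γ y + s y + ε)) :
    Good S (w - edge x y) (c + Pi.single x k) (γ - Pi.single x ε + Pi.single y ε) s := by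
  have hc := fun A => cut_sub_edge (c := c) (A := A) h.symm hx hy hxy hw
  refine Good.of_singleton (sub_edge_symm h.symm x y) ?_ (fun i hi => ?_) (fun i hi => ?_)
    (fun A hA h2 hAS => ?_) ?_
  · simp [Finset.sum_add_distrib, Finset.sum_sub_distrib, Pi.single_apply, hx, hy, h.sum_eq]
  · by_cases hix : i = x
    · subst hix; simpa using hatt
    · simpa [hix] using h.att i hi
  · have hci := hc {i}
    rw [cut_add_single]
    by_cases hix : i = x
    · subst hix
      simp only [Finset.mem_singleton, hxy.symm, not_false_eq_true, and_self, if_true, not_true,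
        if_false] at hci ⊢
      convert hbx using 1
      · omega
      · simp [hxy]; ring
    · by_cases hiy : i = y
      · subst hiy
        simp only [Finset.mem_singleton, hxy, not_false_eq_true, and_self, if_true, not_true,
          if_false] at hci ⊢
        convert hby using 1
        · omega
        · simp [hxy.symm]; ring
      · simp only [Finset.mem_singleton, Ne.symm hix, Ne.symm hiy, false_and, if_false] at hci ⊢
        simpa [hci, hix, hiy] using h.big_singleton hi
  · have hh := h.huge A hA h2 hAS
    have hcA := hc A
    rw [cut_add_single, demand_add_single_sub]
    rw [← hcA] at hh
    by_cases hxA : x ∈ A <;> by_cases hyA : y ∈ A <;>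
      simp only [hxA, hyA, not_true, not_false_eq_true, and_self, and_true, and_false, if_true, if_false,
        add_zero, zero_add, sub_zero] at hh ⊢
    · exact big_of_six_le (by have := hh.six_le; omega) _
    · rcases Nat.eq_zero_or_pos k with rfl | hk
      · rw [sub_eq_add_neg]
        exact hh.big_of_add_one (neg_ne_zero.2 hε)
      · exact big_of_six_le (by have := hh.six_le; omega) _
    · exact hh.big_of_add_one hε
    · exact big_of_six_le hh.six_le _
  · simpa [Finset.sum_add_distrib, Pi.single_apply, hx] using hsmall

end Z3Flow

namespace Z3Flow

variable {V : Type*} [DecidableEq V] {S : Finset V} {w : V → V → ℕ} {c : V → ℕ}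
  {γ s : V → ZMod 3}

/-- The neighbours of `x` in `S`. -/
def nbrs (S : Finset V) (w : V → V → ℕ) (x : V) : Finset V := {y ∈ S.erase x | 1 ≤ w x y}

lemma Reduced.eq_ite (h : Reduced S w c γ s) {x : V} (hx : x ∈ S) {y : V} (hy : y ∈ S.erase x) :
    w x y = if y ∈ nbrs S w x then 1 else 0 := by
  have := h.simple x hx y (Finset.mem_of_mem_erase hy) (Finset.ne_of_mem_erase hy).symm
  simp only [nbrs, Finset.mem_filter, hy, true_and]
  split_ifs <;> omega

lemma Reduced.card_nbrs (h : Reduced S w c γ s) {x : V} (hx : x ∈ S) :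
    (nbrs S w x).card + c x = cut S w c {x} := by
  rw [cut_singleton, Finset.sum_congr rfl fun y hy => h.eq_ite hx hy, Finset.sum_boole,
    Finset.filter_mem_eq_inter,
    Finset.inter_eq_right.2 (show nbrs S w x ⊆ S.erase x from Finset.filter_subset _ _), Nat.cast_id]

lemma Reduced.sum_eq_card (h : Reduced S w c γ s) {x : V} (hx : x ∈ S) {A : Finset V}
    (hA : A ⊆ S.erase x) : ∑ i ∈ A, w i x = ∑ y ∈ nbrs S w x, if y ∈ A then 1 else 0 := by
  rw [Finset.sum_congr rfl fun i hi => (h.symm i x).trans (h.eq_ite hx (hA hi)),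
    Finset.sum_boole, Finset.sum_boole, Finset.filter_mem_eq_inter, Finset.filter_mem_eq_inter,
    Finset.inter_comm]

lemma Reduced.ne_of_subset_erase {x : V} (hx : x ∈ S) {A : Finset V} (hA : A ⊆ S.erase x) :
    A ≠ S := by
  rintro rfl
  simpa using hA hx

lemma exists_eq_of_card_eq_four {N : Finset V} (h : N.card = 4) :
    ∃ a b c d, a ≠ b ∧ a ≠ c ∧ a ≠ d ∧ b ≠ c ∧ b ≠ d ∧ c ≠ d ∧ N = {a, b, c, d} := by
  obtain ⟨a, t, hat, rfl, ht⟩ := Finset.card_eq_succ.1 h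
  obtain ⟨b, c, d, hbc, hbd, hcd, rfl⟩ := Finset.card_eq_three.1 ht
  simp only [Finset.mem_insert, Finset.mem_singleton, not_or] at hat
  exact ⟨a, b, c, d, hat.1, hat.2.1, hat.2.2, hbc, hbd, hcd, rfl⟩

lemma Reduced.good_split_four (h : Reduced S w c γ s) {x : V} (hx : x ∈ S)
    (hdeg : cut S w c {x} = 4) (hdem : γ x + s x = 0) (hc : c x = 0) {y₁ y₂ y₃ y₄ : V}
    (h₁₂ : y₁ ≠ y₂) (h₁₃ : y₁ ≠ y₃) (h₁₄ : y₁ ≠ y₄) (h₂₃ : y₂ ≠ y₃) (h₂₄ : y₂ ≠ y₄)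
    (h₃₄ : y₃ ≠ y₄) (hN : nbrs S w x = {y₁, y₂, y₃, y₄}) :
    Good (S.erase x) (w + edge y₁ y₂ + edge y₃ y₄) c γ s := by
  have hs : s x = 0 := (h.att x hx).1 hc
  have hsub : ∀ y ∈ nbrs S w x, y ∈ S.erase x := fun y hy => (Finset.mem_filter.1 hy).1
  rw [hN] at hsub
  simp only [Finset.mem_insert, Finset.mem_singleton, forall_eq_or_imp, forall_eq] at hsub
  obtain ⟨m₁, m₂, m₃, m₄⟩ := hsub
  refine ⟨fun i j => ?_, ?_, fun i hi => h.att i (Finset.mem_of_mem_erase hi),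
    fun A hA hne hAS => ?_, ?_⟩
  · simp only [Pi.add_apply, h.symm i j, edge_symm _ _ i j]
  · have := Finset.add_sum_erase S γ hx
    rw [h.sum_eq] at this
    rw [hs, add_zero] at hdem
    rwa [hdem, zero_add] at this
  · have hAS' : A ⊆ S := hA.trans (Finset.erase_subset _ _)
    have hcut := cut_erase (w := w) (c := c) hx hA
    rw [h.sum_eq_card hx hA, hN, Finset.sum_insert (by simp [h₁₂, h₁₃, h₁₄]),
      Finset.sum_insert (by simp [h₂₃, h₂₄]), Finset.sum_pair h₃₄] at hcut
    have hbig := h.big A hAS' hne (ne_of_subset_erase hx hA)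
    have hhuge := fun h2 => h.huge A hAS' h2 (ne_of_subset_erase hx hA)
    rw [cut_add_edge m₃ m₄ h₃₄, cut_add_edge m₁ m₂ h₁₂]
    by_cases hall : y₁ ∈ A ∧ y₂ ∈ A ∧ y₃ ∈ A ∧ y₄ ∈ A
    · obtain ⟨a₁, a₂, a₃, a₄⟩ := hall
      have hu := cut_union h.symm c hAS' (Finset.singleton_subset_iff.2 hx)
        (Finset.disjoint_singleton_right.2 fun hxA => by simpa using hA hxA)
      have hb := h.big (A ∪ {x}) (Finset.union_subset hAS' (by simpa)) (by simp) (by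
        rintro he
        apply hAS
        rw [← he]
        ext i
        by_cases hix : i = x
        · subst hix
          simpa using fun hxA => by simpa using hA hxA
        · simp [hix])
      rw [demand_union _ _ (Finset.disjoint_singleton_right.2 fun hxA => by simpa using hA hxA),
        demand_single, hdem, add_zero] at hb
      simp only [Finset.sum_singleton] at hu
      rw [h.sum_eq_card hx hA, hN, Finset.sum_insert (by simp [h₁₂, h₁₃, h₁₄]),
        Finset.sum_insert (by simp [h₂₃, h₂₄]), Finset.sum_pair h₃₄] at hu
      simp only [a₁, a₂, a₃, a₄, if_true, not_true, and_false, if_false, add_zero] at hu hcut ⊢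
      rwa [show cut (S.erase x) w c A = cut S w c (A ∪ {x}) by omega]
    · have key : cut S w c A = cut (S.erase x) w c A +
          ((if y₁ ∈ A ∧ y₂ ∉ A then 1 else 0) + if y₂ ∈ A ∧ y₁ ∉ A then 1 else 0) +
          ((if y₃ ∈ A ∧ y₄ ∉ A then 1 else 0) + if y₄ ∈ A ∧ y₃ ∉ A then 1 else 0) ∨
          2 ≤ A.card ∧ cut S w c A = cut (S.erase x) w c A +
          ((if y₁ ∈ A ∧ y₂ ∉ A then 1 else 0) + if y₂ ∈ A ∧ y₁ ∉ A then 1 else 0) +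
          ((if y₃ ∈ A ∧ y₄ ∉ A then 1 else 0) + if y₄ ∈ A ∧ y₃ ∉ A then 1 else 0) + 2 := by
        by_cases h2 : (y₁ ∈ A ∧ y₂ ∈ A) ∨ y₃ ∈ A ∧ y₄ ∈ A
        · right
          refine ⟨?_, ?_⟩
          · rcases h2 with h2 | h2
            · exact Finset.one_lt_card.2 ⟨y₁, h2.1, y₂, h2.2, h₁₂⟩
            · exact Finset.one_lt_card.2 ⟨y₃, h2.1, y₄, h2.2, h₃₄⟩
          · by_cases a₁ : y₁ ∈ A <;> by_cases a₂ : y₂ ∈ A <;> by_cases a₃ : y₃ ∈ A <;>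
              by_cases a₄ : y₄ ∈ A <;> simp [a₁, a₂, a₃, a₄] at hall h2 hcut ⊢ <;> omega
        · left
          by_cases a₁ : y₁ ∈ A <;> by_cases a₂ : y₂ ∈ A <;> by_cases a₃ : y₃ ∈ A <;>
            by_cases a₄ : y₄ ∈ A <;> simp [a₁, a₂, a₃, a₄] at hall h2 hcut ⊢ <;> omega
      rcases key with key | ⟨h2, key⟩
      · rwa [← key]
      · have := hhuge h2
        rw [key] at this
        exact this.big_of_add_two
  · have small := h.small
    rw [← Finset.add_sum_erase S c hx, ← Finset.add_sum_erase S s hx, hc, hs, zero_add,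
      zero_add] at small
    exact small

lemma Reduced.good_split_three (h : Reduced S w c γ s) {x : V} (hx : x ∈ S)
    (hdem : γ x + s x = 0) (hc : c x = 1) {y₁ y₂ y₃ : V}
    (h₁₂ : y₁ ≠ y₂) (h₁₃ : y₁ ≠ y₃) (h₂₃ : y₂ ≠ y₃) (hN : nbrs S w x = {y₁, y₂, y₃}) :
    Good (S.erase x) (w + edge y₁ y₂) (c + Pi.single y₃ 1) (γ + Pi.single y₃ (γ x))
      (s + Pi.single y₃ (s x)) := by
  have hs : s x ≠ 0 := (h.att x hx).2 hc
  have hsub : ∀ y ∈ nbrs S w x, y ∈ S.erase x := fun y hy => (Finset.mem_filter.1 hy).1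
  rw [hN] at hsub
  simp only [Finset.mem_insert, Finset.mem_singleton, forall_eq_or_imp, forall_eq] at hsub
  obtain ⟨m₁, m₂, m₃⟩ := hsub
  refine ⟨fun i j => ?_, ?_, fun i hi => (h.att i (Finset.mem_of_mem_erase hi)).add ?_,
    fun A hA hne hAS => ?_, ?_⟩
  · simp only [Pi.add_apply, h.symm i j, edge_symm _ _ i j]
  · rw [← Finset.add_sum_erase S γ hx |>.trans h.sum_eq]
    simp only [Pi.add_apply, Finset.sum_add_distrib, Pi.single_apply, Finset.sum_ite_eq', m₃,
      if_true]
    ring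
  · by_cases hi : i = y₃
    · subst hi; simpa
    · simp [hi]
  · have hAS' : A ⊆ S := hA.trans (Finset.erase_subset _ _)
    have hcut := cut_erase (w := w) (c := c) hx hA
    rw [h.sum_eq_card hx hA, hN, Finset.sum_insert (by simp [h₁₂, h₁₃]),
      Finset.sum_pair h₂₃] at hcut
    have hbig := h.big A hAS' hne (ne_of_subset_erase hx hA)
    have hd : demand (γ + Pi.single y₃ (γ x)) (s + Pi.single y₃ (s x)) A = demand γ s A := by
      refine Finset.sum_congr rfl fun i _ => ?_
      simp only [Pi.add_apply, Pi.single_apply]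
      split_ifs
      · linear_combination hdem
      · ring
    rw [cut_add_single, cut_add_edge m₁ m₂ h₁₂, hd]
    by_cases h2 : y₁ ∈ A ∧ y₂ ∈ A
    · have hhuge := h.huge A hAS' (Finset.one_lt_card.2 ⟨y₁, h2.1, y₂, h2.2, h₁₂⟩)
        (ne_of_subset_erase hx hA)
      rw [← hcut] at hhuge
      refine Huge.big_of_add_two ?_
      convert hhuge using 1
      simp only [h2.1, h2.2, if_true, not_true, and_false, if_false]
      omega
    · rw [← hcut] at hbig
      convert hbig using 1
      by_cases a₁ : y₁ ∈ A <;> by_cases a₂ : y₂ ∈ A <;> simp [a₁, a₂] at h2 ⊢ <;> omega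
  · have small := h.small
    rw [← Finset.add_sum_erase S c hx, ← Finset.add_sum_erase S s hx, hc] at small
    simp only [Pi.add_apply, Finset.sum_add_distrib, Pi.single_apply, Finset.sum_ite_eq', m₃,
      if_true]
    rwa [add_comm _ 1, add_comm _ (s x)]

lemma Reduced.root_le_one (h : Reduced S w c γ s) {x : V} (hx : x ∈ S)
    (hdeg : cut S w c {x} = 4) (hdem : γ x + s x = 0) : c x ≤ 1 := by
  by_contra hc
  have h1 := h.huge_erase hx
  have h2 := h.small
  have h3 := cut_compl_singleton (c := c) h.symm hx
  rw [hdem, sub_zero] at h1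
  unfold Huge at h1
  unfold Small at h2
  by_cases hb : ∑ i ∈ S, s i = 0 <;> simp [hb] at h1 h2 <;> omega

lemma Reduced.solvable_of_four (h : Reduced S w c γ s)
    (ih : ∀ S' : Finset V, S'.card < S.card → ∀ w' c' γ' s', Good S' w' c' γ' s' →
      Solvable S' w' γ')
    {x : V} (hx : x ∈ S) (hdeg : cut S w c {x} = 4) : Solvable S w γ := by
  have hdem : γ x + s x = 0 := by
    have := h.big_singleton hx
    rw [hdeg] at this
    simpa [Big] using this
  have hlt : (S.erase x).card < S.card := Finset.card_erase_lt_of_mem hx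
  have hcard := h.card_nbrs hx
  have hmem : ∀ y ∈ nbrs S w x, y ∈ S.erase x ∧ 1 ≤ w x y := fun y hy => Finset.mem_filter.1 hy
  have hle := h.root_le_one hx hdeg hdem
  rcases Nat.le_one_iff_eq_zero_or_eq_one.1 hle with hc | hc
  · obtain ⟨y₁, y₂, y₃, y₄, h₁₂, h₁₃, h₁₄, h₂₃, h₂₄, h₃₄, hN⟩ :=
      exists_eq_of_card_eq_four (show (nbrs S w x).card = 4 by omega)
    have hgood := h.good_split_four hx hdeg hdem hc h₁₂ h₁₃ h₁₄ h₂₃ h₂₄ h₃₄ hN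
    have heq := fun j (hj : j ∈ S.erase x) => h.eq_ite hx hj
    rw [hN] at hmem heq
    simp only [Finset.mem_insert, Finset.mem_singleton, forall_eq_or_imp, forall_eq] at hmem heq
    obtain ⟨⟨m₁, w₁⟩, ⟨m₂, w₂⟩, ⟨m₃, w₃⟩, ⟨m₄, w₄⟩⟩ := hmem
    refine Solvable.of_lift h.symm hx m₁ m₂ h₁₂ w₁ w₂ (Solvable.of_lift_erase
      (lift_symm h.symm x y₁ y₂) hx m₃ m₄ h₃₄ ?_ ?_ (f := 0) (fun j hj => ?_) ?_
      ((ih _ hlt _ _ _ _ hgood).congr (fun i hi j hj _ => ?_) fun _ _ => by simp))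
    · rw [lift_apply m₁ m₂ h₁₂ m₃]
      simpa [h₁₃.symm, h₂₃.symm] using w₃
    · rw [lift_apply m₁ m₂ h₁₂ m₄]
      simpa [h₁₄.symm, h₂₄.symm] using w₄
    · rw [lift_apply m₁ m₂ h₁₂ hj, heq j hj]
      convert attainable_zero.2 (rfl : (0 : V → ZMod 3) j = 0) using 1
      by_cases hj₁ : j = y₁
      · simp [hj₁]
      · by_cases hj₂ : j = y₂
        · simp [hj₂]
        · by_cases hj₃ : j = y₃
          · simp [hj₃, h₁₃.symm, h₂₃.symm]
          · by_cases hj₄ : j = y₄ <;> simp [hj₁, hj₂, hj₃, hj₄, h₁₄.symm, h₂₄.symm]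
    · rw [(h.att x hx).1 hc, add_zero] at hdem
      simp [hdem]
    · exact congrArg (· + edge y₃ y₄ i j) (lift_apply_of_mem hi hj).symm
  · obtain ⟨y₁, y₂, y₃, h₁₂, h₁₃, h₂₃, hN⟩ :=
      Finset.card_eq_three.1 (show (nbrs S w x).card = 3 by omega)
    have hgood := h.good_split_three hx hdem hc h₁₂ h₁₃ h₂₃ hN
    have heq := fun j (hj : j ∈ S.erase x) => h.eq_ite hx hj
    rw [hN] at hmem heq
    simp only [Finset.mem_insert, Finset.mem_singleton, forall_eq_or_imp, forall_eq] at hmem heq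
    obtain ⟨⟨m₁, w₁⟩, ⟨m₂, w₂⟩, ⟨m₃, w₃⟩⟩ := hmem
    refine Solvable.of_lift_erase h.symm hx m₁ m₂ h₁₂ w₁ w₂ (f := Pi.single y₃ (γ x))
      (fun j hj => ?_) ?_ (ih _ hlt _ _ _ _ hgood)
    · rw [heq j hj]
      by_cases hj₃ : j = y₃
      · subst hj₃
        have : γ x ≠ 0 := fun h0 => (h.att x hx).2 hc (by simpa [h0] using hdem)
        simpa [h₁₃.symm, h₂₃.symm]
      · by_cases hj₁ : j = y₁
        · simp [hj₁, h₁₂, h₁₃]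
        · by_cases hj₂ : j = y₂ <;> simp [hj₁, hj₂, hj₃, h₂₃, h₁₂.symm]
    · simp [Pi.single_apply, m₃]

end Z3Flow

namespace Z3Flow

/-- An edge at a vertex of degree `d` and demand `b` may be deleted only with value `ε`. -/
def Forced (d : ℕ) (b ε : ZMod 3) : Prop := d = 5 ∧ b = ε ∨ d = 6 ∧ b = -ε

lemma Big.forced_or {d : ℕ} {b : ZMod 3} (h : Big d b) (hd : 5 ≤ d) :
    (∀ ε ≠ 0, Big (d - 1) (b - ε)) ∨ ∃ ε ≠ 0, Forced d b ε := by
  unfold Big Forced at *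
  rcases Nat.lt_or_ge 6 d with h6 | h6
  · exact Or.inl fun ε _ => by omega
  · interval_cases d
    · right
      refine ⟨b, ?_, by simp⟩
      simpa using h
    · by_cases hb : b = 0
      · left
        simp [hb]
      · exact Or.inr ⟨-b, by simpa, by simp⟩

lemma Forced.big_sub {d : ℕ} {b ε : ZMod 3} (h : Forced d b ε) (hε : ε ≠ 0) :
    Big (d - 1) (b - ε) := by
  rcases h with ⟨rfl, rfl⟩ | ⟨rfl, rfl⟩
  · simp [Big]
  · simp only [Big]
    revert ε; decide

lemma Forced.big_add {d : ℕ} {b ε : ZMod 3} (h : Forced d b ε) (hε : ε ≠ 0) :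
    Big d (b + ε) := by
  rcases h with ⟨rfl, rfl⟩ | ⟨rfl, rfl⟩
  · simp only [Big]
    revert b; decide
  · simp [Big]

lemma Forced.small {d : ℕ} {b ε : ZMod 3} (h : Forced d b ε) (hε : ε ≠ 0) : Small d (-b) := by
  rcases h with ⟨rfl, rfl⟩ | ⟨rfl, rfl⟩
  · simp [Small]
  · simp [Small, hε]

variable {V : Type*} [DecidableEq V] {S : Finset V} {w : V → V → ℕ} {c : V → ℕ}
  {γ s : V → ZMod 3}

lemma Reduced.exists_nbr (h : Reduced S w c γ s) {x : V} (hx : x ∈ S)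
    (hd : 5 ≤ cut S w c {x}) : ∃ y ∈ S, x ≠ y ∧ 1 ≤ w x y := by
  by_contra! hno
  have h1 := cut_singleton (S := S) (w := w) (c := c) x
  rw [Finset.sum_eq_zero fun y hy => Nat.lt_one_iff.1
    (hno y (Finset.mem_of_mem_erase hy) (Finset.ne_of_mem_erase hy).symm)] at h1
  have h2 := cut_compl_singleton (c := c) h.symm hx
  have h3 := (h.huge_erase hx).six_le
  have h4 := h.small.le_seven
  omega

/-- If no edge can be deleted, then all vertices are forced in a common direction. -/
lemma Reduced.exists_forced (h : Reduced S w c γ s) (hd : ∀ x ∈ S, 5 ≤ cut S w c {x})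
    (hno : ∀ x ∈ S, ∀ y ∈ S, x ≠ y → 1 ≤ w x y → ∀ ε ≠ 0,
      Big (cut S w c {x} - 1) (γ x + s x - ε) → ¬Big (cut S w c {y} - 1) (γ y + s y + ε)) :
    ∃ ε ≠ 0, ∀ x ∈ S, Forced (cut S w c {x}) (γ x + s x) ε := by
  have hf : ∀ x ∈ S, ∃ ε ≠ 0, Forced (cut S w c {x}) (γ x + s x) ε := by
    intro x hx
    refine ((h.big_singleton hx).forced_or (hd x hx)).resolve_left fun hall => ?_
    obtain ⟨y, hy, hxy, hw⟩ := h.exists_nbr hx (hd x hx)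
    have hex : ∃ ε ≠ 0, Big (cut S w c {y} - 1) (γ y + s y - ε) := by
      rcases (h.big_singleton hy).forced_or (hd y hy) with h1 | ⟨ε, hε, h1⟩
      · exact ⟨1, by decide, h1 1 (by decide)⟩
      · exact ⟨ε, hε, h1.big_sub hε⟩
    obtain ⟨ε, hε, h1⟩ := hex
    exact hno x hx y hy hxy hw (-ε) (neg_ne_zero.2 hε) (hall _ (neg_ne_zero.2 hε))
      (by rwa [← sub_eq_add_neg])
  have hex : ∀ x, ∃ ε, x ∈ S → ε ≠ 0 ∧ Forced (cut S w c {x}) (γ x + s x) ε := fun x => by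
    by_cases hx : x ∈ S
    · obtain ⟨ε, h1, h2⟩ := hf x hx
      exact ⟨ε, fun _ => ⟨h1, h2⟩⟩
    · exact ⟨0, fun h => (hx h).elim⟩
  choose t ht using hex
  have hadj : ∀ x ∈ S, ∀ y ∈ S, x ≠ y → 1 ≤ w x y → t x = t y := by
    intro x hx y hy hxy hw
    have h1 := hno x hx y hy hxy hw (t x) (ht x hx).1 ((ht x hx).2.big_sub (ht x hx).1)
    have h2 := (ht y hy).2.big_sub (ht y hy).1
    have hne : t y ≠ -t x := fun he => h1 (by rwa [he, sub_neg_eq_add] at h2)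
    have hx0 := (ht x hx).1
    have hy0 := (ht y hy).1
    generalize t x = a at hne hx0 ⊢
    generalize t y = b at hne hy0 ⊢
    clear * - hne hx0 hy0
    revert a b; decide
  obtain ⟨x, hx⟩ : S.Nonempty := Finset.card_pos.1 (by have := h.two_lt; omega)
  refine ⟨t x, (ht x hx).1, fun y hy => ?_⟩
  suffices t x = t y by rw [this]; exact (ht y hy).2
  by_contra hne
  have hPS : {z ∈ S | t x = t z} ⊆ S := Finset.filter_subset _ _
  have hQS : {z ∈ S | ¬t x = t z} ⊆ S := Finset.filter_subset _ _
  have hu := cut_union h.symm c hPS hQS (Finset.disjoint_filter_filter_not _ _ _)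
  rw [Finset.filter_union_filter_not_eq, cut_self, Finset.sum_eq_zero (fun i hi =>
    Finset.sum_eq_zero fun j hj => ?_)] at hu
  · have h1 := (h.big {z ∈ S | t x = t z} hPS ⟨x, by simp [hx]⟩ (by
      intro he
      rw [← he] at hy
      exact hne (Finset.mem_filter.1 hy).2)).four_le
    have h2 := (h.big {z ∈ S | ¬t x = t z} hQS ⟨y, by simp [hy, hne]⟩ (by
      intro he
      rw [← he] at hx
      exact (Finset.mem_filter.1 hx).2 rfl)).four_le
    have h3 := h.small.le_seven
    omega
  · rw [Finset.mem_filter] at hi hj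
    by_contra h0
    refine hj.2 (hi.2.trans (hadj i hi.1 j hj.1 ?_ (by omega)))
    rintro rfl
    exact hj.2 hi.2

lemma Reduced.solvable_of_root_isolated (h : Reduced S w c γ s)
    (ih : ∀ S' : Finset V, S'.card < S.card → ∀ w' c' γ' s', Good S' w' c' γ' s' →
      Solvable S' w' γ')
    (hc : ∑ i ∈ S, c i = 0) {ε : ZMod 3} (hε : ε ≠ 0)
    (hf : ∀ x ∈ S, Forced (cut S w c {x}) (γ x + s x) ε) : Solvable S w γ := by
  obtain ⟨x, hx⟩ : S.Nonempty := Finset.card_pos.1 (by have := h.two_lt; omega)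
  have hc0 : ∀ i ∈ S, c i = 0 := Finset.sum_eq_zero_iff.1 hc
  have hs : ∑ i ∈ S, s i = 0 := Finset.sum_eq_zero fun i hi => (h.att i hi).1 (hc0 i hi)
  have h5 : 2 ≤ cut S w c {x} := by have := (h.big_singleton hx).four_le; omega
  have h6 := cut_compl_singleton (c := c) h.symm hx
  have hcs := cut_singleton (S := S) (w := w) (c := c) x
  rw [hc0 x hx] at h6 hcs
  obtain ⟨f, hfa, hfs⟩ := (attainable_of_two_le (hcs ▸ h5) (γ x)).exists_sum
  have hsx : S \ S.erase x = {x} := by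
    rw [Finset.sdiff_erase hx, Finset.sdiff_self, Finset.insert_empty]
  have hg := h.restrict (Finset.erase_subset x S) (by
      intro he
      rw [← he] at hx
      simp at hx) (g := -f) (by
      rw [demand_compl_singleton h.toGood hx, hs, zero_sub]
      rw [show cut S w c (S.erase x) = cut S w c {x} by omega]
      exact (hf x hx).small hε) (fun i hi => by
      rw [hsx, Finset.sum_singleton, h.symm]
      exact (hfa i hi).neg) (by
      have := Finset.add_sum_erase S γ hx
      rw [h.sum_eq] at this
      simp only [Pi.neg_apply, Finset.sum_neg_distrib, hfs]
      linear_combination -this)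
  rw [sub_neg_eq_add] at hg
  exact Solvable.of_erase h.symm hx hfa hfs (ih _ (Finset.card_erase_lt_of_mem hx) _ _ _ _ hg)

lemma attainable_sub_or {k : ℕ} {b ε : ZMod 3} (h : Attainable k b) (hε : ε ≠ 0) :
    (∃ l, k = l + 1 ∧ Attainable l (b - ε)) ∨ b = -(k * ε) := by
  rcases k with _ | _ | _ | k
  · right; simpa using h
  · rw [zero_add, attainable_one] at h
    by_cases hb : b = ε
    · exact Or.inl ⟨0, by simp [hb]⟩
    · right
      push_cast
      revert b ε; decide
  · by_cases hb : b = ε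
    · right
      rw [hb]
      push_cast
      clear * -
      revert ε; decide
    · exact Or.inl ⟨1, by simpa [sub_eq_zero]⟩
  · exact Or.inl ⟨k + 2, by simp⟩

lemma small_add_one {k : ℕ} {ε : ZMod 3} (hε : ε ≠ 0) (h : Small k (-(k * ε))) :
    Small (k + 1) (-(k * ε)) := by
  have := h.le_seven
  unfold Small at *
  interval_cases k <;> simp at h ⊢ <;> revert ε <;> decide

lemma sum_sub_edge_lt {x y : V} (hx : x ∈ S) (hy : y ∈ S)
    (h : 1 ≤ w x y) :
    ∑ i ∈ S, ∑ j ∈ S, (w - edge x y) i j < ∑ i ∈ S, ∑ j ∈ S, w i j := by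
  have hle : ∀ i j, (w - edge x y) i j ≤ w i j := fun i j => Nat.sub_le _ _
  refine Finset.sum_lt_sum (fun i _ => Finset.sum_le_sum fun j _ => hle i j)
    ⟨x, hx, Finset.sum_lt_sum (fun j _ => hle x j) ⟨y, hy, ?_⟩⟩
  simp only [Pi.sub_apply, edge, and_self, true_or, if_true]
  omega

lemma Reduced.solvable (h : Reduced S w c γ s)
    (ihS : ∀ S' : Finset V, S'.card < S.card → ∀ w' c' γ' s', Good S' w' c' γ' s' →
      Solvable S' w' γ')
    (ihW : ∀ w' c' γ', ∑ i ∈ S, ∑ j ∈ S, w' i j < ∑ i ∈ S, ∑ j ∈ S, w i j →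
      Good S w' c' γ' s → Solvable S w' γ')
    (ihC : ∀ c' s', ∑ i ∈ S, c' i < ∑ i ∈ S, c i → Good S w c' γ s' → Solvable S w γ) :
    Solvable S w γ := by
  by_cases h4 : ∃ x ∈ S, cut S w c {x} = 4
  · obtain ⟨x, hx, hx4⟩ := h4
    exact h.solvable_of_four ihS hx hx4
  push Not at h4
  have hd : ∀ x ∈ S, 5 ≤ cut S w c {x} := fun x hx => by
    have := (h.big_singleton hx).four_le
    have := h4 x hx
    omega
  have hdel : ∀ x ∈ S, ∀ y ∈ S, x ≠ y → 1 ≤ w x y → ∀ ε ≠ 0, ∀ k,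
      Attainable (c x + k) (s x) → Small (∑ i ∈ S, c i + k) (∑ i ∈ S, s i) →
      Big (cut S w c {x} + k - 1) (γ x + s x - ε) → Big (cut S w c {y} - 1) (γ y + s y + ε) →
      Solvable S w γ := by
    intro x hx y hy hxy hw ε hε k h1 h2 h3 h5
    have := ihW _ _ _ (sum_sub_edge_lt hx hy hw) (h.delete_edge hx hy hxy hw k hε h1 h2 h3 h5)
    rw [← sub_edge_add h.symm hw]
    exact Solvable.add_edge hx hy hxy hε this
  by_cases hno : ∀ x ∈ S, ∀ y ∈ S, x ≠ y → 1 ≤ w x y → ∀ ε ≠ 0,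
      Big (cut S w c {x} - 1) (γ x + s x - ε) → ¬Big (cut S w c {y} - 1) (γ y + s y + ε)
  swap
  · push Not at hno
    obtain ⟨x, hx, y, hy, hxy, hw, ε, hε, h1, h2⟩ := hno
    exact hdel x hx y hy hxy hw ε hε 0 (h.att x hx) h.small h1 h2
  obtain ⟨ε, hε, hf⟩ := h.exists_forced hd hno
  by_cases hc : ∑ i ∈ S, c i = 0
  · exact h.solvable_of_root_isolated ihS hc hε hf
  by_cases hroot : ∃ x ∈ S, ∃ l, c x = l + 1 ∧ Attainable l (s x - ε)
  · obtain ⟨x, hx, l, hl, hatt⟩ := hroot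
    obtain ⟨c, rfl⟩ : ∃ c₀ : V → ℕ, c = c₀ + Pi.single x 1 := ⟨c - Pi.single x 1, by
      refine (tsub_add_cancel_of_le fun i => ?_).symm
      by_cases hi : i = x
      · subst hi; simp [hl]
      · simp [hi]⟩
    have hlx : c x = l := by simpa using hl
    refine ihC c _ ?_ (h.delete_root_edge hx hε (by rwa [hlx]) ?_)
    · simp [Finset.sum_add_distrib, Pi.single_apply, hx]
    · have := (hf x hx).big_sub hε
      simpa [cut_add_single] using this
  push Not at hroot
  have hs : ∀ x ∈ S, s x = -(c x * ε) := fun x hx =>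
    (attainable_sub_or (h.att x hx) hε).resolve_left fun ⟨l, hl, hatt⟩ => hroot x hx l hl hatt
  have hsum : ∑ i ∈ S, s i = -((∑ i ∈ S, c i : ℕ) * ε) := by
    rw [Finset.sum_congr rfl hs, Finset.sum_neg_distrib, Nat.cast_sum, Finset.sum_mul]
  obtain ⟨x, hx, hcx⟩ := Finset.exists_ne_zero_of_sum_ne_zero hc
  obtain ⟨y, hy, hxy, hw⟩ := h.exists_nbr hx (hd x hx)
  refine hdel x hx y hy hxy hw (-ε) (neg_ne_zero.2 hε) 1 (attainable_of_two_le (by omega) _) ?_ ?_ ?_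
  · rw [hsum]
    exact small_add_one hε (hsum ▸ h.small)
  · rw [Nat.add_sub_cancel, sub_neg_eq_add]
    exact (hf x hx).big_add hε
  · rw [← sub_eq_add_neg]
    exact (hf y hy).big_sub hε

lemma Good.two_lt_card (h : Good S w c γ s) (hS : 1 < S.card)
    (hsimple : ∀ x ∈ S, ∀ y ∈ S, x ≠ y → w x y ≤ 1) : 2 < S.card := by
  by_contra hle
  obtain ⟨x, y, hxy, rfl⟩ := Finset.card_eq_two.1 (show S.card = 2 by omega)
  have hw := hsimple x (by simp) y (by simp) hxy
  have hx := h.big {x} (by simp) (by simp) (by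
    intro he
    have : y ∈ ({x} : Finset V) := by rw [he]; simp
    exact hxy (Finset.mem_singleton.1 this).symm)
  have hy := h.big {y} (by simp) (by simp) (by
    intro he
    have : x ∈ ({y} : Finset V) := by rw [he]; simp
    exact hxy (Finset.mem_singleton.1 this))
  have hu := cut_union h.symm c (S := {x, y}) (A := {x}) (B := {y}) (by simp) (by simp) (by simpa)
  have hsm := h.small
  have hdu := h.demand_self
  rw [← Finset.insert_eq, cut_self] at hu
  simp only [Finset.sum_singleton] at hu
  rw [Finset.insert_eq, demand_union _ _ (by simpa), ← Finset.insert_eq] at hdu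
  rw [← hdu] at hsm
  unfold Big at hx hy
  unfold Small at hsm
  generalize demand γ s {x} = a at *
  generalize demand γ s {y} = b at *
  by_cases ha : a = 0 <;> by_cases hb : b = 0 <;> simp [ha, hb] at hx hy hsm <;> omega

theorem Good.solvable {S : Finset V} {w : V → V → ℕ} {c : V → ℕ} {γ s : V → ZMod 3}
    (h : Good S w c γ s) : Solvable S w γ := by
  rcases Nat.lt_or_ge 1 S.card with hS | hS
  swap
  · exact solvable_of_card_le_one hS w h.sum_eq
  have ihS : ∀ S' : Finset V, S'.card < S.card → ∀ w' c' γ' s', Good S' w' c' γ' s' →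
      Solvable S' w' γ' := fun S' _ w' c' γ' s' h' => h'.solvable
  by_cases hcut : ∃ A ⊆ S, 2 ≤ A.card ∧ A ≠ S ∧ Small (cut S w c A) (demand γ s A)
  · obtain ⟨A, hA, h2, hAS, hsm⟩ := hcut
    exact h.solvable_of_small_cut ihS hA hAS h2 hsm
  by_cases hpar : ∃ x ∈ S, ∃ y ∈ S, x ≠ y ∧ 2 ≤ w x y
  · obtain ⟨x, hx, y, hy, hxy, h2⟩ := hpar
    exact h.solvable_of_parallel ihS hx hy hxy h2
  push Not at hcut hpar
  have hsimple : ∀ x ∈ S, ∀ y ∈ S, x ≠ y → w x y ≤ 1 := fun x hx y hy hxy =>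
    Nat.lt_succ_iff.1 (hpar x hx y hy hxy)
  have hr : Reduced S w c γ s :=
    { toGood := h
      huge := fun A hA h2 hAS => (huge_or_small _ _).resolve_right (hcut A hA h2 hAS)
      simple := hsimple
      two_lt := h.two_lt_card hS hsimple }
  exact hr.solvable ihS (fun w' c' γ' _ h' => h'.solvable) fun c' s' _ h' => h'.solvable
termination_by (S.card, ∑ i ∈ S, ∑ j ∈ S, w i j, ∑ i ∈ S, c i)

end Z3Flow

namespace Z3Flow

variable {V : Type*}

/-- Twice the number of edges of the multigraph on `S` joining different classes of `π`. -/
def cross (S : Finset V) (w : V → V → ℕ) (π : V → ℕ) : ℕ :=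
  ∑ i ∈ S, ∑ j ∈ S, if π i ≠ π j then w i j else 0

/-- The condition of Nash-Williams and Tutte for four edge-disjoint spanning trees. -/
def Part (S : Finset V) (w : V → V → ℕ) : Prop :=
  ∀ π : V → ℕ, 8 * (S.image π).card ≤ cross S w π + 8

lemma even_cross {w : V → V → ℕ} (hw : ∀ i j, w i j = w j i) (S : Finset V) (π : V → ℕ) :
    Even (cross S w π) := by
  classical
  unfold cross
  induction S using Finset.induction_on with
  | empty => simp
  | insert a S ha ih =>
    simp only [Finset.sum_insert ha, ne_eq, not_true, if_false, zero_add, Finset.sum_add_distrib]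
    rw [← add_assoc]
    refine Even.add ?_ ih
    rw [Finset.sum_congr rfl fun i _ => show (if ¬π i = π a then w i a else 0) =
      if ¬π a = π i then w a i else 0 by simp only [hw i a, eq_comm]]
    exact Even.add_self _

lemma exists_cross_le_of_not_part {w : V → V → ℕ} (hw : ∀ i j, w i j = w j i) {S : Finset V}
    (h : ¬Part S w) : ∃ π : V → ℕ, cross S w π + 10 ≤ 8 * (S.image π).card := by
  unfold Part at h
  push Not at h
  obtain ⟨π, hπ⟩ := h
  obtain ⟨m, hm⟩ := even_cross hw S π
  exact ⟨π, by omega⟩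

/-- The partition obtained from `σ` by subdividing the class `q` according to `κ`. -/
def refine (σ : V → ℕ) (q : ℕ) (κ : V → ℕ) : V → ℕ := fun i =>
  if σ i = q then 2 * κ i else 2 * σ i + 1

lemma cross_refine (S : Finset V) (w : V → V → ℕ) (σ : V → ℕ) (q : ℕ) (κ : V → ℕ) :
    cross S w (refine σ q κ) = cross S w σ + cross {i ∈ S | σ i = q} w κ := by
  unfold cross
  simp only [Finset.sum_filter]
  rw [← Finset.sum_add_distrib]
  refine Finset.sum_congr rfl fun i _ => ?_
  by_cases hi : σ i = q
  · rw [if_pos hi, ← Finset.sum_add_distrib]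
    refine Finset.sum_congr rfl fun j _ => ?_
    by_cases hj : σ j = q
    · simp [refine, hi, hj]
    · have : 2 * κ i ≠ 2 * σ j + 1 := by omega
      simp [refine, hi, hj, this, Ne.symm hj]
  · rw [if_neg hi, add_zero]
    refine Finset.sum_congr rfl fun j _ => ?_
    by_cases hj : σ j = q
    · have : 2 * σ i + 1 ≠ 2 * κ j := by omega
      simp [refine, hi, hj, this]
    · simp [refine, hi, hj]

lemma card_image_refine (S : Finset V) {σ : V → ℕ} {q : ℕ} (hq : q ∈ S.image σ) (κ : V → ℕ) :
    (S.image (refine σ q κ)).card + 1 =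
      (S.image σ).card + ({i ∈ S | σ i = q}.image κ).card := by
  have h1 : S.image (refine σ q κ) = ({i ∈ S | σ i = q}.image κ).image (2 * ·) ∪
      ((S.image σ).erase q).image (2 * · + 1) := by
    ext m
    simp only [Finset.mem_image, Finset.mem_union, Finset.mem_filter, Finset.mem_erase, refine]
    constructor
    · rintro ⟨i, hi, rfl⟩
      by_cases h : σ i = q
      · exact Or.inl ⟨κ i, ⟨i, ⟨hi, h⟩, rfl⟩, by simp [h]⟩
      · exact Or.inr ⟨σ i, ⟨h, i, hi, rfl⟩, by simp [h]⟩
    · rintro (⟨_, ⟨i, ⟨hi, h⟩, rfl⟩, rfl⟩ | ⟨_, ⟨h, i, hi, rfl⟩, rfl⟩)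
      · exact ⟨i, hi, by simp [h]⟩
      · exact ⟨i, hi, by simp [h]⟩
  have h2 (B : Finset ℕ) : (B.image (2 * ·)).card = B.card :=
    Finset.card_image_of_injective _ fun a b hab => by simpa using hab
  have h3 (B : Finset ℕ) : (B.image (2 * · + 1)).card = B.card :=
    Finset.card_image_of_injective _ fun a b hab => by simpa using hab
  rw [h1, Finset.card_union_of_disjoint, h2, h3, Finset.card_erase_of_mem hq]
  · have := Finset.card_pos.2 ⟨q, hq⟩
    omega
  · rw [Finset.disjoint_left]
    intro m h1 h2
    obtain ⟨a, _, rfl⟩ := Finset.mem_image.1 h1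
    obtain ⟨b, _, hb⟩ := Finset.mem_image.1 h2
    omega

lemma cross_const (S : Finset V) (w : V → V → ℕ) : cross S w (fun _ => 0) = 0 := by simp [cross]

variable {S : Finset V} {w : V → V → ℕ}

/-- No proper subset with at least two vertices satisfies the partition condition. -/
def Minimal (S : Finset V) (w : V → V → ℕ) : Prop :=
  ∀ A ⊆ S, 2 ≤ A.card → A ≠ S → ¬Part A w

lemma Minimal.exists_cross_le (hmin : Minimal S w) (hw : ∀ i j, w i j = w j i) {A : Finset V}
    (hA : A ⊆ S) (hne : A.Nonempty) (hAS : A ≠ S) :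
    ∃ κ : V → ℕ, cross A w κ + 8 + (if 2 ≤ A.card then 2 else 0) ≤ 8 * (A.image κ).card := by
  split_ifs with h2
  · exact exists_cross_le_of_not_part hw (hmin A hA h2 hAS)
  · exact ⟨fun _ => 0, by rw [cross_const, Finset.image_const hne]; simp⟩

variable [DecidableEq V]

lemma cross_indicator (hw : ∀ i j, w i j = w j i) {A : Finset V} (hA : A ⊆ S) :
    cross S w (fun i => if i ∈ A then 0 else 1) = 2 * cut S w 0 A := by
  have h2 : ∑ i ∈ S \ A, ∑ j ∈ A, w i j = ∑ i ∈ A, ∑ j ∈ S \ A, w i j := by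
    rw [Finset.sum_comm]
    exact Finset.sum_congr rfl fun i _ => Finset.sum_congr rfl fun j _ => hw j i
  unfold cross cut
  rw [two_mul, ← Finset.sum_sdiff hA]
  simp only [Pi.zero_apply, Finset.sum_const_zero, add_zero]
  nth_rw 1 [← h2]
  congr 1
  · refine Finset.sum_congr rfl fun i hi => ?_
    rw [← Finset.sum_sdiff hA, Finset.sum_eq_zero fun j hj => ?_, zero_add]
    · refine Finset.sum_congr rfl fun j hj => ?_
      simp [hj, (Finset.mem_sdiff.1 hi).2]
    · simp [(Finset.mem_sdiff.1 hi).2, (Finset.mem_sdiff.1 hj).2]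
  · refine Finset.sum_congr rfl fun i hi => ?_
    rw [← Finset.sum_sdiff hA, add_comm, Finset.sum_eq_zero fun j hj => ?_, zero_add]
    · refine Finset.sum_congr rfl fun j hj => ?_
      simp [hi, (Finset.mem_sdiff.1 hj).2]
    · simp [hi, hj]

lemma Part.le_cut_add (h : Part S w) (hw : ∀ i j, w i j = w j i) {A : Finset V} (hA : A ⊆ S)
    (hne : A.Nonempty) (hAS : A ≠ S) (κ ρ : V → ℕ) :
    8 * (A.image κ).card + 8 * ((S \ A).image ρ).card ≤
      2 * cut S w 0 A + cross A w κ + cross (S \ A) w ρ + 8 := by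
  obtain ⟨a, ha⟩ := hne
  obtain ⟨b, hb⟩ : (S \ A).Nonempty := Finset.sdiff_nonempty.2 fun h => hAS (hA.antisymm h)
  have hb' := Finset.mem_sdiff.1 hb
  set σ : V → ℕ := fun i => if i ∈ A then 0 else 1 with hσ
  have hσA : {i ∈ S | σ i = 0} = A := by
    ext i
    simp only [hσ, Finset.mem_filter, ite_eq_left_iff, one_ne_zero, imp_false, not_not]
    exact ⟨fun h => h.2, fun h => ⟨hA h, h⟩⟩
  have hτB : {i ∈ S | refine σ 0 κ i = 3} = S \ A := by
    ext i
    simp only [hσ, refine, Finset.mem_filter, Finset.mem_sdiff]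
    by_cases hi : i ∈ A
    · simp only [hi, if_true, not_true, and_false, iff_false]
      omega
    · simp [hi]
  have him : S.image σ = {0, 1} := by
    ext m
    simp only [Finset.mem_image, Finset.mem_insert, Finset.mem_singleton, hσ]
    constructor
    · rintro ⟨i, _, rfl⟩
      split_ifs <;> simp
    · rintro (rfl | rfl)
      · exact ⟨a, hA ha, by simp [ha]⟩
      · exact ⟨b, hb'.1, by simp [hb'.2]⟩
  have h0 : 0 ∈ S.image σ := by simp [him]
  have h3 : 3 ∈ S.image (refine σ 0 κ) :=
    Finset.mem_image.2 ⟨b, hb'.1, by simp [refine, hσ, hb'.2]⟩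
  have c1 := card_image_refine S h0 κ
  have c2 := card_image_refine S h3 ρ
  rw [hσA, him, Finset.card_pair zero_ne_one] at c1
  rw [hτB] at c2
  have hp := h (refine (refine σ 0 κ) 3 ρ)
  rw [cross_refine, cross_refine, hσA, hτB, cross_indicator hw hA] at hp
  omega

lemma cross_quot (S : Finset V) (w : V → V → ℕ) (p : V → V) (π : V → ℕ) :
    cross (S.image p) (quot S p w) π = cross S w (π ∘ p) := by
  have h := sum_quot S (S.image p) (S.image p) p (fun i j => if π (p i) ≠ π (p j) then w i j else 0)
  rw [filter_mem_image] at h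
  refine Eq.trans (Finset.sum_congr rfl fun u _ => Finset.sum_congr rfl fun v _ => ?_) h
  unfold quot
  rw [Finset.sum_congr rfl fun i hi => Finset.sum_congr rfl fun j hj => show
    (if π (p i) ≠ π (p j) then w i j else 0) = if π u ≠ π v then w i j else 0 by
      rw [(Finset.mem_filter.1 hi).2, (Finset.mem_filter.1 hj).2]]
  split_ifs <;> simp

lemma Part.quot (h : Part S w) (p : V → V) : Part (S.image p) (quot S p w) := fun π => by
  rw [cross_quot, Finset.image_image]
  exact h _

lemma Minimal.le_cut (hmin : Minimal S w) (h : Part S w) (hw : ∀ i j, w i j = w j i)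
    {A : Finset V} (hA : A ⊆ S) (hne : A.Nonempty) (hAS : A ≠ S) :
    4 + (if 2 ≤ A.card then 1 else 0) + (if 2 ≤ (S \ A).card then 1 else 0) ≤ cut S w 0 A := by
  obtain ⟨κ, hκ⟩ := hmin.exists_cross_le hw hA hne hAS
  have hB : S \ A ≠ S := fun he => by
    obtain ⟨a, ha⟩ := hne
    have := hA ha
    rw [← he] at this
    exact (Finset.mem_sdiff.1 this).2 ha
  obtain ⟨ρ, hρ⟩ := hmin.exists_cross_le hw Finset.sdiff_subset
    (Finset.sdiff_nonempty.2 fun h => hAS (hA.antisymm h)) hB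
  have := h.le_cut_add hw hA hne hAS κ ρ
  split_ifs at * <;> omega

lemma part_pair {x y : V} (hxy : x ≠ y) (hw : ∀ i j, w i j = w j i) (h : 4 ≤ w x y) :
    Part {x, y} w := by
  intro π
  unfold cross
  rw [Finset.image_insert, Finset.image_singleton]
  by_cases hπ : π x = π y
  · simp [hπ]
  · rw [Finset.card_pair hπ, Finset.sum_pair hxy, Finset.sum_pair hxy, Finset.sum_pair hxy,
      hw y x]
    simp only [ne_eq, hπ, Ne.symm hπ, not_true, not_false_eq_true, if_true, if_false]
    omega

lemma Part.four_le {x y : V} (hxy : x ≠ y) (hw : ∀ i j, w i j = w j i) (h : Part {x, y} w) :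
    4 ≤ w x y := by
  have hp := h (fun i => if i = x then 0 else 1)
  unfold cross at hp
  rw [Finset.image_insert, Finset.image_singleton, Finset.sum_pair hxy, Finset.sum_pair hxy,
    Finset.sum_pair hxy, hw y x] at hp
  simp [hxy.symm] at hp
  omega

lemma cross_add_edge_of_ne {x y : V} (hx : x ∈ S) (hy : y ∈ S) {π : V → ℕ} (h : π x ≠ π y) :
    cross S w π + 2 ≤ cross S (w + edge x y) π := by
  have he : ∀ a b, a ∈ S → b ∈ S → (∑ i ∈ S, ∑ j ∈ S, if i = a ∧ j = b then 1 else 0) = 1 := by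
    intro a b ha hb
    simp [ite_and, ha, hb, Finset.sum_ite_irrel]
  have h2 : cross S w π + 2 = ∑ i ∈ S, ∑ j ∈ S, ((if π i ≠ π j then w i j else 0) +
      ((if i = x ∧ j = y then 1 else 0) + if i = y ∧ j = x then 1 else 0)) := by
    simp only [Finset.sum_add_distrib, he x y hx hy, he y x hy hx]
    rfl
  rw [h2]
  refine Finset.sum_le_sum fun i _ => Finset.sum_le_sum fun j _ => ?_
  have hxy : x ≠ y := fun he => h (by rw [he])
  simp only [Pi.add_apply, edge]
  by_cases h1 : i = x ∧ j = y
  · obtain ⟨rfl, rfl⟩ := h1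
    simp [h, hxy]
  · by_cases h2 : i = y ∧ j = x
    · obtain ⟨rfl, rfl⟩ := h2
      simp [Ne.symm h, h1]
    · simp [h1, h2]

lemma cross_le_add_edge (x y : V) (π : V → ℕ) : cross S w π ≤ cross S (w + edge x y) π :=
  Finset.sum_le_sum fun i _ => Finset.sum_le_sum fun j _ => by
    split_ifs
    · exact Nat.le_add_right _ _
    · exact le_rfl

/-- At a vertex of degree five, splitting off a pair of edges and deleting the vertex preserves the
partition condition. -/
lemma Minimal.part_erase (hmin : Minimal S w) (h : Part S w) (hw : ∀ i j, w i j = w j i) {v : V}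
    (hv : v ∈ S) (hS : 2 < S.card) (hdeg : cut S w 0 {v} = 5) {x y : V} (hx : x ∈ S.erase v)
    (hy : y ∈ S.erase v) (hxy : x ≠ y) : Part (S.erase v) (w + edge x y) := by
  have hbound : ∀ π : V → ℕ, 8 * ((S.erase v).image π).card ≤ cross (S.erase v) w π + 10 := by
    intro π
    have := h.le_cut_add hw (Finset.singleton_subset_iff.2 hv) (by simp) (by
      rintro rfl; simp at hS) (fun _ => 0) π
    rw [cross_const, hdeg, Finset.sdiff_singleton_eq_erase] at this
    simp at this
    omega
  intro π
  by_cases hπ : 8 * ((S.erase v).image π).card ≤ cross (S.erase v) w π + 8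
  · have := cross_le_add_edge (S := S.erase v) (w := w) x y π
    omega
  have hne : π x ≠ π y := by
    intro heq
    have hQ : {i ∈ S.erase v | π i = π y} ⊆ S :=
      (Finset.filter_subset _ _).trans (Finset.erase_subset _ _)
    obtain ⟨κ, hκ⟩ := exists_cross_le_of_not_part hw (hmin {i ∈ S.erase v | π i = π y} hQ
      (Finset.one_lt_card.2 ⟨x, Finset.mem_filter.2 ⟨hx, heq⟩, y, Finset.mem_filter.2 ⟨hy, rfl⟩, hxy⟩)
      (by
        intro he
        rw [← he] at hv
        simp at hv))
    have h1 := card_image_refine (S.erase v) (Finset.mem_image_of_mem π hy) κ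
    have h2 := cross_refine (S.erase v) w π (π y) κ
    have h3 := hbound (refine π (π y) κ)
    obtain ⟨m, hm⟩ := even_cross hw (S.erase v) π
    omega
  have h1 := cross_add_edge_of_ne (w := w) hx hy hne
  have h2 := hbound π
  omega

theorem Part.solvable {S : Finset V} {w : V → V → ℕ} (h : Part S w) (hw : ∀ i j, w i j = w j i)
    {γ : V → ZMod 3} (hγ : ∑ i ∈ S, γ i = 0) : Solvable S w γ := by
  rcases Nat.lt_or_ge 1 S.card with hS | hS
  swap
  · exact solvable_of_card_le_one hS w hγ
  by_cases hmin : Minimal S w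
  swap
  · unfold Minimal at hmin
    push Not at hmin
    obtain ⟨A, hA, h2, hAS, hPA⟩ := hmin
    obtain ⟨a, ha⟩ : A.Nonempty := Finset.card_pos.1 (by omega)
    have hlt₁ := card_image_contr_lt hA ha h2
    have hlt₂ := Finset.card_lt_card (hA.ssubset_of_ne hAS)
    refine Solvable.of_contr hA ha hw ((h.quot _).solvable (quot_symm hw _ _) ?_)
      fun g _ hg => hPA.solvable hw ?_
    · unfold push
      rw [sum_fibers, filter_mem_image, hγ]
    · simp [Finset.sum_sub_distrib, hg]
  rcases Nat.lt_or_ge 2 S.card with hS2 | hS2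
  swap
  · obtain ⟨x, y, hxy, rfl⟩ := Finset.card_eq_two.1 (show S.card = 2 by omega)
    have := h.four_le hxy hw
    exact solvable_pair hxy hw (by omega) hγ
  have hsub : ∀ v ∈ S, {v} ⊆ S ∧ ({v} : Finset V).Nonempty ∧ {v} ≠ S := fun v hv =>
    ⟨by simpa, by simp, by rintro rfl; simp at hS⟩
  by_cases h5 : ∃ v ∈ S, cut S w 0 {v} = 5
  · obtain ⟨v, hv, hdeg⟩ := h5
    have hcs := cut_singleton (S := S) (w := w) (c := 0) v
    rw [hdeg, Pi.zero_apply, add_zero] at hcs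
    obtain ⟨y, hy, hwy⟩ := Finset.exists_ne_zero_of_sum_ne_zero (show ∑ j ∈ S.erase v, w v j ≠ 0 by
      omega)
    have hyv := Finset.ne_of_mem_erase hy
    have hwy4 : w v y < 4 := by
      by_contra! hle
      refine hmin {v, y} ?_ (Finset.card_pair hyv.symm).ge ?_ (part_pair hyv.symm hw hle)
      · simp [Finset.insert_subset_iff, hv, Finset.mem_of_mem_erase hy]
      · intro he
        rw [← he, Finset.card_pair hyv.symm] at hS2
        omega
    rw [← Finset.add_sum_erase _ _ hy] at hcs
    obtain ⟨z, hz, hwz⟩ := Finset.exists_ne_zero_of_sum_ne_zero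
      (show ∑ j ∈ (S.erase v).erase y, w v j ≠ 0 by omega)
    obtain ⟨hzy, hz⟩ := Finset.mem_erase.1 hz
    rw [Finset.add_sum_erase _ _ hy] at hcs
    have h3 : 2 ≤ ∑ j ∈ S.erase v, (w v j - ((if j = y then 1 else 0) + if j = z then 1 else 0)) := by
      have hle : ∑ j ∈ S.erase v, w v j ≤
          ∑ j ∈ S.erase v, (w v j - ((if j = y then 1 else 0) + if j = z then 1 else 0)) +
          ∑ j ∈ S.erase v, ((if j = y then 1 else 0) + if j = z then 1 else 0) := by
        rw [← Finset.sum_add_distrib]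
        exact Finset.sum_le_sum fun j _ => by omega
      rw [Finset.sum_add_distrib (s := S.erase v) (f := fun j => if j = y then 1 else 0),
        Finset.sum_ite_eq', Finset.sum_ite_eq', if_pos hy, if_pos hz] at hle
      omega
    obtain ⟨f, hfa, hfs⟩ := (attainable_of_two_le h3 (γ v)).exists_sum
    have hlt := Finset.card_erase_lt_of_mem hv
    refine Solvable.of_lift_erase hw hv hy hz hzy.symm (by omega) (by omega) hfa hfs
      ((hmin.part_erase h hw hv hS2 hdeg hy hz hzy.symm).solvable
        (fun i j => by simp only [Pi.add_apply, hw i j, edge_symm y z i j]) ?_)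
    simp only [Pi.add_apply, Finset.sum_add_distrib, hfs]
    rw [add_comm, Finset.add_sum_erase S γ hv, hγ]
  · refine Good.solvable (c := 0) (s := 0) ⟨hw, hγ, by simp, fun A hA hne hAS => Or.inl ?_, ?_⟩
    · have h1 := hmin.le_cut h hw hA hne hAS
      have hpos : 0 < (S \ A).card := Finset.card_pos.2
        (Finset.sdiff_nonempty.2 fun h => hAS (hA.antisymm h))
      have hsum := Finset.card_sdiff_add_card_eq_card hA
      by_cases hA2 : 2 ≤ A.card
      · by_cases hB2 : 2 ≤ (S \ A).card
        · rw [if_pos hA2, if_pos hB2] at h1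
          exact h1
        · obtain ⟨v, hB⟩ := Finset.card_eq_one.1 (show (S \ A).card = 1 by omega)
          have hv : v ∈ S := Finset.sdiff_subset (hB ▸ Finset.mem_singleton_self v)
          have hAe : A = S.erase v := by
            rw [← Finset.sdiff_singleton_eq_erase, ← hB, Finset.sdiff_sdiff_eq_self hA]
          have h2 := cut_compl_singleton (c := 0) hw hv
          have h3 : cut S w 0 {v} ≠ 5 := fun h => h5 ⟨v, hv, h⟩
          rw [← hAe] at h2
          simp at h2
          rw [if_pos hA2] at h1
          omega
      · have := hne.card_pos
        obtain ⟨v, rfl⟩ := Finset.card_eq_one.1 (show A.card = 1 by omega)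
        have h3 : cut S w 0 {v} ≠ 5 := fun h => h5 ⟨v, by simpa using hA, h⟩
        rw [Finset.card_singleton] at hsum
        have h4 : 2 ≤ (S \ {v}).card := by omega
        rw [Finset.card_singleton, if_neg (by omega), if_pos h4] at h1
        omega
    · simp [Small]
termination_by S.card

end Z3Flow

namespace Multigraph

open Z3Flow

variable {V E : Type} {G : Multigraph V E}

lemma exists_crossing_edge {F : Set E} (hF : ∀ u v, Relation.ReflTransGen (G.AdjOn F) u v)
    {π : V → ℕ} {u v : V} (huv : π u ≠ π v) : ∃ e ∈ F, π (G.fst e) ≠ π (G.snd e) := by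
  by_contra! hne
  have key : π u = π v := by
    clear huv
    induction hF u v with
    | refl => rfl
    | tail _ hbc ih =>
      obtain ⟨e, he, ⟨rfl, rfl⟩ | ⟨rfl, rfl⟩⟩ := hbc
      · rw [ih, hne e he]
      · rw [ih, hne e he]
  exact huv key

open Classical in
lemma card_image_le_crossing [Fintype V] [Fintype E] {F : Set E}
    (hF : ∀ u v, Relation.ReflTransGen (G.AdjOn F) u v) (π : V → ℕ) : (Finset.univ.image π).card ≤
      ({e | e ∈ F ∧ π (G.fst e) ≠ π (G.snd e)} : Finset E).card + 1 := by
  by_cases hc : (Finset.univ.image π).card ≤ 1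
  · omega
  obtain ⟨_, hu, _, hv, huv⟩ := Finset.one_lt_card.1 (not_le.1 hc)
  obtain ⟨u, -, rfl⟩ := Finset.mem_image.1 hu
  obtain ⟨v, -, rfl⟩ := Finset.mem_image.1 hv
  obtain ⟨e, he, hπ⟩ := exists_crossing_edge hF huv
  set ρ : V → ℕ := fun x => if π x = π (G.snd e) then π (G.fst e) else π x with hρ
  have himg : Finset.univ.image ρ = (Finset.univ.image π).erase (π (G.snd e)) := by
    ext m
    simp only [Finset.mem_image, Finset.mem_univ, true_and, Finset.mem_erase, hρ]
    constructor
    · rintro ⟨x, rfl⟩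
      split_ifs with hx
      · exact ⟨hπ, _, rfl⟩
      · exact ⟨hx, _, rfl⟩
    · rintro ⟨hm, x, rfl⟩
      exact ⟨x, if_neg hm⟩
  have hcard : (Finset.univ.image ρ).card + 1 = (Finset.univ.image π).card := by
    rw [himg]
    exact Finset.card_erase_add_one (Finset.mem_image_of_mem _ (Finset.mem_univ _))
  have hsub : ({e | e ∈ F ∧ ρ (G.fst e) ≠ ρ (G.snd e)} : Finset E) ⊂
      ({e | e ∈ F ∧ π (G.fst e) ≠ π (G.snd e)} : Finset E) := by
    rw [Finset.ssubset_iff_of_subset]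
    · exact ⟨e, by simp [he, hπ], by simp [hρ]⟩
    · intro e'
      simp only [Finset.mem_filter, Finset.mem_univ, true_and, hρ]
      exact fun h => ⟨h.1, fun h' => h.2 (by rw [h'])⟩
  have := card_image_le_crossing hF ρ
  have := Finset.card_lt_card hsub
  omega
termination_by (Finset.univ.image π).card
decreasing_by exact hcard.le

variable [DecidableEq V]

variable (G) in
/-- The number of edges of `A` joining two given vertices. -/
def mult (A : Finset E) : V → V → ℕ := ∑ e ∈ A, edge (G.fst e) (G.snd e)

lemma mult_symm (A : Finset E) (i j : V) : G.mult A i j = G.mult A j i := by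
  simp only [mult, Finset.sum_apply]
  exact Finset.sum_congr rfl fun e _ => edge_symm _ _ i j

lemma outDeg_eq_sum [Fintype E] (o : E → Bool) (v : V) :
    (G.outDeg o v : ZMod 3) = ∑ e, if v = G.tail o e then 1 else 0 := by
  rw [outDeg, outDegOn, Finset.sum_boole, ← Set.ncard_coe_finset]
  congr 2
  ext e
  simp [eq_comm]

variable [Fintype V]

lemma cross_edge {x y : V} (π : V → ℕ) :
    cross Finset.univ (edge x y) π = if π x ≠ π y then 2 else 0 := by
  by_cases h : π x = π y
  · rw [if_neg (not_not.2 h)]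
    refine Finset.sum_eq_zero fun i _ => Finset.sum_eq_zero fun j _ => ?_
    unfold edge
    split_ifs with h1 h2 <;> try rfl
    rcases h2 with ⟨rfl, rfl⟩ | ⟨rfl, rfl⟩
    · exact (h1 h).elim
    · exact (h1 h.symm).elim
  · have hxy : x ≠ y := fun h' => h (by rw [h'])
    have key (i j : V) : (if π i ≠ π j then edge x y i j else 0) =
        (if i = x then if j = y then 1 else 0 else 0) +
          if i = y then if j = x then 1 else 0 else 0 := by
      unfold edge
      by_cases h1 : i = x ∧ j = y
      · obtain ⟨rfl, rfl⟩ := h1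
        simp [h, hxy]
      · by_cases h2 : i = y ∧ j = x
        · obtain ⟨rfl, rfl⟩ := h2
          simp [Ne.symm h, hxy.symm]
        · simp [h1, h2, ← ite_and]
    simp only [cross, key, Finset.sum_add_distrib]
    simp [h, Finset.sum_ite_irrel]

lemma cross_mult (A : Finset E) (π : V → ℕ) :
    cross Finset.univ (G.mult A) π = 2 * {e ∈ A | π (G.fst e) ≠ π (G.snd e)}.card := by
  have h : cross Finset.univ (G.mult A) π =
      ∑ e ∈ A, cross Finset.univ (edge (G.fst e) (G.snd e)) π := by
    unfold cross mult
    rw [Finset.sum_comm (s := A)]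
    refine Finset.sum_congr rfl fun i _ => ?_
    rw [Finset.sum_comm (s := A)]
    refine Finset.sum_congr rfl fun j _ => ?_
    split_ifs <;> simp
  simp only [h, cross_edge, Finset.card_filter, Finset.mul_sum, mul_ite, mul_one, mul_zero]

/-- A flow on the multigraph splits into nonzero flows along the edges. -/
lemma exists_sign (A : Finset E) {n : V → V → ZMod 3} (h : Attains Finset.univ (G.mult A) n) :
    ∃ sg : E → ZMod 3, (∀ e, sg e ≠ 0) ∧ ∀ v, ∑ u, n v u =
      ∑ e ∈ A, sg e * ((if v = G.fst e then 1 else 0) - (if v = G.snd e then 1 else 0)) := by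
  classical
  induction A using Finset.induction_on generalizing n with
  | empty =>
    refine ⟨1, fun e => by simp, fun v => ?_⟩
    rw [Finset.sum_empty]
    refine Finset.sum_eq_zero fun u _ => ?_
    by_cases huv : v = u
    · exact huv ▸ h.self v
    · simpa [mult] using h.2 v (Finset.mem_univ v) u (Finset.mem_univ u) huv
  | insert e A he ih =>
    rw [mult, Finset.sum_insert he, add_comm, ← mult] at h
    obtain ⟨ε, hε, h'⟩ := h.remove_edge (mult_symm A) (Finset.mem_univ _) (Finset.mem_univ _)
      (G.loopless e)
    obtain ⟨sg, hsg, hsum⟩ := ih h'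
    refine ⟨Function.update sg e ε, fun e' => ?_, fun v => ?_⟩
    · by_cases hee : e' = e
      · simpa [hee] using hε
      · simpa [hee] using hsg e'
    · have h1 := hsum v
      rw [Finset.sum_sub_distrib, ← Finset.mul_sum,
        sum_arc (Finset.mem_univ _) (Finset.mem_univ _), sub_eq_iff_eq_add] at h1
      rw [Finset.sum_insert he, h1, Function.update_self, add_comm]
      congr 1
      refine Finset.sum_congr rfl fun e' he' => ?_
      rw [Function.update_of_ne (ne_of_mem_of_not_mem he' he)]

variable [Fintype E]

lemma HasEdgeDisjointSpanningTrees.part (h : G.HasEdgeDisjointSpanningTrees 4) :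
    Part Finset.univ (G.mult Finset.univ) := fun π => by
  classical
  obtain ⟨T, hT, hdisj⟩ := h
  have hle : ∑ i, ({e | e ∈ T i ∧ π (G.fst e) ≠ π (G.snd e)} : Finset E).card ≤
      ({e | π (G.fst e) ≠ π (G.snd e)} : Finset E).card := by
    rw [← Finset.card_biUnion]
    · refine Finset.card_le_card fun e => ?_
      simp
    · intro i _ j _ hij
      refine Finset.disjoint_left.2 fun e hi hj => ?_
      exact Set.disjoint_left.1 (hdisj i j hij) (Finset.mem_filter.1 hi).2.1
        (Finset.mem_filter.1 hj).2.1
  have hi (i : Fin 4) := card_image_le_crossing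
    (fun u v => (hT i).1.2 u (Set.mem_univ u) v (Set.mem_univ v)) π
  rw [cross_mult]
  rw [Fin.sum_univ_four] at hle
  linarith [hi 0, hi 1, hi 2, hi 3]

end Multigraph

/-- every graph containing `4` pairwise edge-disjoint spanning
trees is `Z₃`-connected. -/
theorem z3Connected_of_four_edge_disjoint_spanning_trees
    {V E : Type} [Fintype V] [Fintype E] (G : Multigraph V E)
    (h : G.HasEdgeDisjointSpanningTrees 4) :
    G.Z3Connected := by
  classical
  intro f hf
  set γ : V → ZMod 3 := fun v => 2 * f v -
    ∑ e, ((if v = G.fst e then 1 else 0) + (if v = G.snd e then 1 else 0)) with hγ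
  have hsum : ∑ v, γ v = 0 := by
    rw [hγ, Finset.sum_sub_distrib, ← Finset.mul_sum, ← hf, Finset.sum_comm]
    simp [Finset.sum_add_distrib, mul_comm, mul_two]
  obtain ⟨n, hn, hout⟩ := h.part.solvable (Multigraph.mult_symm _) hsum
  obtain ⟨sg, hsg, hflow⟩ := Multigraph.exists_sign _ hn
  refine ⟨fun e => decide (sg e = 1), fun v => ?_⟩
  have hv := (hflow v).symm.trans (hout v (Finset.mem_univ v))
  rw [hγ, eq_sub_iff_add_eq, ← Finset.sum_add_distrib] at hv
  have key : ∀ x y : ZMod 3, 2 * x = 2 * y → x = y := by decide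
  refine key _ _ ?_
  rw [← hv, Multigraph.outDeg_eq_sum, Finset.mul_sum]
  refine Finset.sum_congr rfl fun e _ => ?_
  have hs : ∀ x : ZMod 3, x ≠ 0 → x ≠ 1 → x = -1 := by decide
  by_cases h1 : sg e = 1
  · simp only [Multigraph.tail, h1, decide_true, if_true]
    ring
  · simp only [Multigraph.tail, h1, decide_false, Bool.false_eq_true, if_false]
    rw [hs _ (hsg e) h1]
    ring
end

section
/- Every graph that contains 4 pairwise edge-disjoint spanning trees admits a nowhere-zero 3-flow. -/
namespace ModThree

open scoped Pointwise

theorem zmod_three_cases (x : ZMod 3) : x = 0 ∨ x = 1 ∨ x = -1 := by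
  revert x; decide

/-- `x` is the residue of a sum of `n` signs. -/
def IsSignSum (n : ℕ) (x : ZMod 3) : Prop :=
  2 ≤ n ∨ (n = 1 ∧ x ≠ 0) ∨ (n = 0 ∧ x = 0)

/-- The degree `d` is large enough for the prescribed residue `c`. -/
def IsLarge (d : ℕ) (c : ZMod 3) : Prop :=
  6 ≤ d ∨ (d = 5 ∧ c ≠ 0) ∨ (d = 4 ∧ c = 0)

/-- The degree `d` exceeds the bound of `IsLarge` by at least two. -/
def IsExcessive (d : ℕ) (c : ZMod 3) : Prop :=
  8 ≤ d ∨ (d = 7 ∧ c ≠ 0) ∨ (d = 6 ∧ c = 0)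

/-- The degree `d` is at most the bound of `IsLarge`. -/
def IsSmall (d : ℕ) (c : ZMod 3) : Prop :=
  d ≤ 5 ∨ (d = 6 ∧ c ≠ 0) ∨ (d = 7 ∧ c = 0)

theorem IsSignSum.add {m n : ℕ} {x y : ZMod 3} (hx : IsSignSum m x) (hy : IsSignSum n y) :
    IsSignSum (m + n) (x + y) := by
  rcases hx with h | ⟨rfl, h⟩ | ⟨rfl, rfl⟩
  · left; omega
  · rcases hy with h | ⟨rfl, h⟩ | ⟨rfl, rfl⟩
    · left; omega
    · left; omega
    · right; left; simpa using h
  · simpa using hy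

theorem isSignSum_one {x : ZMod 3} (hx : x ≠ 0) : IsSignSum 1 x := Or.inr (Or.inl ⟨rfl, hx⟩)

theorem isSignSum_zero : IsSignSum 0 0 := Or.inr (Or.inr ⟨rfl, rfl⟩)

theorem IsSignSum.eq_zero {x : ZMod 3} (h : IsSignSum 0 x) : x = 0 := by
  simpa [IsSignSum] using h

theorem IsSignSum.exists_sub {n : ℕ} {x : ZMod 3} (h : IsSignSum (n + 1) x) :
    ∃ y ≠ 0, IsSignSum n (x - y) := by
  rcases n with _ | _ | n
  · exact ⟨x, by simpa [IsSignSum] using h, by simpa using isSignSum_zero⟩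
  · have : ∃ y ≠ 0, x - y ≠ 0 := by clear h; revert x; decide
    obtain ⟨y, hy, hxy⟩ := this
    exact ⟨y, hy, isSignSum_one hxy⟩
  · exact ⟨1, by decide, Or.inl (by omega)⟩

theorem IsSignSum.sum {ι : Type} (s : Finset ι) {w : ι → ℕ} {x : ι → ZMod 3}
    (h : ∀ i ∈ s, IsSignSum (w i) (x i)) : IsSignSum (∑ i ∈ s, w i) (∑ i ∈ s, x i) := by
  classical
  induction s using Finset.induction_on with
  | empty => simpa using isSignSum_zero
  | insert a s ha ih =>
    rw [Finset.sum_insert ha, Finset.sum_insert ha]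
    exact (h a (by simp)).add (ih fun i hi => h i (by simp [hi]))

theorem isSmall_of_not_isExcessive {d : ℕ} {c : ZMod 3} (h : ¬ IsExcessive d c) :
    IsSmall d c := by
  unfold IsExcessive IsSmall at *
  grind

theorem IsLarge.add_two {d : ℕ} {c : ZMod 3} (h : IsLarge d c) : IsLarge (d + 2) c := by
  unfold IsLarge at *
  grind

theorem IsExcessive.isLarge {d d' : ℕ} {c c' : ZMod 3} (h : IsExcessive d c) (hd : d ≤ d') :
    IsLarge d' c' := by
  unfold IsLarge IsExcessive at *
  grind

theorem IsExcessive.isLarge_sub {d d' : ℕ} {c x : ZMod 3} (h : IsExcessive d c) (hx : x ≠ 0)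
    (hd : d ≤ d' + 1) : IsLarge d' (c - x) := by
  unfold IsLarge IsExcessive at *
  grind

theorem IsExcessive.isLarge_of_add_two {d : ℕ} {c : ZMod 3} (h : IsExcessive (d + 2) c) :
    IsLarge d c := by
  unfold IsLarge IsExcessive at *
  grind

variable {V : Type} [DecidableEq V]

/-- The boundary of the unit flow along the ordered pair `e`. -/
def unitFlow (e : V × V) : V → ZMod 3 := Pi.single e.1 1 - Pi.single e.2 1

/-- The boundaries modulo `3` of the orientations of the multigraph with edges `M`. -/
def boundaries (M : Multiset (V × V)) : Set (V → ZMod 3) :=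
  (M.map fun e => {b : V → ZMod 3 | ∃ x : ZMod 3, x ≠ 0 ∧ b = x • unitFlow e}).sum

/-- The number of edges of `M` with exactly one end in `A`. -/
def cut (M : Multiset (V × V)) (A : Finset V) : ℕ :=
  M.countP fun e => ¬ (e.1 ∈ A ↔ e.2 ∈ A)

@[simp] theorem boundaries_zero : boundaries (0 : Multiset (V × V)) = {0} := by
  simp [boundaries, ← Set.singleton_zero]

theorem boundaries_add (M N : Multiset (V × V)) :
    boundaries (M + N) = boundaries M + boundaries N := by
  simp [boundaries]

theorem mem_boundaries_cons {e : V × V} {M : Multiset (V × V)} {b : V → ZMod 3} :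
    b ∈ boundaries (e ::ₘ M) ↔ ∃ x : ZMod 3, x ≠ 0 ∧ b - x • unitFlow e ∈ boundaries M := by
  simp only [boundaries, Multiset.map_cons, Multiset.sum_cons, Set.mem_add, Set.mem_ofPred_eq]
  constructor
  · rintro ⟨_, ⟨x, hx, rfl⟩, b', hb', rfl⟩
    exact ⟨x, hx, by simpa using hb'⟩
  · rintro ⟨x, hx, h⟩
    exact ⟨_, ⟨x, hx, rfl⟩, _, h, by simp⟩

theorem add_mem_boundaries {M N : Multiset (V × V)} {b b' : V → ZMod 3}
    (h : b ∈ boundaries M) (h' : b' ∈ boundaries N) : b + b' ∈ boundaries (M + N) := by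
  rw [boundaries_add]; exact Set.add_mem_add h h'

theorem exists_of_mem_boundaries_add {M N : Multiset (V × V)} {b : V → ZMod 3}
    (h : b ∈ boundaries (M + N)) : ∃ b₁ ∈ boundaries M, ∃ b₂ ∈ boundaries N, b₁ + b₂ = b := by
  rw [boundaries_add] at h; exact Set.mem_add.1 h

theorem unitFlow_swap (u v : V) : unitFlow (u, v) = -unitFlow (v, u) := by
  simp [unitFlow]

theorem unitFlow_add (u v w : V) : unitFlow (u, v) + unitFlow (v, w) = unitFlow (u, w) := by
  simp [unitFlow]

theorem boundaries_swap (u v : V) (M : Multiset (V × V)) :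
    boundaries ((u, v) ::ₘ M) ⊆ boundaries ((v, u) ::ₘ M) := by
  intro b hb
  obtain ⟨x, hx, h⟩ := mem_boundaries_cons.1 hb
  refine mem_boundaries_cons.2 ⟨-x, by simpa using hx, ?_⟩
  rw [unitFlow_swap v u]
  simpa using h

/-- Splitting off a pair of edges at `v`. -/
theorem boundaries_lift (u v w : V) (M : Multiset (V × V)) :
    boundaries ((u, w) ::ₘ M) ⊆ boundaries ((v, u) ::ₘ (v, w) ::ₘ M) := by
  intro b hb
  obtain ⟨x, hx, h⟩ := mem_boundaries_cons.1 hb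
  refine mem_boundaries_cons.2 ⟨-x, by simpa using hx, mem_boundaries_cons.2 ⟨x, hx, ?_⟩⟩
  rw [← unitFlow_add u v w, unitFlow_swap u v] at h
  convert h using 1
  module

theorem boundaries_cons_mono {M N : Multiset (V × V)} (h : boundaries M ⊆ boundaries N)
    (e : V × V) : boundaries (e ::ₘ M) ⊆ boundaries (e ::ₘ N) := by
  intro b hb
  obtain ⟨x, hx, hb⟩ := mem_boundaries_cons.1 hb
  exact mem_boundaries_cons.2 ⟨x, hx, h hb⟩

theorem sum_unitFlow (e : V × V) (A : Finset V) :
    ∑ v ∈ A, unitFlow e v = (if e.1 ∈ A then 1 else 0) - (if e.2 ∈ A then 1 else 0) := by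
  simp [unitFlow]

theorem cut_cons (e : V × V) (M : Multiset (V × V)) (A : Finset V) :
    cut (e ::ₘ M) A = cut M A + if (e.1 ∈ A ↔ e.2 ∈ A) then 0 else 1 := by
  simp only [cut, Multiset.countP_cons]
  split_ifs <;> simp_all

@[simp] theorem cut_zero (A : Finset V) : cut (0 : Multiset (V × V)) A = 0 := by simp [cut]

theorem cut_add (M N : Multiset (V × V)) (A : Finset V) : cut (M + N) A = cut M A + cut N A := by
  simp [cut]

theorem cut_le_card (M : Multiset (V × V)) (A : Finset V) : cut M A ≤ M.card :=
  Multiset.countP_le_card _ _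

theorem isSignSum_cut {M : Multiset (V × V)} {b : V → ZMod 3} (h : b ∈ boundaries M)
    (A : Finset V) : IsSignSum (cut M A) (∑ v ∈ A, b v) := by
  induction M using Multiset.induction_on generalizing b with
  | empty =>
    simp only [boundaries_zero, Set.mem_singleton_iff] at h
    simpa [h] using isSignSum_zero
  | cons e M ih =>
    obtain ⟨x, hx, h⟩ := mem_boundaries_cons.1 h
    have h1 := ih h
    have h2 : ∑ v ∈ A, b v = ∑ v ∈ A, (b - x • unitFlow e) v + x * ∑ v ∈ A, unitFlow e v := by
      simp [Finset.sum_sub_distrib, Finset.mul_sum]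
    rw [h2, cut_cons]
    refine h1.add ?_
    rw [sum_unitFlow]
    by_cases h3 : e.1 ∈ A <;> by_cases h4 : e.2 ∈ A <;>
      simp [h3, h4, isSignSum_zero, isSignSum_one, hx]

theorem exists_mem_boundaries {M : Multiset (V × V)} {x : ZMod 3} (A : Finset V)
    (h : IsSignSum (cut M A) x) : ∃ b ∈ boundaries M, ∑ v ∈ A, b v = x := by
  induction M using Multiset.induction_on generalizing x with
  | empty =>
    rw [cut_zero] at h
    exact ⟨0, by simp, by simp [h.eq_zero]⟩
  | cons e M ih =>
    have key : ∃ y ≠ 0, IsSignSum (cut M A) (x - y * ∑ v ∈ A, unitFlow e v) := by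
      rw [cut_cons] at h
      rw [sum_unitFlow]
      by_cases h3 : e.1 ∈ A <;> by_cases h4 : e.2 ∈ A <;> simp only [h3, h4, if_true, if_false,
        iff_self, iff_true, iff_false, not_true, add_zero] at h ⊢
      · exact ⟨1, by decide, by simpa using h⟩
      · obtain ⟨y, hy, h⟩ := h.exists_sub
        exact ⟨y, hy, by simpa using h⟩
      · obtain ⟨y, hy, h⟩ := h.exists_sub
        exact ⟨-y, by simpa using hy, by simpa using h⟩
      · exact ⟨1, by decide, by simpa using h⟩
    obtain ⟨y, hy, h⟩ := key
    obtain ⟨b, hb, hbx⟩ := ih h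
    refine ⟨b + y • unitFlow e, mem_boundaries_cons.2 ⟨y, hy, by simpa using hb⟩, ?_⟩
    simp [Finset.sum_add_distrib, ← Finset.mul_sum, hbx]

theorem eq_zero_of_cut_eq_zero {M : Multiset (V × V)} {b : V → ZMod 3} (h : b ∈ boundaries M)
    {v : V} (hv : cut M {v} = 0) : b v = 0 := by
  have := isSignSum_cut h {v}
  rw [hv] at this
  simpa using this.eq_zero

theorem cut_eq_zero {M : Multiset (V × V)} {A : Finset V}
    (h : ∀ e ∈ M, (e.1 ∈ A ↔ e.2 ∈ A)) : cut M A = 0 := by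
  simpa [cut, Multiset.countP_eq_zero] using h

theorem sum_cut_singleton {M : Multiset (V × V)} {A : Finset V}
    (h : ∀ e ∈ M, ¬ (e.1 ∈ A ∧ e.2 ∈ A)) : ∑ v ∈ A, cut M {v} = cut M A := by
  induction M using Multiset.induction_on with
  | empty => simp
  | cons e M ih =>
    have h1 := h e (by simp)
    simp only [cut_cons, Finset.sum_add_distrib]
    rw [ih fun e he => h e (by simp [he])]
    congr 1
    by_cases h3 : e.1 ∈ A <;> by_cases h4 : e.2 ∈ A
    · exact absurd ⟨h3, h4⟩ h1
    · rw [Finset.sum_eq_single_of_mem e.1 h3] <;> simp <;> grind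
    · rw [Finset.sum_eq_single_of_mem e.2 h4] <;> simp <;> grind
    · rw [Finset.sum_eq_zero] <;> simp <;> grind

/-- The pushforward of a function along a map of vertices. -/
def push [Fintype V] {R : Type} [AddCommMonoid R] (f : V → V) (b : V → R) (v : V) : R :=
  ∑ u with f u = v, b u

theorem sum_push [Fintype V] {R : Type} [AddCommMonoid R] (f : V → V) (b : V → R)
    (B : Finset V) : ∑ v ∈ B, push f b v = ∑ u with f u ∈ B, b u := by
  unfold push
  rw [← Finset.sum_fiberwise_of_maps_to (s := Finset.univ.filter fun u => f u ∈ B) (t := B) (g := f)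
    (by simp)]
  refine Finset.sum_congr rfl fun v hv => Finset.sum_congr ?_ fun _ _ => rfl
  ext u
  simp only [Finset.mem_filter, Finset.mem_univ, true_and]
  grind

theorem push_unitFlow [Fintype V] (f : V → V) (e : V × V) :
    push f (unitFlow e) = unitFlow (Prod.map f f e) := by
  funext v
  unfold push
  rw [sum_unitFlow]
  simp [unitFlow, Pi.single_apply, eq_comm]

theorem exists_push_eq [Fintype V] (f : V → V) {M : Multiset (V × V)} {b : V → ZMod 3}
    (h : b ∈ boundaries (M.map (Prod.map f f))) : ∃ b' ∈ boundaries M, push f b' = b := by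
  induction M using Multiset.induction_on generalizing b with
  | empty =>
    simp only [Multiset.map_zero, boundaries_zero, Set.mem_singleton_iff] at h
    exact ⟨0, by simp, by funext; simp [push, h]⟩
  | cons e M ih =>
    rw [Multiset.map_cons] at h
    obtain ⟨x, hx, h⟩ := mem_boundaries_cons.1 h
    obtain ⟨b', hb', hb⟩ := ih h
    refine ⟨b' + x • unitFlow e, mem_boundaries_cons.2 ⟨x, hx, by simpa using hb'⟩, ?_⟩
    rw [← push_unitFlow] at hb
    rw [eq_sub_iff_add_eq] at hb
    rw [← hb]
    funext v
    simp [push, Finset.sum_add_distrib, Finset.mul_sum]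

theorem cut_map [Fintype V] (f : V → V) (M : Multiset (V × V)) (B : Finset V) :
    cut (M.map (Prod.map f f)) B = cut M (Finset.univ.filter fun u => f u ∈ B) := by
  rw [cut, Multiset.countP_map, cut, Multiset.countP_eq_card_filter]
  simp

/-- The map contracting `A` to the vertex `a`. -/
def contract (A : Finset V) (a v : V) : V := if v ∈ A then a else v

theorem contract_of_mem {A : Finset V} {v : V} (hv : v ∈ A) (a : V) : contract A a v = a :=
  if_pos hv

theorem contract_of_notMem {A : Finset V} {v : V} (hv : v ∉ A) (a : V) : contract A a v = v :=
  if_neg hv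

theorem contract_mem_iff {A U : Finset V} (hA : A ⊆ U) {a : V} (ha : a ∈ A) (u : V) :
    contract A a u ∈ insert a (U \ A) ↔ u ∈ U := by
  by_cases hu : u ∈ A
  · simp [contract_of_mem hu, hA hu]
  · simp only [contract_of_notMem hu, Finset.mem_insert, Finset.mem_sdiff]
    have : u ≠ a := by rintro rfl; exact hu ha
    simp [hu, this]

theorem push_contract_self [Fintype V] {A : Finset V} {a : V} (ha : a ∈ A) (g : V → ZMod 3) :
    push (contract A a) g a = ∑ v ∈ A, g v := by
  unfold push
  refine Finset.sum_congr ?_ fun _ _ => rfl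
  ext u
  by_cases hu : u ∈ A
  · simp [hu, contract_of_mem]
  · simp only [Finset.mem_filter, Finset.mem_univ, true_and, contract_of_notMem hu, hu, iff_false]
    rintro rfl
    exact hu ha

theorem push_contract_of_notMem [Fintype V] {A : Finset V} {a : V} (ha : a ∈ A)
    (g : V → ZMod 3) {v : V} (hv : v ∉ A) : push (contract A a) g v = g v := by
  unfold push
  rw [Finset.sum_eq_single_of_mem v (by simp [contract_of_notMem hv])]
  intro u hu huv
  have := (Finset.mem_filter.1 hu).2
  by_cases huA : u ∈ A
  · rw [contract_of_mem huA] at this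
    exact absurd (this ▸ ha) hv
  · exact absurd ((contract_of_notMem huA a).symm.trans this) huv

/-- The data of a multigraph on the vertex set `U` together with an extra vertex all of whose
edges are already oriented: `w v` counts these edges at `v`, the target boundary of the whole
graph is `c`, and the target boundary of the remaining edges `M` is `b`. -/
structure IsAdmissible (U : Finset V) (M : Multiset (V × V)) (b c : V → ZMod 3) (w : V → ℕ) :
    Prop where
  two_le : 2 ≤ U.card
  mem : ∀ e ∈ M, e.1 ∈ U ∧ e.2 ∈ U
  supp : ∀ v ∉ U, b v = 0
  sum_eq : ∑ v ∈ U, b v = 0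
  sign : ∀ v ∈ U, IsSignSum (w v) (c v - b v)
  small : IsSmall (∑ v ∈ U, w v) (∑ v ∈ U, c v)
  large : ∀ A ⊆ U, A.Nonempty → A ≠ U → IsLarge (cut M A + ∑ v ∈ A, w v) (∑ v ∈ A, c v)

/-- The quantity on which the main induction is based. -/
def size (U : Finset V) (M : Multiset (V × V)) (w : V → ℕ) : ℕ :=
  U.card + 4 * M.card + ∑ v ∈ U, w v

/-- All admissible data of size less than `n` are solvable. -/
def SolvableBelow (V : Type) [DecidableEq V] (n : ℕ) : Prop :=
  ∀ (U : Finset V) (M : Multiset (V × V)) (b c : V → ZMod 3) (w : V → ℕ),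
    size U M w < n → IsAdmissible U M b c w → b ∈ boundaries M

namespace IsAdmissible

variable {U : Finset V} {M : Multiset (V × V)} {b c : V → ZMod 3} {w : V → ℕ}

theorem mem_of_loop {e : V × V} (h : IsAdmissible U (e ::ₘ M) b c w) (he : e.1 = e.2)
    (ih : SolvableBelow V (size U (e ::ₘ M) w)) : b ∈ boundaries (e ::ₘ M) := by
  refine mem_boundaries_cons.2 ⟨1, by decide, ?_⟩
  have : unitFlow e = 0 := by simp [unitFlow, he]
  rw [this, smul_zero, sub_zero]
  refine ih U M b c w (by simp [size]) { h with mem := fun e he => h.mem e (by simp [he]), large := ?_ }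
  intro A hA hne hAU
  simpa [cut_cons, he] using h.large A hA hne hAU

theorem mem_of_card_eq_two (h : IsAdmissible U M b c w) (hU : U.card = 2) : b ∈ boundaries M := by
  obtain ⟨x, y, hxy, rfl⟩ := Finset.card_eq_two.1 hU
  have hx := h.large {x} (by simp) (by simp) (by
    intro h; exact hxy (by simpa using (Finset.ext_iff.1 h y).symm : y = x).symm)
  have hy := h.large {y} (by simp) (by simp) (by
    intro h; exact hxy (by simpa using (Finset.ext_iff.1 h x)))
  have hcut : cut M {x} = cut M {y} := by
    refine Multiset.countP_congr rfl fun e he => ?_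
    have := h.mem e he
    simp only [Finset.mem_insert, Finset.mem_singleton] at this ⊢
    grind
  have hs := h.small
  rw [Finset.sum_pair hxy, Finset.sum_pair hxy] at hs
  rw [← hcut] at hy
  simp only [Finset.sum_singleton] at hx hy
  have h2 : 2 ≤ cut M {x} := by
    unfold IsLarge IsSmall at *
    grind
  obtain ⟨b', hb', hb⟩ := exists_mem_boundaries (M := M) (x := b x) {x} (Or.inl h2)
  have hU0 := isSignSum_cut hb' {x, y}
  rw [cut_eq_zero fun e he => iff_of_true (h.mem e he).1 (h.mem e he).2] at hU0
  have hU0 := hU0.eq_zero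
  have hs := h.sum_eq
  rw [Finset.sum_pair hxy] at hU0 hs
  convert hb'
  funext v
  simp only [Finset.sum_singleton] at hb
  by_cases hvx : v = x
  · rw [hvx, hb]
  by_cases hvy : v = y
  · rw [hvy]
    grind
  rw [h.supp v (by simp [hvx, hvy])]
  symm
  refine eq_zero_of_cut_eq_zero hb' (cut_eq_zero fun e he => ?_)
  have := h.mem e he
  simp only [Finset.mem_insert, Finset.mem_singleton] at this ⊢
  grind

theorem mem_of_not_isExcessive [Fintype V] (h : IsAdmissible U M b c w)
    (ih : SolvableBelow V (size U M w)) {A : Finset V} (hA : A ⊆ U) (hA2 : 2 ≤ A.card)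
    (hAU : A ≠ U) (hex : ¬ IsExcessive (cut M A + ∑ v ∈ A, w v) (∑ v ∈ A, c v)) :
    b ∈ boundaries M := by
  obtain ⟨a, ha⟩ : A.Nonempty := Finset.card_pos.1 (by omega)
  have hlt : A.card < U.card := Finset.card_lt_card (hA.ssubset_of_ne hAU)
  set f : V → V := contract A a with hf
  have hfA : ∀ v ∈ A, f v = a := fun v hv => contract_of_mem hv a
  have hfn : ∀ v ∉ A, f v = v := fun v hv => contract_of_notMem hv a
  set U' := insert a (U \ A) with hU'
  have hfU : ∀ u, f u ∈ U' ↔ u ∈ U := contract_mem_iff hA ha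
  have hfix : ∀ u ∈ U', f u = u := by
    intro u hu
    by_cases hu' : u ∈ A
    · rw [hfA u hu']
      simp only [hU', Finset.mem_insert, Finset.mem_sdiff] at hu
      grind
    · exact hfn u hu'
  have hpre : (Finset.univ.filter fun u => f u ∈ U') = U := by ext u; simp [hfU]
  have hcard : U'.card = U.card - A.card + 1 := by
    rw [hU', Finset.card_insert_of_notMem (by simp [ha]), Finset.card_sdiff_of_subset hA]
  have hcontr : push f b ∈ boundaries (M.map (Prod.map f f)) := by
    refine ih U' _ (push f b) (push f c) (push f w) ?_ ⟨by omega, ?_, ?_, ?_, ?_, ?_, ?_⟩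
    · simp only [size, Multiset.card_map, sum_push, hpre]
      omega
    · intro e he
      obtain ⟨e', he', rfl⟩ := Multiset.mem_map.1 he
      simpa [hfU] using h.mem e' he'
    · intro v hv
      refine Finset.sum_eq_zero fun u hu => h.supp u fun huU => hv ?_
      rw [← (Finset.mem_filter.1 hu).2]
      exact (hfU u).2 huU
    · rw [sum_push, hpre, h.sum_eq]
    · intro v hv
      unfold push
      rw [← Finset.sum_sub_distrib]
      refine IsSignSum.sum _ fun u hu => h.sign u ?_
      rw [← hfU, (Finset.mem_filter.1 hu).2]
      exact hv
    · rw [sum_push, sum_push, hpre]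
      exact h.small
    · intro B hB ⟨v, hv⟩ hBU
      rw [sum_push, sum_push, cut_map]
      refine h.large _ ?_ ⟨v, ?_⟩ ?_
      · intro u hu
        exact (hfU u).1 (hB (Finset.mem_filter.1 hu).2)
      · simp [hfix v (hB hv), hv]
      · intro heq
        refine hBU (hB.antisymm fun u hu => ?_)
        have : u ∈ U := by rw [← hfU, hfix u hu]; exact hu
        rw [← heq, Finset.mem_filter, hfix u hu] at this
        exact this.2
  obtain ⟨b₀, hb₀, hpush⟩ := exists_push_eq f hcontr
  set N := M.filter fun e => e.1 ∈ A ∧ e.2 ∈ A with hN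
  set N' := M.filter fun e => ¬ (e.1 ∈ A ∧ e.2 ∈ A) with hN'
  have hM : N + N' = M := Multiset.filter_add_not _ _
  rw [← hM] at hb₀
  obtain ⟨b₁, hb₁, b₂, hb₂, rfl⟩ := exists_of_mem_boundaries_add hb₀
  have hN0 : ∀ e ∈ N, e.1 ∈ A ∧ e.2 ∈ A := fun e he => (Multiset.mem_filter.1 he).2
  have hN0' : ∀ e ∈ N', ¬ (e.1 ∈ A ∧ e.2 ∈ A) := fun e he => (Multiset.mem_filter.1 he).2
  have hNA : cut N A = 0 := cut_eq_zero fun e he => iff_of_true (hN0 e he).1 (hN0 e he).2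
  have hb₁A : ∑ v ∈ A, b₁ v = 0 := by
    have := isSignSum_cut hb₁ A
    rw [hNA] at this
    exact this.eq_zero
  have hdeg : ∀ B ⊆ A, ∑ v ∈ B, (w v + cut N' {v}) = cut N' B + ∑ v ∈ B, w v := by
    intro B hB
    rw [Finset.sum_add_distrib, sum_cut_singleton, add_comm]
    exact fun e he h => hN0' e he ⟨hB h.1, hB h.2⟩
  have hinner : b - b₂ ∈ boundaries N := by
    refine ih A N (b - b₂) c (fun v => w v + cut N' {v}) ?_ ⟨hA2, hN0, ?_, ?_, ?_, ?_, ?_⟩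
    · have h1 : ∑ v ∈ A, w v ≤ ∑ v ∈ U, w v := Finset.sum_le_sum_of_subset hA
      have h2 := cut_le_card N' A
      have h3 : M.card = N.card + N'.card := by rw [← hM, Multiset.card_add]
      simp only [size, hdeg A subset_rfl]
      omega
    · intro v hv
      have h1 := congrFun hpush v
      rw [push_contract_of_notMem ha _ hv, push_contract_of_notMem ha _ hv] at h1
      have h2 : b₁ v = 0 := by
        refine eq_zero_of_cut_eq_zero hb₁ (cut_eq_zero fun e he => ?_)
        have := hN0 e he
        simp only [Finset.mem_singleton]
        grind
      simp [← h1, h2]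
    · have h1 := congrFun hpush a
      rw [push_contract_self ha, push_contract_self ha] at h1
      simp only [Pi.add_apply, Finset.sum_add_distrib, hb₁A] at h1
      simp [← h1]
    · intro v hv
      have h1 := isSignSum_cut hb₂ {v}
      have h2 := (h.sign v (hA hv)).add h1
      simp only [Finset.sum_singleton] at h2
      convert h2 using 1
      simp only [Pi.sub_apply]
      ring
    · rw [hdeg A subset_rfl]
      have := isSmall_of_not_isExcessive hex
      rwa [← hM, cut_add, hNA, zero_add] at this
    · intro B hB hne hBA
      rw [hdeg B hB]
      have := h.large B (hB.trans hA) hne (by rintro rfl; exact hAU (hA.antisymm hB))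
      rwa [← hM, cut_add, add_assoc] at this
  have := add_mem_boundaries hinner hb₂
  rwa [sub_add_cancel, hM] at this

end IsAdmissible

theorem IsLarge.or_neg {d : ℕ} {c x : ZMod 3} (h : IsLarge d c) (h' : ¬ (d = 4 ∧ c = 0))
    (hx : x ≠ 0) : IsLarge (d - 1) (c - x) ∨ IsLarge (d - 1) (c - -x) := by
  have key : ∀ c x : ZMod 3, c ≠ 0 → x ≠ 0 → c - x = 0 ∨ c - -x = 0 := by decide
  have key' : ∀ x : ZMod 3, x ≠ 0 → (0 : ZMod 3) - x ≠ 0 := by decide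
  have hxc : c - x ≠ 0 ∨ c - -x ≠ 0 := by clear h h'; revert c x; decide
  have := key c x
  unfold IsLarge at *
  rcases h with h | ⟨rfl, hc⟩ | ⟨rfl, hc⟩
  · by_cases h6 : d = 6
    · subst h6
      rcases hxc with h | h
      · exact Or.inl (Or.inr (Or.inl ⟨rfl, h⟩))
      · exact Or.inr (Or.inr (Or.inl ⟨rfl, h⟩))
    · exact Or.inl (Or.inl (by omega))
  · exact (key c x hc hx).imp (fun h => Or.inr (Or.inr ⟨rfl, h⟩)) fun h => Or.inr (Or.inr ⟨rfl, h⟩)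
  · exact absurd ⟨rfl, hc⟩ h'

theorem IsLarge.eq_of_not_neg {d : ℕ} {c x : ZMod 3} (h : IsLarge (d - 1) (c - x))
    (h' : ¬ IsLarge (d - 1) (c - -x)) (hx : x ≠ 0) : (d = 5 ∧ c = x) ∨ (d = 6 ∧ c = -x) := by
  have h1 : c - x ≠ 0 → c - -x = 0 → c = -x := by clear h h'; revert c x; decide
  have h2 : c - x = 0 → c = x := sub_eq_zero.1
  unfold IsLarge at *
  push Not at h'
  rcases h with h | ⟨hd, hc⟩ | ⟨hd, hc⟩
  · omega
  · exact Or.inr ⟨by omega, h1 hc (h'.2.1 hd)⟩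
  · exact Or.inl ⟨by omega, h2 hc⟩

theorem IsSignSum.eq_of_not_sub {n : ℕ} {x y : ZMod 3} (h : IsSignSum (n + 1) y)
    (h' : ¬ IsSignSum n (y - x)) (hx : x ≠ 0) : y = -x * (n + 1 : ℕ) := by
  unfold IsSignSum at *
  rcases n with _ | _ | n
  · have h1 : y ≠ 0 := by simpa using h
    have h2 : y - x ≠ 0 := by simpa using h'
    clear h h'
    revert x y
    decide
  · have h2 : y - x = 0 := by simpa using h'
    clear h h'
    revert x y
    decide
  · omega

theorem IsSmall.add_one {d : ℕ} {x : ZMod 3} (h : IsSmall d (-x * d)) (hx : x ≠ 0) :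
    IsSmall (d + 1) (-x * d) := by
  have h5 : -x * (5 : ℕ) ≠ 0 := by clear h; revert x; decide
  have h6 : -x * (6 : ℕ) = 0 := by clear h; revert x; decide
  have h7 : -x * (7 : ℕ) ≠ 0 := by clear h; revert x; decide
  unfold IsSmall at *
  rcases h with h | ⟨rfl, h⟩ | ⟨rfl, h⟩
  · by_cases hd : d = 5
    · subst hd
      exact Or.inr (Or.inl ⟨rfl, h5⟩)
    · exact Or.inl (by omega)
  · exact absurd h6 h
  · exact absurd h h7

theorem isLarge_add_of_eq {d d' : ℕ} {c x : ZMod 3} (h : (d = 5 ∧ c = x) ∨ (d = 6 ∧ c = -x))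
    (hx : x ≠ 0) (hd : d ≤ d') : IsLarge d' (c + x) := by
  have hxx : x + x ≠ 0 := by clear h; revert x; decide
  unfold IsLarge
  rcases h with ⟨rfl, rfl⟩ | ⟨rfl, rfl⟩
  · by_cases h5 : d' = 5
    · exact Or.inr (Or.inl ⟨h5, hxx⟩)
    · exact Or.inl (by omega)
  · exact Or.inl hd

/-- Admissible data to which neither the removal of loops nor the contraction of a set applies. -/
structure IsReduced (U : Finset V) (M : Multiset (V × V)) (b c : V → ZMod 3) (w : V → ℕ) : Prop
    extends IsAdmissible U M b c w where
  three_le : 3 ≤ U.card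
  loopless : ∀ e ∈ M, e.1 ≠ e.2
  excessive : ∀ A ⊆ U, 2 ≤ A.card → A ≠ U →
    IsExcessive (cut M A + ∑ v ∈ A, w v) (∑ v ∈ A, c v)

namespace IsReduced

variable {U : Finset V} {M : Multiset (V × V)} {b c : V → ZMod 3} {w : V → ℕ}

theorem singleton_ne (h : IsReduced U M b c w) (v : V) : {v} ≠ U := by
  rintro rfl
  have := h.two_le
  simp at this

theorem large_singleton (h : IsReduced U M b c w) {v : V} (hv : v ∈ U) :
    IsLarge (cut M {v} + w v) (c v) := by
  simpa using h.large {v} (by simpa using hv) (by simp) (h.singleton_ne v)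

/-- Orienting an edge and moving it into the boundary, possibly with an increase of `w`. -/
theorem mem_of_delete_edge {e : V × V} (h : IsReduced U (e ::ₘ M) b c w)
    (ih : SolvableBelow V (size U (e ::ₘ M) w)) {x : ZMod 3} (hx : x ≠ 0) {w' : V → ℕ}
    (hw : ∀ v, w v ≤ w' v) (hw' : ∀ v ∈ U, v ≠ e.1 → v ≠ e.2 → w' v = w v)
    (hlt : ∑ v ∈ U, w' v < ∑ v ∈ U, w v + 4)
    (hsign : ∀ v ∈ U, IsSignSum (w' v) (c v - b v))
    (hsmall : IsSmall (∑ v ∈ U, w' v) (∑ v ∈ U, c v))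
    (h1 : IsLarge (cut M {e.1} + w' e.1) (c e.1 - x))
    (h2 : IsLarge (cut M {e.2} + w' e.2) (c e.2 + x)) : b ∈ boundaries (e ::ₘ M) := by
  have he := h.loopless e (by simp)
  have heU := h.mem e (by simp)
  have hsum : ∀ (g : V → ZMod 3) (A : Finset V), ∑ v ∈ A, (g - x • unitFlow e) v =
      ∑ v ∈ A, g v - x * ((if e.1 ∈ A then 1 else 0) - (if e.2 ∈ A then 1 else 0)) := by
    intro g A
    rw [← sum_unitFlow]
    simp [Finset.sum_sub_distrib, Finset.mul_sum]
  refine mem_boundaries_cons.2 ⟨x, hx, ih U M (b - x • unitFlow e) (c - x • unitFlow e) w' ?_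
    ⟨h.two_le, fun e he => h.mem e (by simp [he]), ?_, ?_, ?_, ?_, ?_⟩⟩
  · simp only [size, Multiset.card_cons]
    omega
  · intro v hv
    have h3 : v ≠ e.1 := by rintro rfl; exact hv heU.1
    have h4 : v ≠ e.2 := by rintro rfl; exact hv heU.2
    simp [h.supp v hv, unitFlow, h3, h4]
  · rw [hsum, h.sum_eq]
    simp [heU]
  · intro v hv
    simpa using hsign v hv
  · rw [hsum]
    simpa [heU] using hsmall
  · intro A hA hne hAU
    have hle : ∑ v ∈ A, w v ≤ ∑ v ∈ A, w' v := Finset.sum_le_sum fun v _ => hw v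
    rcases Nat.lt_or_ge A.card 2 with hA1 | hA2
    · obtain ⟨v, rfl⟩ := Finset.card_eq_one.1 (by have := hne.card_pos; omega : A.card = 1)
      rw [hsum]
      simp only [Finset.sum_singleton, Finset.mem_singleton]
      by_cases hv1 : v = e.1
      · subst hv1
        simpa [he.symm] using h1
      by_cases hv2 : v = e.2
      · subst hv2
        simpa [he] using h2
      have hvU : v ∈ U := by simpa using hA
      have h3 := h.large_singleton hvU
      rw [hw' v hvU hv1 hv2]
      simpa [cut_cons, Ne.symm hv1, Ne.symm hv2] using h3
    · have hex := h.excessive A hA hA2 hAU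
      rw [hsum]
      by_cases h3 : e.1 ∈ A <;> by_cases h4 : e.2 ∈ A <;>
        simp only [cut_cons, h3, h4, if_true, if_false, iff_true, iff_false, not_true, add_zero] at hex ⊢
      · exact hex.isLarge (by omega)
      · exact hex.isLarge_sub (by simpa using hx) (by omega)
      · exact hex.isLarge_sub (by simpa using hx) (by omega)
      · exact hex.isLarge (by omega)

/-- Moving one of the previously oriented edges at `v` into the boundary. -/
theorem mem_of_delete_oriented (h : IsReduced U M b c w) (ih : SolvableBelow V (size U M w))
    {v : V} (hv : v ∈ U) {n : ℕ} (hn : w v = n + 1) {x : ZMod 3} (hx : x ≠ 0)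
    (hsign : IsSignSum n (c v - x - b v)) (hlarge : IsLarge (cut M {v} + n) (c v - x)) :
    b ∈ boundaries M := by
  have hsw : ∀ A : Finset V, ∑ u ∈ A, w u =
      ∑ u ∈ A, Function.update w v n u + if v ∈ A then 1 else 0 := by
    intro A
    split_ifs with hvA
    · rw [Finset.sum_update_of_mem hvA, ← Finset.add_sum_erase _ _ hvA, hn,
        Finset.erase_eq]
      omega
    · rw [Finset.sum_update_of_notMem hvA, add_zero]
  have hsc : ∀ A : Finset V, ∑ u ∈ A, (c - Pi.single v x : V → ZMod 3) u =
      ∑ u ∈ A, c u - if v ∈ A then x else 0 := by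
    intro A
    simp [Finset.sum_sub_distrib, Pi.single_apply]
  have hU := hsw U
  rw [if_pos hv] at hU
  refine ih U M b (c - Pi.single v x : V → ZMod 3) (Function.update w v n) ?_
    ⟨h.two_le, h.mem, h.supp, h.sum_eq, ?_, ?_, ?_⟩
  · simp only [size]
    omega
  · intro u hu
    by_cases huv : u = v
    · subst huv
      simpa using hsign
    · simpa [huv] using h.sign u hu
  · have := h.small
    rw [hU] at this
    rw [hsc, if_pos hv]
    unfold IsSmall at *
    grind
  · intro A hA hne hAU
    rcases Nat.lt_or_ge A.card 2 with hA1 | hA2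
    · obtain ⟨u, rfl⟩ := Finset.card_eq_one.1 (by have := hne.card_pos; omega : A.card = 1)
      have huU : u ∈ U := by simpa using hA
      by_cases huv : u = v
      · subst huv
        simpa using hlarge
      · simpa [huv, Ne.symm huv] using h.large_singleton huU
    · have hex := h.excessive A hA hA2 hAU
      rw [hsw] at hex
      rw [hsc]
      split_ifs at hex ⊢ with hvA
      · exact hex.isLarge_sub hx (by omega)
      · exact hex.isLarge (by omega)

theorem exists_crossing (h : IsReduced U M b c w) {A : Finset V} (hA : A ⊆ U) (hne : A.Nonempty)
    (hAU : A ≠ U) : ∃ e ∈ M, ¬ (e.1 ∈ A ↔ e.2 ∈ A) := by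
  by_contra! hcon
  have h1 := h.large A hA hne hAU
  have h2 := h.large (U \ A) Finset.sdiff_subset
    (Finset.sdiff_nonempty.2 fun hUA => hAU (hA.antisymm hUA))
    (by
      intro heq
      obtain ⟨a, ha⟩ := hne
      have := hA ha
      rw [← heq] at this
      exact (Finset.mem_sdiff.1 this).2 ha)
  rw [cut_eq_zero hcon] at h1
  rw [cut_eq_zero fun e he => by
    have h3 := h.mem e he
    have h4 := hcon e he
    simp [h3, h4]] at h2
  have h3 := h.small
  rw [← Finset.sum_sdiff hA, ← Finset.sum_sdiff hA] at h3
  unfold IsLarge IsSmall at *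
  grind

theorem mem_of_forall_ne (h : IsReduced U M b c w) (ih : SolvableBelow V (size U M w))
    (hz : ∀ v ∈ U, ¬ (cut M {v} + w v = 4 ∧ c v = 0)) : b ∈ boundaries M := by
  by_contra hb
  set can : V → ZMod 3 → Prop := fun v x => IsLarge (cut M {v} + w v - 1) (c v - x) with hcan
  have hedge : ∀ e ∈ M, ∀ x ≠ 0, ¬ (can e.1 x ∧ can e.2 (-x)) := by
    rintro e he x hx ⟨h1, h2⟩
    obtain ⟨M', rfl⟩ := Multiset.exists_cons_of_mem he
    have hloop := h.loopless e he
    refine hb (h.mem_of_delete_edge ih hx (fun _ => le_rfl) (fun _ _ _ _ => rfl) (by omega)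
      h.sign h.small ?_ ?_)
    · convert h1 using 1
      simp [cut_cons, hloop.symm]
    · convert h2 using 1
      · simp [cut_cons, hloop]
      · ring
  have hor : ∀ v ∈ U, ∀ x ≠ 0, can v x ∨ can v (-x) := by
    intro v hv x hx
    exact (h.large_singleton hv).or_neg (hz v hv) hx
  have hall : ∀ x ≠ 0, (∀ v ∈ U, can v x) ∨ ∀ v ∈ U, ¬ can v x := by
    classical
    intro x hx
    by_contra! hcon
    obtain ⟨⟨u, hu, hu'⟩, v, hv, hv'⟩ := hcon
    obtain ⟨e, he, hcross⟩ := h.exists_crossing (A := U.filter fun v => can v x)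
      (Finset.filter_subset _ _) ⟨v, by simp [hv, hv']⟩ (by
        intro heq
        rw [← heq, Finset.mem_filter] at hu
        exact hu' hu.2)
    have heU := h.mem e he
    simp only [Finset.mem_filter, heU, true_and] at hcross
    have h1 := hor _ heU.1 x hx
    have h2 := hor _ heU.2 x hx
    have h3 := hedge e he x hx
    have h4 := hedge e he (-x) (by simpa using hx)
    rw [neg_neg] at h4
    tauto
  obtain ⟨ε, hε, hpos, hneg⟩ : ∃ ε : ZMod 3, ε ≠ 0 ∧ (∀ v ∈ U, can v ε) ∧ ∀ v ∈ U, ¬ can v (-ε) := by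
    obtain ⟨u, hu⟩ : U.Nonempty := Finset.card_pos.1 (by have := h.two_le; omega)
    obtain ⟨e, he, -⟩ := h.exists_crossing (A := {u}) (by simpa using hu) (by simp)
      (h.singleton_ne u)
    have heU := h.mem e he
    rcases hall 1 (by decide) with h1 | h1
    · rcases hall (-1) (by decide) with h2 | h2
      · exact absurd ⟨h1 _ heU.1, h2 _ heU.2⟩ (hedge e he 1 (by decide))
      · exact ⟨1, by decide, h1, h2⟩
    · refine ⟨-1, by decide, fun v hv => ?_, by simpa using h1⟩
      exact (hor v hv 1 (by decide)).resolve_left (h1 v hv)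
  have hform : ∀ v ∈ U, (cut M {v} + w v = 5 ∧ c v = ε) ∨ (cut M {v} + w v = 6 ∧ c v = -ε) := by
    intro v hv
    exact (hpos v hv).eq_of_not_neg (hneg v hv) hε
  have hout : ∀ v ∈ U, c v - b v = -ε * w v := by
    intro v hv
    have h1 := h.sign v hv
    rcases hn : w v with _ | n
    · rw [hn] at h1
      simpa using h1.eq_zero
    · have h2 : ¬ IsSignSum n (c v - ε - b v) := by
        intro hs
        refine hb (h.mem_of_delete_oriented ih hv hn hε hs ?_)
        convert hpos v hv using 1
        omega
      rw [hn] at h1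
      rw [sub_right_comm] at h2
      exact h1.eq_of_not_sub h2 hε
  have hC : ∑ v ∈ U, c v = -ε * (∑ v ∈ U, w v : ℕ) := by
    have h1 : ∑ v ∈ U, (c v - b v) = ∑ v ∈ U, c v := by
      rw [Finset.sum_sub_distrib, h.sum_eq, sub_zero]
    rw [← h1, Finset.sum_congr rfl hout, ← Finset.mul_sum, Nat.cast_sum]
  obtain ⟨v, hv, j, hj1, hj3, hsign, hsmall⟩ : ∃ v ∈ U, ∃ j, 1 ≤ j ∧ j ≤ 3 ∧
      IsSignSum (w v + j) (c v - b v) ∧ IsSmall (∑ u ∈ U, w u + j) (∑ u ∈ U, c u) := by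
    have hs := h.small
    rw [hC] at hs ⊢
    by_cases hex : ∃ v ∈ U, 1 ≤ w v
    · obtain ⟨v, hv, hwv⟩ := hex
      refine ⟨v, hv, 1, le_rfl, by omega, Or.inl (by omega), ?_⟩
      exact hs.add_one hε
    · push Not at hex
      obtain ⟨u, hu⟩ : U.Nonempty := Finset.card_pos.1 (by have := h.two_le; omega)
      refine ⟨u, hu, 3, by omega, le_rfl, Or.inl (by omega), Or.inl ?_⟩
      rw [Finset.sum_eq_zero fun v hv => by have := hex v hv; omega]
      omega
  obtain ⟨e, he, hcross⟩ := h.exists_crossing (A := {v}) (by simpa using hv) (by simp)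
    (h.singleton_ne v)
  have hloop := h.loopless e he
  have heU := h.mem e he
  obtain ⟨M', rfl⟩ := Multiset.exists_cons_of_mem he
  have hsw : ∑ u ∈ U, (w + Pi.single v j : V → ℕ) u = ∑ u ∈ U, w u + j := by
    simp [Finset.sum_add_distrib, hv]
  have hv' : v = e.1 ∨ v = e.2 := by
    simp only [Finset.mem_singleton] at hcross
    grind
  obtain ⟨x, hx, hlarge⟩ : ∃ x : ZMod 3, x ≠ 0 ∧
      IsLarge (cut M' {e.1} + (w + Pi.single v j : V → ℕ) e.1) (c e.1 - x) ∧
      IsLarge (cut M' {e.2} + (w + Pi.single v j : V → ℕ) e.2) (c e.2 + x) := by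
    have hlv : IsLarge (cut M' {v} + (w + Pi.single v j : V → ℕ) v) (c v + ε) := by
      have h1 := hform v hv
      rw [cut_cons, if_neg hcross] at h1
      simp only [Pi.add_apply, Pi.single_eq_same]
      exact isLarge_add_of_eq h1 hε (by omega)
    have hlu : ∀ u ∈ U, u ≠ v → (u = e.1 ∨ u = e.2) →
        IsLarge (cut M' {u} + (w + Pi.single v j : V → ℕ) u) (c u - ε) := by
      intro u hu huv hue
      convert hpos u hu using 1
      rcases hue with rfl | rfl
      · simp [cut_cons, hloop.symm, huv]
      · simp [cut_cons, hloop, huv]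
    rcases hv' with rfl | rfl
    · refine ⟨-ε, by simpa using hε, by simpa using hlv, ?_⟩
      simpa [sub_eq_add_neg] using hlu e.2 heU.2 hloop.symm (Or.inr rfl)
    · exact ⟨ε, hε, hlu e.1 heU.1 hloop (Or.inl rfl), hlv⟩
  refine hb (h.mem_of_delete_edge ih hx (w' := (w + Pi.single v j : V → ℕ)) (fun _ => by simp) ?_ ?_ ?_ ?_
    hlarge.1 hlarge.2)
  · intro u _ h1 h2
    have : u ≠ v := by rcases hv' with rfl | rfl <;> assumption
    simp [this]
  · rw [hsw]
    omega
  · intro u hu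
    by_cases huv : u = v
    · subst huv
      simpa using hsign
    · simpa [huv] using h.sign u hu
  · rwa [hsw]

end IsReduced

/-- The edges joining `v` to the members of `Y`. -/
def star (v : V) (Y : Multiset V) : Multiset (V × V) := Y.map fun y => (v, y)

omit [DecidableEq V] in
theorem star_add (v : V) (Y Z : Multiset V) : star v (Y + Z) = star v Y + star v Z := by
  simp [star]

omit [DecidableEq V] in
theorem star_cons (v y : V) (Y : Multiset V) : star v (y ::ₘ Y) = (v, y) ::ₘ star v Y := by
  simp [star]

theorem cut_star_of_notMem {v : V} {A : Finset V} (hv : v ∉ A) (Y : Multiset V) :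
    cut (star v Y) A = Y.countP (· ∈ A) := by
  rw [cut, star, Multiset.countP_map, Multiset.countP_eq_card_filter]
  simp [hv]

theorem cut_star_of_mem {v : V} {A : Finset V} (hv : v ∈ A) (Y : Multiset V) :
    cut (star v Y) A = Y.countP (· ∉ A) := by
  rw [cut, star, Multiset.countP_map, Multiset.countP_eq_card_filter]
  simp [hv]

theorem boundaries_lift_star (v : V) (P N : Multiset (V × V)) :
    boundaries (P + N) ⊆ boundaries (star v (P.map Prod.fst + P.map Prod.snd) + N) := by
  induction P using Multiset.induction_on with
  | empty => simp [star]
  | cons p P ih =>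
    have h : star v ((p ::ₘ P).map Prod.fst + (p ::ₘ P).map Prod.snd) + N =
        (v, p.1) ::ₘ (v, p.2) ::ₘ (star v (P.map Prod.fst + P.map Prod.snd) + N) := by
      simp [star, Multiset.cons_swap]
    rw [h, Multiset.cons_add]
    exact (boundaries_lift p.1 v p.2 _).trans
      (boundaries_cons_mono (boundaries_cons_mono ih _) _)

/-- The edges at `v` can be directed away from `v`. -/
theorem exists_star (v : V) {M : Multiset (V × V)} (hM : ∀ e ∈ M, e.1 ≠ e.2) :
    ∃ (Y : Multiset V) (N : Multiset (V × V)), boundaries (star v Y + N) ⊆ boundaries M ∧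
      (∀ (p : V × V → Prop) [DecidablePred p], (∀ e, p e ↔ p e.swap) →
        (star v Y + N).countP p = M.countP p) ∧ v ∉ Y ∧ ∀ e ∈ N, e.1 ≠ v ∧ e.2 ≠ v := by
  induction M using Multiset.induction_on with
  | empty => exact ⟨0, 0, by simp [star], by simp [star], by simp, by simp⟩
  | cons e M ih =>
    obtain ⟨Y, N, h1, h2, h3, h4⟩ := ih fun e he => hM e (by simp [he])
    have he := hM e (by simp)
    by_cases hv1 : e.1 = v
    · refine ⟨e.2 ::ₘ Y, N, ?_, ?_, ?_, h4⟩
      · rw [star_cons, Multiset.cons_add, ← hv1]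
        rw [← hv1] at h1
        exact boundaries_cons_mono h1 _
      · intro p _ hp
        rw [star_cons, Multiset.cons_add, Multiset.countP_cons, Multiset.countP_cons, h2 p hp, ← hv1]
      · simp only [Multiset.mem_cons, not_or]
        exact ⟨fun h => he (hv1.trans h), h3⟩
    by_cases hv2 : e.2 = v
    · refine ⟨e.1 ::ₘ Y, N, ?_, ?_, ?_, h4⟩
      · rw [star_cons, Multiset.cons_add, ← hv2]
        rw [← hv2] at h1
        exact (boundaries_swap _ _ _).trans (boundaries_cons_mono h1 _)
      · intro p _ hp
        rw [star_cons, Multiset.cons_add, Multiset.countP_cons, Multiset.countP_cons, h2 p hp, ← hv2,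
          if_congr (hp e) rfl rfl]
        rfl
      · simp only [Multiset.mem_cons, not_or]
        exact ⟨fun h => hv1 h.symm, h3⟩
    · refine ⟨Y, e ::ₘ N, ?_, ?_, h3, ?_⟩
      · rw [Multiset.add_cons]
        exact boundaries_cons_mono h1 _
      · intro p _ hp
        rw [Multiset.add_cons, Multiset.countP_cons, Multiset.countP_cons, h2 p hp]
      · intro f hf
        rcases Multiset.mem_cons.1 hf with rfl | hf
        · exact ⟨hv1, hv2⟩
        · exact h4 f hf

theorem cut_eq_of_countP {M N : Multiset (V × V)}
    (h : ∀ (p : V × V → Prop) [DecidablePred p], (∀ e, p e ↔ p e.swap) → N.countP p = M.countP p)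
    (A : Finset V) : cut N A = cut M A :=
  h _ fun e => by simp [iff_comm]

omit [DecidableEq V] in
theorem card_eq_of_countP {M N : Multiset (V × V)}
    (h : ∀ (p : V × V → Prop) [DecidablePred p], (∀ e, p e ↔ p e.swap) → N.countP p = M.countP p) :
    N.card = M.card := by
  simpa using h (fun _ => True) fun _ => Iff.rfl

omit [DecidableEq V] in
theorem forall_mem_of_countP {M N : Multiset (V × V)}
    (h : ∀ (p : V × V → Prop) [DecidablePred p], (∀ e, p e ↔ p e.swap) → N.countP p = M.countP p)
    {p : V × V → Prop} (hp : ∀ e, p e ↔ p e.swap) (hM : ∀ e ∈ M, p e) : ∀ e ∈ N, p e := by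
  classical
  have h1 := h (fun e => ¬ p e) fun e => not_congr (hp e)
  rw [Multiset.countP_eq_zero.2 fun e he => not_not.2 (hM e he), Multiset.countP_eq_zero] at h1
  exact fun e he => not_not.1 (h1 e he)

/-- At most four members can be paired off so that equal members are paired only if this
cannot be avoided. -/
theorem exists_pairing {Y : Multiset V} {n : ℕ} (hn : n ≤ 2) (hY : Y.card + n = 4) :
    ∃ (P : Multiset (V × V)) (Z : Multiset V), Y = P.map Prod.fst + P.map Prod.snd + Z ∧
      Z.card = n ∧ ∀ p ∈ P, p.1 = p.2 → 3 ≤ Y.count p.1 := by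
  have h : n = 2 ∨ n = 1 ∨ n = 0 := by omega
  rcases h with rfl | rfl | rfl
  · exact ⟨0, Y, by simp, by omega, by simp⟩
  · obtain ⟨a, b, c, rfl⟩ := Multiset.card_eq_three.1 (by omega : Y.card = 3)
    by_cases hab : a = b
    · subst hab
      refine ⟨{(a, c)}, {a}, ?_, by simp, ?_⟩
      · simp only [Multiset.map_singleton, Multiset.insert_eq_cons, ← Multiset.singleton_add]
        abel
      · simp only [Multiset.mem_singleton, forall_eq]
        rintro rfl
        simp
    · exact ⟨{(a, b)}, {c}, by simp [Multiset.insert_eq_cons, ← Multiset.singleton_add, add_assoc],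
        by simp, by simp [hab]⟩
  · obtain ⟨a, Y, rfl⟩ := Multiset.exists_mem_of_ne_zero
      (by rintro rfl; simp at hY : Y ≠ 0) |>.imp fun a ha => Multiset.exists_cons_of_mem ha
    obtain ⟨b, c, d, rfl⟩ := Multiset.card_eq_three.1 (by simpa using hY : Y.card = 3)
    by_cases h : (a = c ∨ b = d) ∧ (a = b ∨ c = d) ∨ a ≠ b ∧ c ≠ d
    · refine ⟨{(a, b), (c, d)}, 0, ?_, by simp, ?_⟩
      · simp only [Multiset.insert_eq_cons, ← Multiset.singleton_add, Multiset.map_add,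
          Multiset.map_singleton, add_zero]
        abel
      · simp only [Multiset.insert_eq_cons, Multiset.mem_cons, Multiset.mem_singleton]
        rintro p (rfl | rfl) hp <;> simp only [Multiset.count_cons, Multiset.count_singleton] <;> grind
    · refine ⟨{(a, c), (b, d)}, 0, ?_, by simp, ?_⟩
      · simp only [Multiset.insert_eq_cons, ← Multiset.singleton_add, Multiset.map_add,
          Multiset.map_singleton, add_zero]
        abel
      · simp only [Multiset.insert_eq_cons, Multiset.mem_cons, Multiset.mem_singleton]
        rintro p (rfl | rfl) hp <;> simp only [Multiset.count_cons, Multiset.count_singleton] <;> grind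

theorem IsSignSum.neg {n : ℕ} {x : ZMod 3} (h : IsSignSum n x) : IsSignSum n (-x) := by
  simpa [IsSignSum] using h

theorem card_map_fst_countP (P : Multiset (V × V)) (A : Finset V) :
    (P.map Prod.fst).countP (· ∈ A) + (P.map Prod.snd).countP (· ∈ A) =
      cut P A + 2 * P.countP fun p => p.1 ∈ A ∧ p.2 ∈ A := by
  induction P using Multiset.induction_on with
  | empty => simp
  | cons p P ih =>
    simp only [Multiset.map_cons, Multiset.countP_cons, cut_cons]
    by_cases h1 : p.1 ∈ A <;> by_cases h2 : p.2 ∈ A <;> simp [h1, h2] <;> omega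

theorem sum_count_eq_countP (Z : Multiset V) (A : Finset V) :
    ∑ u ∈ A, Z.count u = Z.countP (· ∈ A) := by
  induction Z using Multiset.induction_on with
  | empty => simp
  | cons z Z ih => simp [Multiset.count_cons, Multiset.countP_cons, Finset.sum_add_distrib, ih]

theorem IsLarge.le_two_of_isSmall {d n : ℕ} {c : ZMod 3} (h : IsLarge (4 - n + (d - n)) c)
    (h' : IsSmall d c) (hn : n ≤ d) (hn' : n ≤ 4) : n ≤ 2 := by
  unfold IsLarge IsSmall at *
  by_contra! hn2
  have h4 : 4 - n + (d - n) + 2 ≤ d := by omega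
  rcases h' with h' | ⟨rfl, h'⟩ | ⟨rfl, h'⟩
  · omega
  · rcases h with h | ⟨h, -⟩ | ⟨-, h⟩
    · omega
    · omega
    · exact h' h
  · rcases h with h | ⟨-, h⟩ | ⟨h, -⟩
    · omega
    · exact h h'
    · omega

namespace IsReduced

variable {U : Finset V} {M : Multiset (V × V)} {b c : V → ZMod 3} {w : V → ℕ}

/-- Splitting off a vertex: the edges at `v` ending in `P` are lifted in pairs,
the ones ending in `Z` are oriented. -/
theorem mem_of_split {v : V} {P N : Multiset (V × V)} {Y Z : Multiset V}
    (h : IsReduced U (star v Y + N) b c w) (ih : SolvableBelow V (size U (star v Y + N) w))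
    (hv : v ∈ U) (hc : c v = 0) (hw : Y.card + w v = 4) (hvY : v ∉ Y)
    (hN : ∀ e ∈ N, e.1 ≠ v ∧ e.2 ≠ v) (hY : Y = P.map Prod.fst + P.map Prod.snd + Z)
    (hZ : Z.card = w v) (hP : ∀ p ∈ P, p.1 = p.2 → 3 ≤ Y.count p.1) :
    b ∈ boundaries (star v Y + N) := by
  have hYU : ∀ y ∈ Y, y ∈ U.erase v := fun y hy =>
    Finset.mem_erase.2 ⟨fun h => hvY (h ▸ hy), (h.mem (v, y) (by simp [star, hy])).2⟩
  have hP1 : ∀ p ∈ P, p.1 ∈ Y := fun p hp => by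
    rw [hY]; simp only [Multiset.mem_add]; exact Or.inl (Or.inl (Multiset.mem_map_of_mem _ hp))
  have hP2 : ∀ p ∈ P, p.2 ∈ Y := fun p hp => by
    rw [hY]; simp only [Multiset.mem_add]; exact Or.inl (Or.inr (Multiset.mem_map_of_mem _ hp))
  have hZY : ∀ z ∈ Z, z ∈ Y := fun z hz => by rw [hY]; simp [hz]
  have hYc : Y.card = 2 * P.card + Z.card := by rw [hY]; simp; omega
  obtain ⟨b₁, hb₁, hb₁v⟩ : ∃ b₁ ∈ boundaries (star v Z), ∑ u ∈ {v}, b₁ u = b v := by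
    refine exists_mem_boundaries {v} ?_
    rw [cut_star_of_mem (by simp), Multiset.countP_eq_card.2, hZ]
    · simpa [hc] using (h.sign v hv).neg
    · intro z hz hzv
      rw [Finset.mem_singleton] at hzv
      exact hvY (hzv ▸ hZY z hz)
  rw [Finset.sum_singleton] at hb₁v
  have hcnt : ∀ u ≠ v, cut (star v Z) {u} = Z.count u := fun u hu => by
    rw [cut_star_of_notMem (by simpa using hu.symm)]
    simp [Multiset.count, eq_comm]
  have hsum : ∀ A : Finset V, ∑ u ∈ A, (w u + Z.count u) =
      ∑ u ∈ A, w u + Z.countP (· ∈ A) := fun A => by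
    rw [Finset.sum_add_distrib, sum_count_eq_countP]
  have hwU : ∑ u ∈ U.erase v, (w u + Z.count u) = ∑ u ∈ U, w u := by
    rw [hsum, Multiset.countP_eq_card.2 fun z hz => hYU z (hZY z hz), hZ,
      Finset.sum_erase_add _ _ hv]
  have hcU : ∑ u ∈ U.erase v, c u = ∑ u ∈ U, c u := Finset.sum_erase _ hc
  have key : b - b₁ ∈ boundaries (P + N) := by
    refine ih (U.erase v) (P + N) (b - b₁) c (fun u => w u + Z.count u) ?_ ⟨?_, ?_, ?_, ?_, ?_, ?_, ?_⟩
    · simp only [size, hwU, Multiset.card_add, star, Multiset.card_map]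
      have := Finset.card_erase_lt_of_mem hv
      omega
    · have := h.three_le
      rw [Finset.card_erase_of_mem hv]
      omega
    · intro e he
      rcases Multiset.mem_add.1 he with he | he
      · exact ⟨hYU _ (hP1 e he), hYU _ (hP2 e he)⟩
      · have := h.mem e (by simp [he])
        have := hN e he
        simp_all
    · intro u hu
      by_cases huv : u = v
      · simp [huv, hb₁v]
      · have huU : u ∉ U := fun huU => hu (by simp [huv, huU])
        have : b₁ u = 0 := by
          refine eq_zero_of_cut_eq_zero hb₁ ?_
          rw [hcnt u huv, Multiset.count_eq_zero]
          exact fun huZ => hu (hYU u (hZY u huZ))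
        simp [this, h.supp u huU]
    · rw [Finset.sum_erase _ (by simp [hb₁v])]
      have h1 := isSignSum_cut hb₁ U
      rw [cut_eq_zero] at h1
      · simp [h.sum_eq, h1.eq_zero]
      · intro e he
        obtain ⟨z, hz, rfl⟩ := Multiset.mem_map.1 he
        exact iff_of_true hv (Finset.mem_of_mem_erase (hYU z (hZY z hz)))
    · intro u hu
      have h1 := isSignSum_cut hb₁ {u}
      rw [hcnt u (Finset.ne_of_mem_erase hu), Finset.sum_singleton] at h1
      convert (h.sign u (Finset.mem_of_mem_erase hu)).add h1 using 1
      simp only [Pi.sub_apply]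
      ring
    · rw [hwU, hcU]
      exact h.small
    · intro A hA hne hAU
      have hvA : v ∉ A := fun hvA => by simpa using hA hvA
      have hAU' : A ⊆ U := hA.trans (Finset.erase_subset _ _)
      have hAne : A ≠ U := by rintro rfl; exact hvA hv
      set s := P.countP fun p => p.1 ∈ A ∧ p.2 ∈ A with hs
      have hcard : Y.countP (· ∈ A) = cut P A + 2 * s + Z.countP (· ∈ A) := by
        rw [hs, ← card_map_fst_countP, hY, Multiset.countP_add, Multiset.countP_add]
      have hsP : s ≤ P.card := Multiset.countP_le_card _ _
      have hle : Y.countP (· ∈ A) ≤ Y.card := Multiset.countP_le_card _ _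
      have h1 := h.large A hAU' hne hAne
      have h2 := h.excessive A hAU'
      have h3 := h.large (insert v A) (Finset.insert_subset hv hAU') (by simp) (by
        rintro rfl
        exact hAU (by simp [hvA]))
      have h4 : cut N (insert v A) = cut N A := by
        refine Multiset.countP_congr rfl fun e he => ?_
        simp [hN e he]
      have h5 : Y.card = Y.countP (· ∈ A) + Y.countP (· ∉ insert v A) := by
        rw [Multiset.card_eq_countP_add_countP (· ∈ A)]
        congr 1
        refine Multiset.countP_congr rfl fun y hy => ?_
        have : y ≠ v := by rintro rfl; exact hvY hy
        simp [this]
      rw [cut_add, cut_star_of_mem (by simp), h4, Finset.sum_insert hvA, Finset.sum_insert hvA, hc,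
        zero_add] at h3
      rw [cut_add, cut_star_of_notMem hvA] at h1 h2
      rw [hsum, cut_add]
      have h6 : 4 ≤ Y.countP (· ∈ A) → IsLarge (cut N A + ∑ u ∈ A, w u) (∑ u ∈ A, c u) := by
        intro hn
        convert h3 using 1
        omega
      have hs' : s = 0 ∨ s = 1 ∨ s = 2 := by omega
      rcases hs' with hs0 | hs1 | hs2
      · convert h1 using 1
        omega
      · by_cases hn : 3 ≤ Y.countP (· ∈ A)
        · by_cases hn' : 4 ≤ Y.countP (· ∈ A)
          · convert (h6 hn').add_two using 1
            omega
          · convert h3 using 1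
            omega
        · have hA2 : 2 ≤ A.card := by
            by_contra! hA1
            obtain ⟨u, rfl⟩ := Finset.card_eq_one.1 (by have := hne.card_pos; omega : A.card = 1)
            obtain ⟨p, hp, hpA⟩ := Multiset.countP_pos.1 (by omega : 0 < s)
            simp only [Finset.mem_singleton] at hpA hn
            have h7 := hP p hp (hpA.1.trans hpA.2.symm)
            rw [hpA.1, Multiset.count] at h7
            simp only [eq_comm] at h7 hn
            exact hn h7
          refine IsExcessive.isLarge_of_add_two ?_
          convert h2 hA2 hAne using 1
          omega
      · convert h6 (by omega) using 1
        omega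
  have h1 : b ∈ boundaries (P + (star v Z + N)) := by
    have := add_mem_boundaries key hb₁
    rw [sub_add_cancel] at this
    convert this using 2
    abel
  have h2 := boundaries_lift_star v P _ h1
  rwa [← add_assoc, ← star_add, ← hY] at h2

theorem mem_of_eq_four {v : V} (h : IsReduced U M b c w) (ih : SolvableBelow V (size U M w))
    (hv : v ∈ U) (hc : c v = 0) (hd : cut M {v} + w v = 4) : b ∈ boundaries M := by
  obtain ⟨Y, N, hsub, hcount, hvY, hN⟩ := exists_star v h.loopless
  refine hsub ?_
  have hcut := cut_eq_of_countP hcount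
  have h' : IsReduced U (star v Y + N) b c w :=
    { h with
      mem := forall_mem_of_countP hcount (p := fun e => e.1 ∈ U ∧ e.2 ∈ U)
        (fun e => by simp [and_comm]) h.mem
      large := by simpa only [hcut] using h.large
      loopless := forall_mem_of_countP hcount (p := fun e => e.1 ≠ e.2)
        (fun e => by simp [eq_comm]) h.loopless
      excessive := by simpa only [hcut] using h.excessive }
  have hN0 : ∀ A, v ∉ A → cut N (insert v A) = cut N A := fun A hvA => by
    refine Multiset.countP_congr rfl fun e he => ?_
    simp [hN e he]
  have hYc : Y.card + w v = 4 := by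
    rw [← hd, ← hcut, cut_add, cut_star_of_mem (by simp), cut_eq_zero, Multiset.countP_eq_card.2]
    · simp
    · intro y hy hyv
      rw [Finset.mem_singleton] at hyv
      exact hvY (hyv ▸ hy)
    · intro e he
      simp [hN e he]
  have hw2 : w v ≤ 2 := by
    have h1 := h'.large (U.erase v) (Finset.erase_subset _ _)
      (Finset.card_pos.1 (by rw [Finset.card_erase_of_mem hv]; have := h.three_le; omega))
      (by simpa using hv)
    have h2 : cut N (U.erase v) = 0 := cut_eq_zero fun e he => by
      have := h'.mem e (by simp [he])
      simp [hN e he, this]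
    have h3 : Y.countP (· ∈ U.erase v) = Y.card := Multiset.countP_eq_card.2 fun y hy => by
      have := h'.mem (v, y) (by simp [star, hy])
      refine Finset.mem_erase.2 ⟨?_, this.2⟩
      rintro rfl
      exact hvY hy
    have h4 := Finset.sum_erase_add U w hv
    rw [cut_add, cut_star_of_notMem (by simp), h2, h3, Finset.sum_erase _ hc] at h1
    refine IsLarge.le_two_of_isSmall (d := ∑ u ∈ U, w u) (n := w v) ?_ h.small (by omega) (by omega)
    convert h1 using 1
    omega
  obtain ⟨P, Z, hY, hZ, hP⟩ := exists_pairing hw2 hYc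
  refine h'.mem_of_split ?_ hv hc hYc hvY hN hY hZ hP
  rwa [size, card_eq_of_countP hcount]

end IsReduced

/-- Admissible data are solvable. -/
theorem IsAdmissible.mem_boundaries [Fintype V] {U : Finset V} {M : Multiset (V × V)}
    {b c : V → ZMod 3} {w : V → ℕ} (h : IsAdmissible U M b c w) : b ∈ boundaries M := by
  obtain ⟨n, hn⟩ : ∃ n, size U M w = n := ⟨_, rfl⟩
  induction n using Nat.strong_induction_on generalizing U M b c w with
  | _ n ihn =>
  have ih : SolvableBelow V (size U M w) := fun U' M' b' c' w' hlt h' =>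
    ihn _ (hn ▸ hlt) h' rfl
  by_cases hloop : ∃ e ∈ M, e.1 = e.2
  · obtain ⟨e, he, hee⟩ := hloop
    obtain ⟨M', rfl⟩ := Multiset.exists_cons_of_mem he
    exact h.mem_of_loop hee ih
  by_cases hU : U.card = 2
  · exact h.mem_of_card_eq_two hU
  by_cases hex : ∀ A ⊆ U, 2 ≤ A.card → A ≠ U →
      IsExcessive (cut M A + ∑ v ∈ A, w v) (∑ v ∈ A, c v)
  · have h' : IsReduced U M b c w :=
      { h with
        three_le := by have := h.two_le; omega
        loopless := fun e he hee => hloop ⟨e, he, hee⟩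
        excessive := hex }
    by_cases hz : ∃ v ∈ U, cut M {v} + w v = 4 ∧ c v = 0
    · obtain ⟨v, hv, hd, hc⟩ := hz
      exact h'.mem_of_eq_four ih hv hc hd
    · exact h'.mem_of_forall_ne ih fun v hv hvz => hz ⟨v, hv, hvz⟩
  · push Not at hex
    obtain ⟨A, hA, hA2, hAU, hA'⟩ := hex
    exact h.mem_of_not_isExcessive ih hA hA2 hAU hA'

/-- The number of edges of `M` with both ends in `A`. -/
def inside (M : Multiset (V × V)) (A : Finset V) : ℕ := M.countP fun e => e.1 ∈ A ∧ e.2 ∈ A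

theorem inside_add (M N : Multiset (V × V)) (A : Finset V) :
    inside (M + N) A = inside M A + inside N A := by
  simp [inside]

theorem inside_cons (e : V × V) (M : Multiset (V × V)) (A : Finset V) :
    inside (e ::ₘ M) A = inside M A + if e.1 ∈ A ∧ e.2 ∈ A then 1 else 0 := by
  simp [inside, Multiset.countP_cons]

theorem inside_mono (M : Multiset (V × V)) {A B : Finset V} (h : A ⊆ B) :
    inside M A ≤ inside M B := by
  induction M using Multiset.induction_on with
  | empty => simp [inside]
  | cons e M ih =>
    rw [inside_cons, inside_cons]
    split_ifs with h1 h2 <;> first | omega | exact absurd ⟨h h1.1, h h1.2⟩ h2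

theorem inside_eq_card {M : Multiset (V × V)} {A : Finset V}
    (h : ∀ e ∈ M, e.1 ∈ A ∧ e.2 ∈ A) : inside M A = M.card :=
  Multiset.countP_eq_card.2 h

theorem inside_add_cut {M : Multiset (V × V)} {A U : Finset V}
    (hM : ∀ e ∈ M, e.1 ∈ U ∧ e.2 ∈ U) :
    inside M A + inside M (U \ A) + cut M A = M.card := by
  induction M using Multiset.induction_on with
  | empty => simp [inside]
  | cons e M ih =>
    have h1 := ih fun e he => hM e (by simp [he])
    have h2 := hM e (by simp)
    simp only [inside_cons, cut_cons, Finset.mem_sdiff, h2, true_and, Multiset.card_cons]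
    by_cases h3 : e.1 ∈ A <;> by_cases h4 : e.2 ∈ A <;> simp [h3, h4] <;> omega

theorem inside_star_of_notMem {v : V} {A : Finset V} (hv : v ∉ A) (Y : Multiset V) :
    inside (star v Y) A = 0 := by
  rw [inside, Multiset.countP_eq_zero]
  intro e he
  obtain ⟨y, -, rfl⟩ := Multiset.mem_map.1 he
  simp [hv]

theorem inside_star_of_mem {v : V} {A : Finset V} (hv : v ∈ A) (Y : Multiset V) :
    inside (star v Y) A = Y.countP (· ∈ A) := by
  rw [inside, star, Multiset.countP_map, Multiset.countP_eq_card_filter]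
  simp [hv]

/-- A multigraph on `U` with as many edges as four spanning trees, in which no set of vertices
spans more edges than four forests do. -/
structure IsSparse (U : Finset V) (M : Multiset (V × V)) : Prop where
  mem : ∀ e ∈ M, e.1 ∈ U ∧ e.2 ∈ U
  card_add : M.card + 4 = 4 * U.card
  inside_le : ∀ A ⊆ U, A.Nonempty → inside M A + 4 ≤ 4 * A.card

namespace IsSparse

variable {U : Finset V} {M : Multiset (V × V)} {b : V → ZMod 3}

theorem loopless (h : IsSparse U M) : ∀ e ∈ M, e.1 ≠ e.2 := by
  intro e he hee
  have h1 := h.inside_le {e.1} (by simpa using (h.mem e he).1) (by simp)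
  have h2 : 0 < inside M {e.1} := Multiset.countP_pos.2 ⟨e, he, by simp [hee]⟩
  simp at h1
  omega

theorem cut_add_inside (h : IsSparse U M) {A : Finset V} (hA : A ⊆ U) :
    inside M A + inside M (U \ A) + cut M A + 4 = 4 * A.card + 4 * (U \ A).card := by
  rw [inside_add_cut h.mem, h.card_add, ← Finset.card_sdiff_add_card_eq_card hA]
  ring

/-- The case of a tight set `A`, which can be contracted. -/
theorem mem_of_tight [Fintype V] (h : IsSparse U M)
    (ih : ∀ (U' : Finset V) (M' : Multiset (V × V)) (b' : V → ZMod 3), U'.card < U.card →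
      IsSparse U' M' → (∀ v ∉ U', b' v = 0) → ∑ v ∈ U', b' v = 0 → b' ∈ boundaries M')
    (hb : ∀ v ∉ U, b v = 0) (hb' : ∑ v ∈ U, b v = 0) {A : Finset V} (hA : A ⊆ U)
    (hA2 : 2 ≤ A.card) (hAU : A ≠ U) (ht : inside M A + 4 = 4 * A.card) : b ∈ boundaries M := by
  obtain ⟨a, ha⟩ : A.Nonempty := Finset.card_pos.1 (by omega)
  have hlt : A.card < U.card := Finset.card_lt_card (hA.ssubset_of_ne hAU)
  set f := contract A a with hf
  set U' := insert a (U \ A) with hU'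
  have hfU : ∀ u, f u ∈ U' ↔ u ∈ U := contract_mem_iff hA ha
  have hpre : (Finset.univ.filter fun u => f u ∈ U') = U := by ext u; simp [hfU]
  have hcard : U'.card = U.card - A.card + 1 := by
    rw [hU', Finset.card_insert_of_notMem (by simp [ha]), Finset.card_sdiff_of_subset hA]
  set N := M.filter fun e => e.1 ∈ A ∧ e.2 ∈ A with hN
  set N' := M.filter fun e => ¬ (e.1 ∈ A ∧ e.2 ∈ A) with hN'
  have hM : N + N' = M := Multiset.filter_add_not _ _
  have hNA : N.card = inside M A := (Multiset.countP_eq_card_filter _ _).symm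
  have hNA' : inside N A = inside M A := by
    rw [inside_eq_card, hNA]
    exact fun e he => (Multiset.mem_filter.1 he).2
  have hMc : M.card = N.card + N'.card := by rw [← hM, Multiset.card_add]
  have hins : ∀ X, inside M X = inside N X + inside N' X := fun X => by rw [← hM, inside_add]
  have hcon := h.card_add
  have hcontr : push f b ∈ boundaries (N'.map (Prod.map f f)) := by
    refine ih U' _ _ (by omega) ⟨?_, ?_, ?_⟩ ?_ ?_
    · intro e he
      obtain ⟨e', he', rfl⟩ := Multiset.mem_map.1 he
      simpa [hfU] using h.mem e' (Multiset.mem_filter.1 he').1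
    · rw [Multiset.card_map]
      omega
    · intro Y hY hne
      have hmap : inside (N'.map (Prod.map f f)) Y =
          N'.countP fun e => f e.1 ∈ Y ∧ f e.2 ∈ Y := by
        rw [inside, Multiset.countP_map, Multiset.countP_eq_card_filter]
        rfl
      rw [hmap]
      by_cases haY : a ∈ Y
      · have hmem : ∀ u, f u ∈ Y ↔ u ∈ A ∪ Y.erase a := by
          intro u
          by_cases hu : u ∈ A
          · simp [hf, contract_of_mem hu, hu, haY]
          · have : u ≠ a := by rintro rfl; exact hu ha
            simp [hf, contract_of_notMem hu, hu, this]
        have h1 := h.inside_le (A ∪ Y.erase a)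
          (Finset.union_subset hA fun u hu => by
            have h1 := Finset.mem_of_mem_erase hu
            have h2 := hY h1
            rw [hU', Finset.mem_insert] at h2
            exact (Finset.mem_sdiff.1 (h2.resolve_left (Finset.ne_of_mem_erase hu))).1)
          ⟨a, by simp [ha]⟩
        have h2 := inside_mono N (Finset.subset_union_left (s₁ := A) (s₂ := Y.erase a))
        have h3 := Finset.card_union_le A (Y.erase a)
        rw [Finset.card_erase_of_mem haY] at h3
        have h4 := Finset.card_pos.2 hne
        have h5 := hins (A ∪ Y.erase a)
        have h6 : (N'.countP fun e => f e.1 ∈ Y ∧ f e.2 ∈ Y) = inside N' (A ∪ Y.erase a) :=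
          Multiset.countP_congr rfl fun e _ => by simp only [hmem]
        omega
      · have hYA : ∀ u ∈ Y, u ∈ U ∧ u ∉ A := by
          intro u hu
          have h2 := hY hu
          rw [hU', Finset.mem_insert] at h2
          exact Finset.mem_sdiff.1 (h2.resolve_left (by rintro rfl; exact haY hu))
        have hmem : ∀ u, f u ∈ Y ↔ u ∈ Y := by
          intro u
          by_cases hu : u ∈ A
          · simp only [hf, contract_of_mem hu, haY, false_iff]
            exact fun huY => (hYA u huY).2 hu
          · simp [hf, contract_of_notMem hu]
        have h1 := h.inside_le Y (fun u hu => (hYA u hu).1) hne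
        have h5 := hins Y
        have h6 : (N'.countP fun e => f e.1 ∈ Y ∧ f e.2 ∈ Y) = inside N' Y :=
          Multiset.countP_congr rfl fun e _ => by simp only [hmem]
        omega
    · intro v hv
      refine Finset.sum_eq_zero fun u hu => hb u fun huU => hv ?_
      rw [← (Finset.mem_filter.1 hu).2]
      exact (hfU u).2 huU
    · rw [sum_push, hpre, hb']
  obtain ⟨b₁, hb₁, hpush⟩ := exists_push_eq f hcontr
  have hinner : b - b₁ ∈ boundaries N := by
    refine ih A N _ hlt ⟨fun e he => (Multiset.mem_filter.1 he).2, by omega, ?_⟩ ?_ ?_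
    · intro Y hY hne
      have h1 := h.inside_le Y (hY.trans hA) hne
      have h2 := hins Y
      omega
    · intro v hv
      have h1 := congrFun hpush v
      rw [push_contract_of_notMem ha _ hv, push_contract_of_notMem ha _ hv] at h1
      simp [h1]
    · have h1 := congrFun hpush a
      rw [push_contract_self ha, push_contract_self ha] at h1
      simp [h1]
  have := add_mem_boundaries hinner hb₁
  rwa [sub_add_cancel, hM] at this

/-- Splitting off a vertex: the edges at `v` ending in `P` are lifted in pairs,
the ones ending in `Z` are oriented. -/
theorem mem_of_split {v : V} {P N : Multiset (V × V)} {Y Z : Multiset V}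
    (h : IsSparse U (star v Y + N))
    (ih : ∀ (U' : Finset V) (M' : Multiset (V × V)) (b' : V → ZMod 3), U'.card < U.card →
      IsSparse U' M' → (∀ v ∉ U', b' v = 0) → ∑ v ∈ U', b' v = 0 → b' ∈ boundaries M')
    (hb : ∀ v ∉ U, b v = 0) (hb' : ∑ v ∈ U, b v = 0) (hv : v ∈ U) (hvY : v ∉ Y)
    (ht : ∀ A ⊆ U, 2 ≤ A.card → A ≠ U → inside (star v Y + N) A + 4 ≠ 4 * A.card)
    (hN : ∀ e ∈ N, e.1 ≠ v ∧ e.2 ≠ v) (hY : Y = P.map Prod.fst + P.map Prod.snd + Z)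
    (hZ : 2 ≤ Z.card) (hYc : Y.card = P.card + 4) (hP1 : P.card ≤ 1) (hP : ∀ p ∈ P, p.1 ≠ p.2) :
    b ∈ boundaries (star v Y + N) := by
  have hYU : ∀ y ∈ Y, y ∈ U.erase v := fun y hy =>
    Finset.mem_erase.2 ⟨fun h => hvY (h ▸ hy), (h.mem (v, y) (by simp [star, hy])).2⟩
  have hPY : ∀ p ∈ P, p.1 ∈ Y ∧ p.2 ∈ Y := fun p hp => by
    rw [hY]
    simp only [Multiset.mem_add]
    exact ⟨Or.inl (Or.inl (Multiset.mem_map_of_mem _ hp)),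
      Or.inl (Or.inr (Multiset.mem_map_of_mem _ hp))⟩
  have hZY : ∀ z ∈ Z, z ∈ Y := fun z hz => by rw [hY]; simp [hz]
  have hcutZ : cut (star v Z) {v} = Z.card := by
    rw [cut_star_of_mem (by simp), Multiset.countP_eq_card]
    intro z hz hzv
    rw [Finset.mem_singleton] at hzv
    exact hvY (hzv ▸ hZY z hz)
  obtain ⟨b₁, hb₁, hb₁v⟩ : ∃ b₁ ∈ boundaries (star v Z), ∑ u ∈ {v}, b₁ u = b v :=
    exists_mem_boundaries {v} (Or.inl (by omega))
  rw [Finset.sum_singleton] at hb₁v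
  have hcard := h.card_add
  have key : b - b₁ ∈ boundaries (P + N) := by
    refine ih (U.erase v) (P + N) (b - b₁) (Finset.card_erase_lt_of_mem hv) ⟨?_, ?_, ?_⟩ ?_ ?_
    · intro e he
      rcases Multiset.mem_add.1 he with he | he
      · exact ⟨hYU _ (hPY e he).1, hYU _ (hPY e he).2⟩
      · have := h.mem e (by simp [he])
        have := hN e he
        simp_all
    · rw [Finset.card_erase_of_mem hv]
      have := Finset.card_pos.2 ⟨v, hv⟩
      simp only [Multiset.card_add, star, Multiset.card_map] at hcard ⊢
      omega
    · intro A hA hne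
      have hvA : v ∉ A := fun hvA => by simpa using hA hvA
      have hAU : A ⊆ U := hA.trans (Finset.erase_subset _ _)
      have hAne : A ≠ U := by rintro rfl; exact hvA hv
      have h1 := h.inside_le A hAU hne
      have h2 := ht A hAU
      rw [inside_add, inside_star_of_notMem hvA] at h1 h2
      rw [inside_add]
      have h3 : inside P A ≤ P.card := Multiset.countP_le_card _ _
      rcases Nat.eq_zero_or_pos (inside P A) with h4 | h4
      · omega
      · obtain ⟨p, hp, hp1, hp2⟩ := Multiset.countP_pos.1 h4
        have := h2 (Finset.one_lt_card.2 ⟨_, hp1, _, hp2, hP p hp⟩) hAne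
        omega
    · intro u hu
      by_cases huv : u = v
      · simp [huv, hb₁v]
      · have huU : u ∉ U := fun huU => hu (by simp [huv, huU])
        have : b₁ u = 0 := by
          refine eq_zero_of_cut_eq_zero hb₁ ?_
          rw [cut_star_of_notMem (by simpa using Ne.symm huv), Multiset.countP_eq_zero]
          intro z hz hzu
          rw [Finset.mem_singleton] at hzu
          exact hu (hzu ▸ hYU z (hZY z hz))
        simp [this, hb u huU]
    · rw [Finset.sum_erase _ (by simp [hb₁v])]
      have h1 := isSignSum_cut hb₁ U
      rw [cut_eq_zero] at h1
      · simp [hb', h1.eq_zero]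
      · intro e he
        obtain ⟨z, hz, rfl⟩ := Multiset.mem_map.1 he
        exact iff_of_true hv (Finset.mem_of_mem_erase (hYU z (hZY z hz)))
  have h1 : b ∈ boundaries (P + (star v Z + N)) := by
    have := add_mem_boundaries key hb₁
    rw [sub_add_cancel] at this
    convert this using 2
    abel
  have h2 := boundaries_lift_star v P _ h1
  rwa [← add_assoc, ← star_add, ← hY] at h2

theorem mem_of_cut_le_five {v : V} (h : IsSparse U M)
    (ih : ∀ (U' : Finset V) (M' : Multiset (V × V)) (b' : V → ZMod 3), U'.card < U.card →
      IsSparse U' M' → (∀ v ∉ U', b' v = 0) → ∑ v ∈ U', b' v = 0 → b' ∈ boundaries M')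
    (hb : ∀ v ∉ U, b v = 0) (hb' : ∑ v ∈ U, b v = 0) (hv : v ∈ U) (hU : 2 ≤ U.card)
    (ht : ∀ A ⊆ U, 2 ≤ A.card → A ≠ U → inside M A + 4 ≠ 4 * A.card)
    (hd : cut M {v} ≤ 5) : b ∈ boundaries M := by
  obtain ⟨Y, N, hsub, hcount, hvY, hN⟩ := exists_star v h.loopless
  refine hsub ?_
  have hins : ∀ A, inside (star v Y + N) A = inside M A := fun A =>
    hcount _ fun e => by simp [and_comm]
  have h' : IsSparse U (star v Y + N) :=
    { mem := forall_mem_of_countP hcount (p := fun e => e.1 ∈ U ∧ e.2 ∈ U)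
        (fun e => by simp [and_comm]) h.mem
      card_add := by rw [card_eq_of_countP hcount, h.card_add]
      inside_le := by simpa only [hins] using h.inside_le }
  have ht' : ∀ A ⊆ U, 2 ≤ A.card → A ≠ U → inside (star v Y + N) A + 4 ≠ 4 * A.card := by
    simpa only [hins] using ht
  have hYc : Y.card = cut M {v} := by
    rw [← cut_eq_of_countP hcount, cut_add, cut_star_of_mem (by simp), cut_eq_zero,
      Multiset.countP_eq_card.2]
    · simp
    · intro y hy hyv
      rw [Finset.mem_singleton] at hyv
      exact hvY (hyv ▸ hy)
    · intro e he
      simp [hN e he]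
  have h4 : 4 ≤ cut M {v} := by
    have h1 := h.cut_add_inside (A := {v}) (by simpa using hv)
    have h2 : (U \ {v}).card = U.card - 1 := by
      rw [Finset.card_sdiff_of_subset (by simpa using hv), Finset.card_singleton]
    have h3 := h.inside_le (U \ {v}) Finset.sdiff_subset (Finset.card_pos.1 (by omega))
    have h4 := h.inside_le {v} (by simpa using hv) (by simp)
    simp only [Finset.card_singleton] at h1 h4
    omega
  obtain h45 | h45 : Y.card = 4 ∨ Y.card = 5 := by omega
  · exact h'.mem_of_split (P := 0) (Z := Y) ih hb hb' hv hvY ht' hN (by simp) (by omega)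
      (by simpa using h45) (by simp) (by simp)
  obtain ⟨x, hx⟩ : ∃ x, x ∈ Y := Multiset.card_pos_iff_exists_mem.1 (by omega)
  obtain ⟨y, hy, hxy⟩ : ∃ y ∈ Y, x ≠ y := by
    by_contra! hall
    have h1 := h'.inside_le {v, x} (by
      have := h'.mem (v, x) (by simp [star, hx])
      intro u hu
      simp only [Finset.mem_insert, Finset.mem_singleton] at hu
      rcases hu with rfl | rfl
      · exact hv
      · exact this.2) (by simp)
    rw [inside_add, inside_star_of_mem (by simp),
      Multiset.countP_eq_card.2 fun y hy => by simp [hall y hy]] at h1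
    have := Finset.card_le_two (a := v) (b := x)
    omega
  obtain ⟨Y', rfl⟩ := Multiset.exists_cons_of_mem hx
  obtain ⟨Z, rfl⟩ := Multiset.exists_cons_of_mem ((Multiset.mem_cons.1 hy).resolve_left hxy.symm)
  simp only [Multiset.card_cons] at h45
  refine h'.mem_of_split (P := {(x, y)}) (Z := Z) ih hb hb' hv hvY ht' hN ?_ (by omega)
    (by simp; omega) (by simp) (by simpa using hxy)
  simp [← Multiset.singleton_add, add_assoc]

theorem mem_boundaries [Fintype V] (h : IsSparse U M) (hb : ∀ v ∉ U, b v = 0)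
    (hb' : ∑ v ∈ U, b v = 0) : b ∈ boundaries M := by
  obtain ⟨n, hn⟩ : ∃ n, U.card = n := ⟨_, rfl⟩
  induction n using Nat.strong_induction_on generalizing U M b with
  | _ n ihn =>
  have ih : ∀ (U' : Finset V) (M' : Multiset (V × V)) (b' : V → ZMod 3), U'.card < U.card →
      IsSparse U' M' → (∀ v ∉ U', b' v = 0) → ∑ v ∈ U', b' v = 0 → b' ∈ boundaries M' :=
    fun U' M' b' hlt h' h1 h2 => ihn _ (hn ▸ hlt) h' h1 h2 rfl
  have hcard := h.card_add
  by_cases hU : U.card = 1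
  · obtain ⟨u, rfl⟩ := Finset.card_eq_one.1 hU
    obtain rfl : M = 0 := Multiset.card_eq_zero.1 (by omega)
    rw [boundaries_zero, Set.mem_singleton_iff]
    funext v
    by_cases hv : v = u
    · simpa [hv] using hb'
    · exact hb v (by simpa using hv)
  by_cases ht : ∃ A ⊆ U, 2 ≤ A.card ∧ A ≠ U ∧ inside M A + 4 = 4 * A.card
  · obtain ⟨A, hA, hA2, hAU, ht⟩ := ht
    exact h.mem_of_tight ih hb hb' hA hA2 hAU ht
  have ht' : ∀ A ⊆ U, 2 ≤ A.card → A ≠ U → inside M A + 4 ≠ 4 * A.card :=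
    fun A hA hA2 hAU htA => ht ⟨A, hA, hA2, hAU, htA⟩
  by_cases hd : ∃ v ∈ U, cut M {v} ≤ 5
  · obtain ⟨v, hv, hd⟩ := hd
    exact h.mem_of_cut_le_five ih hb hb' hv (by omega) ht' hd
  push Not at hd
  refine IsAdmissible.mem_boundaries (U := U) (c := b) (w := 0)
    ⟨by omega, h.mem, hb, hb', ?_, ?_, ?_⟩
  · intro v _
    simpa using isSignSum_zero
  · left
    simp
  intro A hA hne hAU
  left
  simp only [Pi.zero_apply, Finset.sum_const_zero, add_zero]
  have hne' : (U \ A).Nonempty := Finset.sdiff_nonempty.2 fun hUA => hAU (hA.antisymm hUA)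
  have hcut : cut M (U \ A) = cut M A := Multiset.countP_congr rfl fun e he => by
    simp [h.mem e he, not_iff_not]
  have h1 := Finset.card_pos.2 hne
  have h2 := Finset.card_pos.2 hne'
  by_cases hA1 : A.card = 1
  · obtain ⟨v, rfl⟩ := Finset.card_eq_one.1 hA1
    exact hd v (by simpa using hA)
  by_cases hA1' : (U \ A).card = 1
  · obtain ⟨v, hv⟩ := Finset.card_eq_one.1 hA1'
    rw [← hcut, hv]
    exact hd v (Finset.sdiff_subset (s := U) (t := A) (by simp [hv]))
  have h3 := h.cut_add_inside hA
  have h4 := ht' A hA (by omega) hAU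
  have h5 := ht' (U \ A) Finset.sdiff_subset (by omega) (by
    intro heq
    have := Finset.card_sdiff_add_card_eq_card hA
    rw [heq] at this
    omega)
  have h6 := h.inside_le A hA hne
  have h7 := h.inside_le (U \ A) Finset.sdiff_subset hne'
  omega

end IsSparse

end ModThree

namespace Multigraph

open ModThree

variable {V E : Type} (G : Multigraph V E)

/-- The ordered pair of ends of an edge. -/
def ends (e : E) : V × V := (G.fst e, G.snd e)

theorem inside_map_ends [DecidableEq V] (F : Finset E) (A : Finset V) :
    inside (F.val.map G.ends) A = (F.filter fun e => G.fst e ∈ A ∧ G.snd e ∈ A).card := by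
  rw [inside, Multiset.countP_map]
  rfl

theorem exists_crossing_of_reflTransGen {T : Set E} {r z : V}
    (h : Relation.ReflTransGen (G.AdjOn T) r z) {X : Finset V} (hr : r ∈ X) (hz : z ∉ X) :
    ∃ e ∈ T, ∃ u x, u ∈ X ∧ x ∉ X ∧ (G.fst e = u ∧ G.snd e = x ∨ G.fst e = x ∧ G.snd e = u) := by
  by_contra! hcon
  refine hz ?_
  clear hz
  induction h with
  | refl => exact hr
  | @tail y z _ hyz ih =>
    by_contra hz
    obtain ⟨e, he, h⟩ := hyz
    have := hcon e he y z ih hz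
    tauto

theorem ConnectedOn.exists_growth [Fintype V] [DecidableEq V] [DecidableEq E] {T : Set E}
    (h : G.ConnectedOn T) (r : V) {k : ℕ} (hk : k + 1 ≤ Fintype.card V) :
    ∃ (X : Finset V) (F : Finset E), r ∈ X ∧ X.card = k + 1 ∧ ↑F ⊆ T ∧ F.card = k ∧
      (∀ e ∈ F, G.fst e ∈ X ∧ G.snd e ∈ X) ∧
      ∀ A : Finset V, A.Nonempty → inside (F.val.map G.ends) A + 1 ≤ A.card := by
  induction k with
  | zero =>
    exact ⟨{r}, ∅, by simp, by simp, by simp, by simp, by simp, fun A hA => by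
      simpa [inside] using hA.card_pos⟩
  | succ k ih =>
    obtain ⟨X, F, hr, hX, hFT, hF, hFX, hA⟩ := ih (by omega)
    obtain ⟨z, hz⟩ : ∃ z, z ∉ X := by
      by_contra! hall
      rw [Finset.eq_univ_iff_forall.2 hall, Finset.card_univ] at hX
      omega
    obtain ⟨e, heT, u, x, hu, hx, he⟩ :=
      G.exists_crossing_of_reflTransGen (h.2 r trivial z trivial) hr hz
    have heF : e ∉ F := fun heF => by
      have := hFX e heF
      rcases he with ⟨h1, h2⟩ | ⟨h1, h2⟩ <;> simp_all
    have hux : u ≠ x := by rintro rfl; exact hx hu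
    refine ⟨insert x X, insert e F, by simp [hr], by rw [Finset.card_insert_of_notMem hx, hX], ?_,
      by rw [Finset.card_insert_of_notMem heF, hF], ?_, ?_⟩
    · rw [Finset.coe_insert]
      exact Set.insert_subset heT hFT
    · intro f hf
      rcases Finset.mem_insert.1 hf with rfl | hf
      · rcases he with ⟨h1, h2⟩ | ⟨h1, h2⟩ <;> simp [h1, h2, hu]
      · simp [hFX f hf]
    · intro A hne
      have h1 := hA A hne
      rw [Finset.insert_val_of_notMem heF, Multiset.map_cons, inside_cons]
      split_ifs with heA
      · have hxu : x ∈ A ∧ u ∈ A := by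
          simp only [ends] at heA
          rcases he with ⟨h1, h2⟩ | ⟨h1, h2⟩ <;> simp_all
        have h2 := hA (A.erase x) ⟨u, by simp [hux, hxu.2]⟩
        have h3 : inside (F.val.map G.ends) (A.erase x) = inside (F.val.map G.ends) A := by
          refine Multiset.countP_congr rfl fun p hp => ?_
          obtain ⟨f, hf, rfl⟩ := Multiset.mem_map.1 hp
          have hfX := hFX f hf
          have h4 : G.fst f ≠ x := by rintro rfl; exact hx hfX.1
          have h5 : G.snd f ≠ x := by rintro rfl; exact hx hfX.2
          simp [ends, h4, h5]
        rw [Finset.card_erase_of_mem hxu.1] at h2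
        have := hne.card_pos
        omega
      · omega

/-- A connected spanning edge set contains a spanning set of edges that is independent in the
cycle matroid. -/
theorem ConnectedOn.exists_tree [Fintype V] [Nonempty V] [DecidableEq V] [DecidableEq E]
    {T : Set E} (h : G.ConnectedOn T) :
    ∃ F : Finset E, ↑F ⊆ T ∧ F.card + 1 = Fintype.card V ∧
      ∀ A : Finset V, A.Nonempty → inside (F.val.map G.ends) A + 1 ≤ A.card := by
  have hV := Fintype.card_pos (α := V)
  obtain ⟨X, F, -, -, hFT, hF, -, hA⟩ := ConnectedOn.exists_growth G h (Classical.arbitrary V)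
    (k := Fintype.card V - 1) (by omega)
  exact ⟨F, hFT, by omega, hA⟩

theorem HasEdgeDisjointSpanningTrees.exists_isSparse [Fintype V] [Nonempty V] [DecidableEq V]
    [DecidableEq E] (h : G.HasEdgeDisjointSpanningTrees 4) :
    ∃ F : Finset E, IsSparse Finset.univ (F.val.map G.ends) := by
  obtain ⟨T, hT, hdisj⟩ := h
  choose F hFT hF hA using fun i => ConnectedOn.exists_tree G (hT i).1
  have hcard : (Finset.univ.biUnion F).card = ∑ i, (F i).card := by
    refine Finset.card_biUnion fun i _ j _ hij => ?_
    refine Finset.disjoint_coe.1 ?_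
    exact (hdisj i j hij).mono (hFT i) (hFT j)
  refine ⟨Finset.univ.biUnion F, by simp, ?_, fun A _ hne => ?_⟩
  · rw [Multiset.card_map, Finset.card_val, hcard, Finset.card_univ]
    have := hF 0
    have := hF 1
    have := hF 2
    have := hF 3
    simp only [Fin.sum_univ_four]
    omega
  · have h0 := hA 0 A hne
    have h1 := hA 1 A hne
    have h2 := hA 2 A hne
    have h3 := hA 3 A hne
    simp only [inside_map_ends] at *
    rw [Finset.filter_biUnion]
    refine (Nat.add_le_add_right Finset.card_biUnion_le 4).trans ?_
    rw [Fin.sum_univ_four]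
    omega

theorem exists_orientation_of_mem_boundaries [DecidableEq V] {F : Finset E} {b : V → ZMod 3}
    (h : b ∈ boundaries (F.val.map G.ends)) :
    ∃ o : E → Bool, b = ∑ e ∈ F, unitFlow (G.tail o e, G.head o e) := by
  classical
  induction F using Finset.induction_on generalizing b with
  | empty => exact ⟨fun _ => true, by simpa using h⟩
  | insert e F he ih =>
    rw [Finset.insert_val_of_notMem he, Multiset.map_cons] at h
    obtain ⟨x, hx, h⟩ := mem_boundaries_cons.1 h
    obtain ⟨o, ho⟩ := ih h
    refine ⟨Function.update o e (decide (x = 1)), ?_⟩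
    have h1 : ∑ f ∈ F, unitFlow (G.tail (Function.update o e (decide (x = 1))) f,
        G.head (Function.update o e (decide (x = 1))) f) =
        ∑ f ∈ F, unitFlow (G.tail o f, G.head o f) := by
      refine Finset.sum_congr rfl fun f hf => ?_
      have : f ≠ e := by rintro rfl; exact he hf
      simp [tail, head, this]
    rw [Finset.sum_insert he, h1, ← ho]
    rcases zmod_three_cases x with rfl | rfl | rfl
    · exact absurd rfl hx
    · simp [tail, head, ends]
    · have : (-1 : ZMod 3) ≠ 1 := by decide
      simp [tail, head, ends, this, unitFlow_swap (G.snd e)]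

theorem sum_unitFlow_tail_head [Fintype E] [DecidableEq V] (o : E → Bool) (v : V) :
    (∑ e, unitFlow (G.tail o e, G.head o e)) v = (G.outDeg o v : ZMod 3) - G.inDeg o v := by
  have h1 : G.outDeg o v = (Finset.univ.filter fun e => G.tail o e = v).card := by
    rw [outDeg, outDegOn, ← Set.ncard_coe_finset]
    simp
  have h2 : G.inDeg o v = (Finset.univ.filter fun e => G.head o e = v).card := by
    rw [inDeg, ← Set.ncard_coe_finset]
    simp
  rw [h1, h2, Finset.natCast_card_filter, Finset.natCast_card_filter, Finset.sum_apply,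
    ← Finset.sum_sub_distrib]
  simp [unitFlow, Pi.single_apply, eq_comm]

end Multigraph

/-- every graph containing `4` pairwise edge-disjoint spanning
trees admits a nowhere-zero `3`-flow, i.e. an orientation in which
`d⁺(v) ≡ d⁻(v) (mod 3)` at every vertex `v`. -/
theorem nowhere_zero_three_flow_of_four_edge_disjoint_spanning_trees
    {V E : Type} [Fintype V] [Fintype E] (G : Multigraph V E)
    (h : G.HasEdgeDisjointSpanningTrees 4) :
    ∃ o : E → Bool, ∀ v : V, (G.outDeg o v : ZMod 3) = (G.inDeg o v : ZMod 3) := by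
  classical
  rcases isEmpty_or_nonempty V with hV | hV
  · exact ⟨fun _ => true, fun v => hV.elim v⟩
  obtain ⟨F, hF⟩ := Multigraph.HasEdgeDisjointSpanningTrees.exists_isSparse G h
  have huniv : F.val.map G.ends + Fᶜ.val.map G.ends = Finset.univ.val.map G.ends := by
    rw [← Multiset.map_add, ← Finset.disjUnion_val F Fᶜ disjoint_compl_right,
      Finset.disjUnion_eq_union, Finset.union_compl]
  obtain ⟨b, hb, -⟩ := ModThree.exists_mem_boundaries (M := Fᶜ.val.map G.ends) (x := 0) ∅
    (by simpa [ModThree.cut] using ModThree.isSignSum_zero)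
  have hsum : ∑ v, b v = 0 := by
    have := ModThree.isSignSum_cut hb Finset.univ
    rw [ModThree.cut_eq_zero (by simp)] at this
    exact this.eq_zero
  have hb' : -b ∈ ModThree.boundaries (F.val.map G.ends) :=
    hF.mem_boundaries (by simp) (by simp [hsum])
  have h0 := ModThree.add_mem_boundaries hb' hb
  rw [neg_add_cancel, huniv] at h0
  obtain ⟨o, ho⟩ := G.exists_orientation_of_mem_boundaries h0
  refine ⟨o, fun v => sub_eq_zero.1 ?_⟩
  rw [← G.sum_unitFlow_tail_head, ← ho, Pi.zero_apply]
end
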